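/- arXiv:2106.01568 — 2 statements merged into one kernel-verified Lean document; each statement's English description precedes it below -/
import Mathlib

section
/- Fix a > 0, γ ∈ [1,2], ν > 0, constants 0 < ς̲₀ ≤ ς̄₀ and Ē > 0. There exists a positive constant C, depending only on (a, γ, ν, ς̄₀, ς̲₀, Ē), with the following property: for every global smooth solution (η, w) of the 1D isentropic compressible Navier–Stokes system on [0,∞) × T whose initial data satisfy ς̲₀ ≤ η₀ ≤ ς̄₀, ∫_T η₀ dx = 1, ∫_T η₀ w₀ dx = 0 and E₀₀ := ∫_T ( (1/2) η₀ w₀² + P(η₀) ) dx ≤ Ē, one has the space–time bound ∫₀^∞ ∫_T (∂_x² w)²(t,x) dx dt ≤ C E₁₀, where E₁₀ := ‖η₀ − 1‖²_{H¹(T)} + ‖w₀‖²_{H¹(T)}. -/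
open MeasureTheory

/-- The pressure potential `P` associated with the pressure law `p(s) = a s^γ`. -/
noncomputable def Ppot (a γ : ℝ) (s : ℝ) : ℝ :=
  if γ = 1 then a * (s * Real.log s + 1) else a * s ^ γ / (γ - 1)

/-- Square of the Sobolev `H^k` norm on the torus `𝕋 = ℝ/ℤ` of a `1`-periodic
function `f : ℝ → ℝ`: `‖f‖²_{H^k} = ∑_{0 ≤ j ≤ k} ∫_𝕋 (∂ₓ^j f)²`. -/
noncomputable def HSq (k : ℕ) (f : ℝ → ℝ) : ℝ :=
  ∑ j ∈ Finset.range (k + 1), ∫ x in (0:ℝ)..1, (deriv^[j] f x) ^ 2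

section

open Set Function

/-- Partial derivative in the first (time) variable. -/
noncomputable def dT (f : ℝ → ℝ → ℝ) (t x : ℝ) : ℝ := deriv (fun s => f s x) t

/-- Partial derivative in the second (space) variable. -/
noncomputable def dX (f : ℝ → ℝ → ℝ) (t x : ℝ) : ℝ := deriv (f t) x

/-- Joint smoothness of a function of two real variables. -/
def Smooth2 (f : ℝ → ℝ → ℝ) : Prop := ContDiff ℝ (⊤ : ℕ∞) (uncurry f)

section PartialDerivatives

variable {f g : ℝ → ℝ → ℝ} {t x : ℝ}

lemma hasDerivAt_fst_of_differentiableAt (hf : DifferentiableAt ℝ (uncurry f) (t, x)) :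
    HasDerivAt (fun s => f s x) (fderiv ℝ (uncurry f) (t, x) (1, 0)) t :=
  hf.hasFDerivAt.comp_hasDerivAt_of_eq t
    ((hasDerivAt_id t).prodMk (hasDerivAt_const t x)) rfl

lemma hasDerivAt_snd_of_differentiableAt (hf : DifferentiableAt ℝ (uncurry f) (t, x)) :
    HasDerivAt (f t) (fderiv ℝ (uncurry f) (t, x) (0, 1)) x :=
  hf.hasFDerivAt.comp_hasDerivAt_of_eq x
    ((hasDerivAt_const x t).prodMk (hasDerivAt_id x)) rfl

lemma hasDerivAt_dT (hf : DifferentiableAt ℝ (uncurry f) (t, x)) :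
    HasDerivAt (fun s => f s x) (dT f t x) t :=
  (hasDerivAt_fst_of_differentiableAt hf).differentiableAt.hasDerivAt

lemma hasDerivAt_dX (hf : DifferentiableAt ℝ (uncurry f) (t, x)) :
    HasDerivAt (f t) (dX f t x) x :=
  (hasDerivAt_snd_of_differentiableAt hf).differentiableAt.hasDerivAt

lemma continuousAt_dT (hf : ContDiffAt ℝ 1 (uncurry f) (t, x)) :
    ContinuousAt (uncurry (dT f)) (t, x) := by
  have h1 : ContinuousAt (fun p => fderiv ℝ (uncurry f) p (1, 0)) (t, x) :=
    (hf.continuousAt_fderiv (by simp)).clm_apply continuousAt_const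
  refine h1.congr ?_
  filter_upwards [hf.eventually (by simp)] with p hp
  exact (hasDerivAt_fst_of_differentiableAt (t := p.1) (x := p.2)
    (hp.differentiableAt (by simp))).deriv.symm

lemma continuousAt_dX (hf : ContDiffAt ℝ 1 (uncurry f) (t, x)) :
    ContinuousAt (uncurry (dX f)) (t, x) := by
  have h1 : ContinuousAt (fun p => fderiv ℝ (uncurry f) p (0, 1)) (t, x) :=
    (hf.continuousAt_fderiv (by simp)).clm_apply continuousAt_const
  refine h1.congr ?_
  filter_upwards [hf.eventually (by simp)] with p hp
  exact (hasDerivAt_snd_of_differentiableAt (t := p.1) (x := p.2)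
    (hp.differentiableAt (by simp))).deriv.symm

namespace Smooth2

lemma contDiffAt (hf : Smooth2 f) (n : ℕ) (p : ℝ × ℝ) : ContDiffAt ℝ n (uncurry f) p :=
  (ContDiff.of_le hf (by exact_mod_cast le_top)).contDiffAt

lemma differentiableAt (hf : Smooth2 f) (p : ℝ × ℝ) : DifferentiableAt ℝ (uncurry f) p :=
  (hf.contDiffAt 1 p).differentiableAt (by simp)

lemma continuous (hf : Smooth2 f) : Continuous (uncurry f) := ContDiff.continuous hf

lemma continuous_slice (hf : Smooth2 f) (t : ℝ) : Continuous (f t) :=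
  hf.continuous.comp (Continuous.prodMk_right t)

lemma hasDerivAt_fst (hf : Smooth2 f) (t x : ℝ) : HasDerivAt (fun s => f s x) (dT f t x) t :=
  hasDerivAt_dT (hf.differentiableAt _)

lemma hasDerivAt_snd (hf : Smooth2 f) (t x : ℝ) : HasDerivAt (f t) (dX f t x) x :=
  hasDerivAt_dX (hf.differentiableAt _)

lemma dT_eq_fderiv (hf : Smooth2 f) (t x : ℝ) :
    dT f t x = fderiv ℝ (uncurry f) (t, x) (1, 0) :=
  (hasDerivAt_fst_of_differentiableAt (hf.differentiableAt _)).deriv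

lemma dX_eq_fderiv (hf : Smooth2 f) (t x : ℝ) :
    dX f t x = fderiv ℝ (uncurry f) (t, x) (0, 1) :=
  (hasDerivAt_snd_of_differentiableAt (hf.differentiableAt _)).deriv

lemma dT (hf : Smooth2 f) : Smooth2 (dT f) := by
  have h : uncurry (_root_.dT f) = fun p => fderiv ℝ (uncurry f) p (1, 0) := by
    ext ⟨t, x⟩; exact hf.dT_eq_fderiv t x
  rw [Smooth2, h]
  exact (ContDiff.fderiv_right hf (by simp)).clm_apply contDiff_const

lemma dX (hf : Smooth2 f) : Smooth2 (dX f) := by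
  have h : uncurry (_root_.dX f) = fun p => fderiv ℝ (uncurry f) p (0, 1) := by
    ext ⟨t, x⟩; exact hf.dX_eq_fderiv t x
  rw [Smooth2, h]
  exact (ContDiff.fderiv_right hf (by simp)).clm_apply contDiff_const

lemma dT_dX_comm (hf : Smooth2 f) (t x : ℝ) :
    _root_.dT (_root_.dX f) t x = _root_.dX (_root_.dT f) t x := by
  have hd : DifferentiableAt ℝ (fderiv ℝ (uncurry f)) (t, x) :=
    ((hf.contDiffAt 2 (t, x)).fderiv_right (m := 1) (by norm_num)).differentiableAt (by simp)
  have h1 : _root_.dT (_root_.dX f) t x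
      = fderiv ℝ (fderiv ℝ (uncurry f)) (t, x) (1, 0) (0, 1) := by
    have e : (fun s => _root_.dX f s x) = fun s => fderiv ℝ (uncurry f) (s, x) (0, 1) := by
      ext s; exact hf.dX_eq_fderiv s x
    rw [_root_.dT, e]
    have h := (hd.hasFDerivAt.comp_hasDerivAt_of_eq t
      ((hasDerivAt_id t).prodMk (hasDerivAt_const t x)) rfl)
    simpa using (h.clm_apply (hasDerivAt_const t ((0, 1) : ℝ × ℝ))).deriv
  have h2 : _root_.dX (_root_.dT f) t x
      = fderiv ℝ (fderiv ℝ (uncurry f)) (t, x) (0, 1) (1, 0) := by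
    have e : (_root_.dT f t) = fun y => fderiv ℝ (uncurry f) (t, y) (1, 0) := by
      ext y; exact hf.dT_eq_fderiv t y
    rw [_root_.dX, e]
    have h := (hd.hasFDerivAt.comp_hasDerivAt_of_eq x
      ((hasDerivAt_const x t).prodMk (hasDerivAt_id x)) rfl)
    simpa using (h.clm_apply (hasDerivAt_const x ((1, 0) : ℝ × ℝ))).deriv
  rw [h1, h2]
  exact (hf.contDiffAt 2 (t, x)).isSymmSndFDerivAt (by simp) _ _

lemma mul (hf : Smooth2 f) (hg : Smooth2 g) : Smooth2 (fun t x => f t x * g t x) :=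
  ContDiff.mul hf hg

end Smooth2

lemma dX_periodic (hf : ∀ t x, f t (x + 1) = f t x) (t x : ℝ) : dX f t (x + 1) = dX f t x := by
  rw [dX, dX, ← deriv_comp_add_const]
  congr 1
  ext y
  exact hf t y

lemma dT_periodic (hf : ∀ t x, f t (x + 1) = f t x) (t x : ℝ) : dT f t (x + 1) = dT f t x := by
  simp only [dT, hf]

lemma continuous_intervalIntegral_slice (hf : Continuous (uncurry f)) (a b : ℝ) :
    Continuous fun t => ∫ x in a..b, f t x :=
  intervalIntegral.continuous_parametric_intervalIntegral_of_continuous' hf a b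

lemma Smooth2.continuous_integral_sq (hf : Smooth2 f) (a b : ℝ) :
    Continuous fun t => ∫ x in a..b, f t x ^ 2 :=
  continuous_intervalIntegral_slice (f := fun t x => f t x ^ 2)
    (Continuous.fun_pow hf.continuous 2) a b

lemma Smooth2.hasDerivAt_intervalIntegral (hf : Smooth2 f) (a b t : ℝ) :
    HasDerivAt (fun s => ∫ x in a..b, f s x) (∫ x in a..b, _root_.dT f t x) t := by
  obtain ⟨C, hC⟩ := ((isCompact_Icc (a := t - 1) (b := t + 1)).prod
    (isCompact_uIcc (a := a) (b := b))).exists_bound_of_continuousOn hf.dT.continuous.continuousOn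
  refine (intervalIntegral.hasDerivAt_integral_of_dominated_loc_of_deriv_le
    (s := Icc (t - 1) (t + 1)) (bound := fun _ => C) (Icc_mem_nhds (by linarith) (by linarith))
    (Filter.Eventually.of_forall fun s => (hf.continuous_slice s).aestronglyMeasurable)
    ((hf.continuous_slice t).intervalIntegrable a b)
    (hf.dT.continuous_slice t).aestronglyMeasurable ?_ intervalIntegrable_const ?_).2
  · refine Filter.Eventually.of_forall fun x hx s hs => hC (s, x) ⟨hs, uIoc_subset_uIcc hx⟩
  · exact Filter.Eventually.of_forall fun x _ s _ => hf.hasDerivAt_fst s x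

/-- Integrated form of the balance law `∂ₜF + ∂ₓJ = S` for a flux with equal boundary values. -/
lemma integral_balance {F J S : ℝ → ℝ → ℝ}
    (hF : ∀ t x, 0 ≤ t → ContDiffAt ℝ 1 (uncurry F) (t, x))
    (hJ : ∀ t x, 0 ≤ t → ContDiffAt ℝ 1 (uncurry J) (t, x))
    (hper : ∀ t, 0 ≤ t → J t 1 = J t 0)
    (hS : ∀ t x, 0 ≤ t → dT F t x + dX J t x = S t x) {T : ℝ} (hT : 0 ≤ T) :
    IntervalIntegrable (fun t => ∫ x in (0:ℝ)..1, S t x) volume 0 T ∧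
      (∫ x in (0:ℝ)..1, F T x) - (∫ x in (0:ℝ)..1, F 0 x)
        = ∫ t in (0:ℝ)..T, ∫ x in (0:ℝ)..1, S t x := by
  have hcF : ∀ t, 0 ≤ t → Continuous (F t) := fun t ht => by
    rw [continuous_iff_continuousAt]
    intro x
    exact ContinuousAt.comp (f := fun y : ℝ => (t, y)) (hF t x ht).continuousAt (by fun_prop)
  have hcJ : ∀ t, 0 ≤ t → Continuous (dX J t) := fun t ht => by
    rw [continuous_iff_continuousAt]
    intro x
    exact ContinuousAt.comp (f := fun y : ℝ => (t, y)) (continuousAt_dX (hJ t x ht)) (by fun_prop)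
  have hcT : ∀ t, 0 ≤ t → Continuous (dT F t) := fun t ht => by
    rw [continuous_iff_continuousAt]
    intro x
    exact ContinuousAt.comp (f := fun y : ℝ => (t, y)) (continuousAt_dT (hF t x ht)) (by fun_prop)
  have hint : Integrable (uncurry (dT F))
      ((volume.restrict (uIoc 0 T)).prod (volume.restrict (uIoc (0:ℝ) 1))) := by
    rw [Measure.prod_restrict]
    have : IntegrableOn (uncurry (dT F)) (Icc 0 T ×ˢ Icc (0:ℝ) 1) (volume.prod volume) := by
      refine ContinuousOn.integrableOn_compact (isCompact_Icc.prod isCompact_Icc) ?_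
      rintro ⟨t, x⟩ ⟨ht, -⟩
      exact (continuousAt_dT (hF t x ht.1)).continuousWithinAt
    refine this.mono_set (Set.prod_mono ?_ ?_)
    · rw [uIoc_of_le hT]; exact Ioc_subset_Icc_self
    · rw [uIoc_of_le zero_le_one]; exact Ioc_subset_Icc_self
  have hST : ∀ t ∈ uIcc 0 T, ∫ x in (0:ℝ)..1, dT F t x = ∫ x in (0:ℝ)..1, S t x := by
    intro t ht
    rw [uIcc_of_le hT] at ht
    have h0 : ∫ x in (0:ℝ)..1, dX J t x = 0 := by
      rw [intervalIntegral.integral_eq_sub_of_hasDerivAt (f := J t)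
        (fun x _ => hasDerivAt_dX ((hJ t x ht.1).differentiableAt (by simp)))
        ((hcJ t ht.1).intervalIntegrable _ _), hper t ht.1, sub_self]
    calc ∫ x in (0:ℝ)..1, dT F t x
        = (∫ x in (0:ℝ)..1, dT F t x) + ∫ x in (0:ℝ)..1, dX J t x := by rw [h0, add_zero]
      _ = ∫ x in (0:ℝ)..1, (dT F t x + dX J t x) := by
          rw [intervalIntegral.integral_add ((hcT t ht.1).intervalIntegrable _ _)
            ((hcJ t ht.1).intervalIntegrable _ _)]
      _ = _ := by simp only [hS t _ ht.1]
  have hint2 : IntervalIntegrable (fun t => ∫ x in (0:ℝ)..1, dT F t x) volume 0 T := by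
    rw [intervalIntegrable_iff]
    simp only [intervalIntegral.integral_of_le zero_le_one]
    rw [uIoc_of_le (zero_le_one (α := ℝ))] at hint
    exact hint.integral_prod_left
  have hprod : IntegrableOn (uncurry (dT F)) (uIoc 0 T ×ˢ uIoc (0:ℝ) 1) := by
    rwa [Measure.prod_restrict] at hint
  refine ⟨hint2.congr fun t ht => hST t (uIoc_subset_uIcc ht), ?_⟩
  rw [← intervalIntegral.integral_congr hST, intervalIntegral_intervalIntegral_swap hprod,
    ← intervalIntegral.integral_sub ((hcF T hT).intervalIntegrable _ _)
      ((hcF 0 le_rfl).intervalIntegrable _ _)]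
  refine intervalIntegral.integral_congr fun x _ => ?_
  refine (intervalIntegral.integral_eq_sub_of_hasDerivAt (f := fun s => F s x)
    (fun t ht => ?_) ?_).symm
  · rw [uIcc_of_le hT] at ht
    exact hasDerivAt_dT ((hF t x ht.1).differentiableAt (by simp))
  · refine ContinuousOn.intervalIntegrable fun t ht => ?_
    rw [uIcc_of_le hT] at ht
    exact (ContinuousAt.comp (f := fun s : ℝ => (s, x)) (continuousAt_dT (hF t x ht.1))
      (by fun_prop)).continuousWithinAt

end PartialDerivatives

/-- Maximum principle for a transport inequality on the torus. -/
lemma transport_max_principle {M Mt Mx v : ℝ → ℝ → ℝ} {K : ℝ}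
    (hc : ContinuousOn (uncurry M) (Ici 0 ×ˢ univ))
    (hper : ∀ t x, 0 ≤ t → M t (x + 1) = M t x)
    (hMt : ∀ t x, 0 ≤ t → HasDerivAt (fun s => M s x) (Mt t x) t)
    (hMx : ∀ t x, 0 ≤ t → HasDerivAt (M t) (Mx t x) x)
    (hlt : ∀ t x, 0 ≤ t → K < M t x → Mt t x + v t x * Mx t x < 0)
    (h0 : ∀ x, M 0 x ≤ K) (t x : ℝ) (ht : 0 ≤ t) : M t x ≤ K := by
  by_contra! hK
  obtain ⟨⟨t₁, x₁⟩, ⟨ht₁, hx₁⟩, hmax⟩ := ((isCompact_Icc (a := 0) (b := t)).prod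
    (isCompact_Icc (a := (0:ℝ)) (b := 1))).exists_isMaxOn
    ⟨(0, 0), by simp [ht]⟩ (hc.mono (Set.prod_mono (fun s hs => hs.1) (subset_univ _)))
  have hmax' : ∀ s ∈ Icc 0 t, ∀ y, M s y ≤ M t₁ x₁ := by
    intro s hs y
    obtain ⟨z, hz, hyz⟩ := Function.Periodic.exists_mem_Ico₀ (fun y => hper s y hs.1) one_pos y
    rw [hyz]
    exact hmax (show (s, z) ∈ Icc 0 t ×ˢ Icc (0:ℝ) 1 from ⟨hs, hz.1, hz.2.le⟩)
  have hbig : K < M t₁ x₁ := hK.trans_le (hmax' t ⟨ht, le_rfl⟩ x)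
  have ht₁pos : 0 < t₁ := by
    rcases ht₁.1.eq_or_lt with h | h
    · exact absurd (h0 x₁) (by have h' : (0:ℝ) = t₁ := h; rw [h']; exact not_le.2 hbig)
    · exact h
  have hx : Mx t₁ x₁ = 0 := IsLocalMax.hasDerivAt_eq_zero
    (Filter.Eventually.of_forall fun y => hmax' t₁ ht₁ y) (hMx t₁ x₁ ht₁.1)
  have htd : 0 ≤ Mt t₁ x₁ := by
    refine ge_of_tendsto ((hasDerivWithinAt_iff_tendsto_slope' (by simp)).1
      ((hMt t₁ x₁ ht₁.1).hasDerivWithinAt (s := Iio t₁))) ?_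
    filter_upwards [Ioo_mem_nhdsLT ht₁pos] with s hs
    rw [slope_def_field]
    exact div_nonneg_of_nonpos (sub_nonpos.2 (hmax' s ⟨hs.1.le, hs.2.le.trans ht₁.2⟩ x₁))
      (sub_nonpos.2 hs.2.le)
  have := hlt t₁ x₁ ht₁.1 hbig
  rw [hx] at this
  linarith

section UnitInterval

variable {f f' f'' g : ℝ → ℝ}

lemma sq_integral_mul_le (hf : Continuous f) (hg : Continuous g) :
    (∫ x in (0:ℝ)..1, f x * g x) ^ 2
      ≤ (∫ x in (0:ℝ)..1, f x ^ 2) * ∫ x in (0:ℝ)..1, g x ^ 2 := by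
  have key : ∀ l : ℝ, 0 ≤ (∫ x in (0:ℝ)..1, g x ^ 2) * (l * l)
      + (-2 * ∫ x in (0:ℝ)..1, f x * g x) * l + ∫ x in (0:ℝ)..1, f x ^ 2 := by
    intro l
    have h0 : 0 ≤ ∫ x in (0:ℝ)..1, (f x - l * g x) ^ 2 :=
      intervalIntegral.integral_nonneg zero_le_one fun x _ => sq_nonneg _
    have h1 : ∫ x in (0:ℝ)..1, (f x - l * g x) ^ 2
        = ∫ x in (0:ℝ)..1, (f x ^ 2 + (-2 * l) * (f x * g x) + (l * l) * g x ^ 2) :=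
      intervalIntegral.integral_congr fun x _ => by ring
    rw [h1, intervalIntegral.integral_add, intervalIntegral.integral_add,
      intervalIntegral.integral_const_mul, intervalIntegral.integral_const_mul] at h0
    · linarith
    all_goals exact Continuous.intervalIntegrable (by fun_prop) _ _
  have := discrim_le_zero key
  rw [discrim] at this
  nlinarith

lemma pow_four_le_integral_mul_integral (hf : ∀ x, HasDerivAt f (f' x) x) (hf' : Continuous f')
    {x₀ x : ℝ} (hx₀ : x₀ ∈ Icc (0:ℝ) 1) (h₀ : f x₀ = 0) (hx : x ∈ Icc (0:ℝ) 1) :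
    f x ^ 4 ≤ 4 * (∫ x in (0:ℝ)..1, f x ^ 2) * ∫ x in (0:ℝ)..1, f' x ^ 2 := by
  have hfc : Continuous f := continuous_iff_continuousAt.2 fun x => (hf x).continuousAt
  have h1 : ∫ y in x₀..x, 2 * (f y * f' y) = f x ^ 2 := by
    rw [intervalIntegral.integral_eq_sub_of_hasDerivAt (f := fun y => f y ^ 2)
      (fun y _ => by
        refine ((hf y).pow 2).congr_deriv ?_
        push_cast
        ring)
      (Continuous.intervalIntegrable (by fun_prop) _ _), h₀]
    ring
  have h2 : f x ^ 2 ≤ ∫ y in (0:ℝ)..1, |f y| * (2 * |f' y|) := by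
    have hsub : uIoc x₀ x ⊆ Ioc (0:ℝ) 1 := by
      intro y hy
      rw [mem_uIoc] at hy
      rcases hy with hy | hy
      · exact ⟨hx₀.1.trans_lt hy.1, hy.2.trans hx.2⟩
      · exact ⟨hx.1.trans_lt hy.1, hy.2.trans hx₀.2⟩
    calc f x ^ 2 ≤ ‖∫ y in x₀..x, 2 * (f y * f' y)‖ := by rw [h1]; exact le_abs_self _
      _ ≤ ∫ y in uIoc x₀ x, ‖2 * (f y * f' y)‖ :=
          intervalIntegral.norm_integral_le_integral_norm_uIoc
      _ ≤ ∫ y in Ioc (0:ℝ) 1, ‖2 * (f y * f' y)‖ := by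
          refine setIntegral_mono_set ?_ ?_ hsub.eventuallyLE
          · exact (Continuous.integrableOn_Icc (by fun_prop)).mono_set Ioc_subset_Icc_self
          · exact Filter.Eventually.of_forall fun y => norm_nonneg _
      _ = ∫ y in (0:ℝ)..1, |f y| * (2 * |f' y|) := by
          rw [intervalIntegral.integral_of_le zero_le_one]
          refine integral_congr_ae (Filter.Eventually.of_forall fun y => ?_)
          simp only [Real.norm_eq_abs, abs_mul, abs_two]
          ring
  calc f x ^ 4 = (f x ^ 2) ^ 2 := by ring
    _ ≤ (∫ y in (0:ℝ)..1, |f y| * (2 * |f' y|)) ^ 2 := by gcongr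
    _ ≤ (∫ y in (0:ℝ)..1, |f y| ^ 2) * ∫ y in (0:ℝ)..1, (2 * |f' y|) ^ 2 :=
        sq_integral_mul_le (by fun_prop) (by fun_prop)
    _ = _ := by
        simp only [mul_pow, sq_abs, intervalIntegral.integral_const_mul]
        ring

lemma exists_zero_of_integral_mul_eq_zero {r : ℝ → ℝ} (hr : Continuous r) (hf : Continuous f)
    (hpos : ∀ x, 0 < r x) (h : ∫ x in (0:ℝ)..1, r x * f x = 0) :
    ∃ x ∈ Icc (0:ℝ) 1, f x = 0 := by
  have hi : IntervalIntegrable (fun x => r x * f x) volume 0 1 :=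
    Continuous.intervalIntegrable (by fun_prop) _ _
  have h1 : ∃ x ∈ Ioo (0:ℝ) 1, f x ≤ 0 := by
    by_contra! hc
    have := intervalIntegral.intervalIntegral_pos_of_pos_on hi
      (fun x hx => mul_pos (hpos x) (hc x hx)) zero_lt_one
    linarith
  have h2 : ∃ x ∈ Ioo (0:ℝ) 1, 0 ≤ f x := by
    by_contra! hc
    have := intervalIntegral.intervalIntegral_pos_of_pos_on hi.neg
      (fun x hx => neg_pos.2 (mul_neg_of_pos_of_neg (hpos x) (hc x hx))) zero_lt_one
    have h0 : ∫ x in (0:ℝ)..1, (-fun x => r x * f x) x = -∫ x in (0:ℝ)..1, r x * f x :=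
      intervalIntegral.integral_neg
    linarith
  obtain ⟨x₁, hx₁, hf₁⟩ := h1
  obtain ⟨x₂, hx₂, hf₂⟩ := h2
  obtain ⟨x, hx, hfx⟩ := intermediate_value_uIcc (a := x₁) (b := x₂) hf.continuousOn
    (show (0:ℝ) ∈ uIcc (f x₁) (f x₂) from mem_uIcc.2 (Or.inl ⟨hf₁, hf₂⟩))
  exact ⟨x, (uIcc_subset_Icc (Ioo_subset_Icc_self hx₁) (Ioo_subset_Icc_self hx₂)) hx, hfx⟩

lemma integral_sq_mul_sq_le (hf : ∀ x, HasDerivAt f (f' x) x) (hf' : ∀ x, HasDerivAt f' (f'' x) x)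
    (hf'' : Continuous f'') (hper : f 1 = f 0) (hper' : f' 1 = f' 0)
    (hz : ∃ x ∈ Icc (0:ℝ) 1, f x = 0) {δ : ℝ} (hδ : 0 < δ) :
    ∫ x in (0:ℝ)..1, f x ^ 2 * f' x ^ 2 ≤ δ ^ 2 / 4 * (∫ x in (0:ℝ)..1, f'' x ^ 2)
      + 4 / (9 * δ ^ 2) * (∫ x in (0:ℝ)..1, f x ^ 2) ^ 2 * ∫ x in (0:ℝ)..1, f' x ^ 2 := by
  have hfc : Continuous f := continuous_iff_continuousAt.2 fun x => (hf x).continuousAt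
  have hfc' : Continuous f' := continuous_iff_continuousAt.2 fun x => (hf' x).continuousAt
  obtain ⟨x₀, hx₀, h₀⟩ := hz
  have hparts : ∫ x in (0:ℝ)..1, f x ^ 2 * f' x ^ 2
      = ∫ x in (0:ℝ)..1, -(1 / 3) * (f x ^ 3 * f'' x) := by
    have h0 : ∫ x in (0:ℝ)..1, (f x ^ 2 * f' x ^ 2 + 1 / 3 * (f x ^ 3 * f'' x)) = 0 := by
      rw [intervalIntegral.integral_eq_sub_of_hasDerivAt (f := fun y => 1 / 3 * (f y ^ 3 * f' y))
        (fun y _ => by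
          refine (((hf y).pow 3).mul (hf' y)).const_mul (1 / 3) |>.congr_deriv ?_
          simp only [Pi.pow_apply]
          push_cast
          ring)
        (Continuous.intervalIntegrable (by fun_prop) _ _), hper, hper']
      ring
    rw [intervalIntegral.integral_add (Continuous.intervalIntegrable (by fun_prop) _ _)
      (Continuous.intervalIntegrable (by fun_prop) _ _)] at h0
    simp only [intervalIntegral.integral_const_mul] at h0 ⊢
    linarith
  rw [hparts]
  set K := ∫ x in (0:ℝ)..1, f x ^ 2
  set Y := ∫ x in (0:ℝ)..1, f' x ^ 2
  have hbound : ∀ x ∈ Icc (0:ℝ) 1, -(1 / 3) * (f x ^ 3 * f'' x)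
      ≤ δ ^ 2 / 4 * f'' x ^ 2 + 4 / (9 * δ ^ 2) * K * Y * f x ^ 2 := by
    intro x hx
    have h4 : f x ^ 4 ≤ 4 * K * Y := pow_four_le_integral_mul_integral hf hfc' hx₀ h₀ hx
    have h6 : f x ^ 6 / (9 * δ ^ 2) ≤ 4 / (9 * δ ^ 2) * K * Y * f x ^ 2 := by
      calc f x ^ 6 / (9 * δ ^ 2) = f x ^ 4 * (f x ^ 2 / (9 * δ ^ 2)) := by ring
        _ ≤ 4 * K * Y * (f x ^ 2 / (9 * δ ^ 2)) := by gcongr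
        _ = _ := by ring
    have hsq : 0 ≤ (δ / 2 * f'' x + f x ^ 3 / (3 * δ)) ^ 2 := sq_nonneg _
    have he : (δ / 2 * f'' x + f x ^ 3 / (3 * δ)) ^ 2
        = δ ^ 2 / 4 * f'' x ^ 2 + 1 / 3 * (f x ^ 3 * f'' x) + f x ^ 6 / (9 * δ ^ 2) := by
      field_simp
      ring
    linarith
  calc ∫ x in (0:ℝ)..1, -(1 / 3) * (f x ^ 3 * f'' x)
      ≤ ∫ x in (0:ℝ)..1, (δ ^ 2 / 4 * f'' x ^ 2 + 4 / (9 * δ ^ 2) * K * Y * f x ^ 2) :=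
        intervalIntegral.integral_mono_on zero_le_one
          (Continuous.intervalIntegrable (by fun_prop) _ _)
          (Continuous.intervalIntegrable (by fun_prop) _ _) hbound
    _ = _ := by
        rw [intervalIntegral.integral_add (Continuous.intervalIntegrable (by fun_prop) _ _)
          (Continuous.intervalIntegrable (by fun_prop) _ _)]
        simp only [intervalIntegral.integral_const_mul]
        ring

end UnitInterval

section RelativePotential

/-- The pressure potential relative to the constant density `1`. -/
noncomputable def relPot (a γ s : ℝ) : ℝ :=
  if γ = 1 then a * (s * Real.log s - s + 1) else a * (s ^ γ - 1 - γ * (s - 1)) / (γ - 1)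

/-- The derivative of `relPot a γ`. -/
noncomputable def relPotDeriv (a γ s : ℝ) : ℝ :=
  if γ = 1 then a * Real.log s else a * γ * (s ^ (γ - 1) - 1) / (γ - 1)

variable {a γ s : ℝ}

lemma hasDerivAt_relPot (hs : 0 < s) : HasDerivAt (relPot a γ) (relPotDeriv a γ s) s := by
  by_cases hγ : γ = 1
  · have e : relPot a γ = fun s => a * (s * Real.log s - s + 1) := by
      ext s; simp [relPot, hγ]
    rw [e, relPotDeriv, if_pos hγ]
    have := (((Real.hasDerivAt_mul_log hs.ne').sub (hasDerivAt_id s)).add_const 1).const_mul a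
    exact this.congr_deriv (by ring)
  · have e : relPot a γ = fun s => a * (s ^ γ - 1 - γ * (s - 1)) / (γ - 1) := by
      ext s; simp [relPot, hγ]
    rw [e, relPotDeriv, if_neg hγ]
    have := (((((Real.hasDerivAt_rpow_const (p := γ) (Or.inl hs.ne')).sub_const 1).sub
      (((hasDerivAt_id s).sub_const 1).const_mul γ))).const_mul a).div_const (γ - 1)
    exact this.congr_deriv (by ring)

lemma hasDerivAt_relPotDeriv (hs : 0 < s) :
    HasDerivAt (relPotDeriv a γ) (a * γ * s ^ (γ - 2)) s := by
  by_cases hγ : γ = 1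
  · have e : relPotDeriv a γ = fun s => a * Real.log s := by
      ext s; simp [relPotDeriv, hγ]
    rw [e, hγ, show (1 - 2 : ℝ) = -1 by norm_num, Real.rpow_neg_one, mul_one]
    exact (Real.hasDerivAt_log hs.ne').const_mul a
  · have e : relPotDeriv a γ = fun s => a * γ * (s ^ (γ - 1) - 1) / (γ - 1) := by
      ext s; simp [relPotDeriv, hγ]
    rw [e]
    have := (((Real.hasDerivAt_rpow_const (p := γ - 1) (Or.inl hs.ne')).sub_const 1).const_mul
      (a * γ)).div_const (γ - 1)
    refine this.congr_deriv ?_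
    have h1 : γ - 1 ≠ 0 := sub_ne_zero.2 hγ
    rw [show γ - 1 - 1 = γ - 2 by ring]
    field_simp

lemma contDiffAt_relPot (hs : 0 < s) : ContDiffAt ℝ 1 (relPot a γ) s := by
  unfold relPot
  split_ifs
  · have := hs.ne'
    fun_prop (disch := assumption)
  · have h := Real.contDiffAt_rpow_const_of_ne (p := γ) (n := 1) hs.ne'
    fun_prop

lemma relPot_one : relPot a γ 1 = 0 := by simp [relPot]

lemma relPotDeriv_one : relPotDeriv a γ 1 = 0 := by simp [relPotDeriv]

lemma mul_relPotDeriv_sub_relPot (hs : 0 < s) :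
    s * relPotDeriv a γ s - relPot a γ s = a * s ^ γ - a := by
  unfold relPot relPotDeriv
  split_ifs with hγ
  · rw [hγ, Real.rpow_one]; ring
  · have h1 : γ - 1 ≠ 0 := sub_ne_zero.2 hγ
    have h2 : s ^ (γ - 1) = s ^ γ / s := Real.rpow_sub_one hs.ne' γ
    rw [h2]
    field_simp
    ring

lemma pressure_eq_relPot :
    a * s ^ γ = (γ - 1) * relPot a γ s + a + a * γ * (s - 1) := by
  unfold relPot
  split_ifs with hγ
  · rw [hγ, Real.rpow_one]; ring
  · have h1 : γ - 1 ≠ 0 := sub_ne_zero.2 hγ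
    field_simp
    ring

lemma relPot_eq_Ppot : ∃ c d, 0 ≤ a → 1 ≤ γ → 0 ≤ c ∧ ∀ s,
    relPot a γ s = Ppot a γ s - c - d * (s - 1) := by
  by_cases hγ : γ = 1
  · refine ⟨a, a, fun ha _ => ⟨ha, fun s => ?_⟩⟩
    simp only [relPot, Ppot, if_pos hγ]
    ring
  · refine ⟨a / (γ - 1), a * γ / (γ - 1), fun ha h => ⟨div_nonneg ha (by linarith), fun s => ?_⟩⟩
    have h1 : γ - 1 ≠ 0 := sub_ne_zero.2 hγ
    simp only [relPot, Ppot, if_neg hγ]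
    field_simp

lemma relPot_taylor (hs : 0 < s) : ∃ ξ ∈ uIcc 1 s, ∃ θ ∈ Icc (0:ℝ) 1,
    relPot a γ s = a * γ * ξ ^ (γ - 2) * θ * (s - 1) ^ 2 := by
  have hcont : ContinuousOn (relPot a γ) (Ioi 0) := fun x hx =>
    (hasDerivAt_relPot hx).continuousAt.continuousWithinAt
  have hcont' : ContinuousOn (relPotDeriv a γ) (Ioi 0) := fun x hx =>
    (hasDerivAt_relPotDeriv hx).continuousAt.continuousWithinAt
  rcases lt_trichotomy s 1 with h | h | h
  · obtain ⟨x, hx, hxe⟩ := exists_hasDerivAt_eq_slope (relPot a γ) (relPotDeriv a γ) h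
      (hcont.mono fun y hy => hs.trans_le hy.1)
      (fun y hy => hasDerivAt_relPot (hs.trans hy.1))
    obtain ⟨ξ, hξ, hξe⟩ := exists_hasDerivAt_eq_slope (relPotDeriv a γ)
      (fun y => a * γ * y ^ (γ - 2)) hx.2
      (hcont'.mono fun y hy => (hs.trans hx.1).trans_le hy.1)
      (fun y hy => hasDerivAt_relPotDeriv ((hs.trans hx.1).trans hy.1))
    have hxd : 1 - x ≠ 0 := by linarith [hx.2]
    have hsd : 1 - s ≠ 0 := by linarith
    refine ⟨ξ, mem_uIcc.2 (Or.inr ⟨by linarith [hξ.1, hx.1], hξ.2.le⟩), (1 - x) / (1 - s),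
      ⟨div_nonneg (by linarith [hx.2]) (by linarith), ?_⟩, ?_⟩
    · rw [div_le_one (by linarith)]; linarith [hx.1]
    · rw [relPot_one] at hxe
      rw [relPotDeriv_one] at hξe
      rw [hξe]
      rw [hxe]
      field_simp
      ring
  · refine ⟨1, by simp, 0, by simp, ?_⟩
    rw [h, relPot_one]; ring
  · obtain ⟨x, hx, hxe⟩ := exists_hasDerivAt_eq_slope (relPot a γ) (relPotDeriv a γ) h
      (hcont.mono fun y hy => zero_lt_one.trans_le hy.1)
      (fun y hy => hasDerivAt_relPot (zero_lt_one.trans hy.1))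
    obtain ⟨ξ, hξ, hξe⟩ := exists_hasDerivAt_eq_slope (relPotDeriv a γ)
      (fun y => a * γ * y ^ (γ - 2)) hx.1
      (hcont'.mono fun y hy => zero_lt_one.trans_le hy.1)
      (fun y hy => hasDerivAt_relPotDeriv (zero_lt_one.trans hy.1))
    have hxd : x - 1 ≠ 0 := by linarith [hx.1]
    have hsd : s - 1 ≠ 0 := by linarith
    refine ⟨ξ, mem_uIcc.2 (Or.inl ⟨hξ.1.le, by linarith [hξ.2, hx.2]⟩), (x - 1) / (s - 1),
      ⟨div_nonneg (by linarith [hx.1]) (by linarith), ?_⟩, ?_⟩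
    · rw [div_le_one (by linarith)]; linarith [hx.2]
    · rw [relPot_one] at hxe
      rw [relPotDeriv_one] at hξe
      rw [hξe]
      rw [hxe]
      field_simp
      ring

lemma relPot_nonneg (ha : 0 ≤ a) (hγ : 0 ≤ γ) (hs : 0 < s) : 0 ≤ relPot a γ s := by
  obtain ⟨ξ, hξ, θ, hθ, h⟩ := relPot_taylor (a := a) (γ := γ) hs
  have hξ0 : 0 ≤ ξ := (lt_min one_pos hs).le.trans hξ.1
  have := hθ.1
  rw [h]
  positivity

lemma relPot_le (ha : 0 ≤ a) (hγ : 0 ≤ γ) (hγ2 : γ ≤ 2) {m : ℝ} (hm : 0 < m) (hm1 : m ≤ 1)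
    (hs : m ≤ s) : relPot a γ s ≤ a * γ * m ^ (γ - 2) * (s - 1) ^ 2 := by
  obtain ⟨ξ, hξ, θ, hθ, h⟩ := relPot_taylor (a := a) (γ := γ) (hm.trans_le hs)
  have hξm : m ≤ ξ := (le_min hm1 hs).trans hξ.1
  have h1 : ξ ^ (γ - 2) ≤ m ^ (γ - 2) := Real.rpow_le_rpow_of_nonpos hm hξm (by linarith)
  have h2 : 0 ≤ ξ ^ (γ - 2) := Real.rpow_nonneg (hm.le.trans hξm) _
  rw [h]
  have h3 : ξ ^ (γ - 2) * θ ≤ m ^ (γ - 2) := by nlinarith [hθ.1, hθ.2]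
  calc a * γ * ξ ^ (γ - 2) * θ * (s - 1) ^ 2 = a * γ * (ξ ^ (γ - 2) * θ) * (s - 1) ^ 2 := by ring
    _ ≤ _ := by gcongr

end RelativePotential

/-- Smooth solutions of the isentropic Navier–Stokes system on `[0,∞) × 𝕋`, of total mass `1` and
total momentum `0`, with the differential equations in expanded form. -/
structure IsFlow (a γ ν : ℝ) (η w : ℝ → ℝ → ℝ) : Prop where
  smooth_density : Smooth2 η
  smooth_velocity : Smooth2 w
  periodic_density : ∀ t x, η t (x + 1) = η t x
  periodic_velocity : ∀ t x, w t (x + 1) = w t x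
  pos : ∀ t x, 0 ≤ t → 0 < η t x
  mass_eq : ∀ t x, 0 ≤ t → dT η t x = -(dX η t x * w t x + η t x * dX w t x)
  momentum_eq : ∀ t x, 0 ≤ t → η t x * (dT w t x + w t x * dX w t x)
    = ν * dX (dX w) t x - a * γ * η t x ^ (γ - 1) * dX η t x
  mass_zero : ∫ x in (0:ℝ)..1, η 0 x = 1
  momentum_zero : ∫ x in (0:ℝ)..1, η 0 x * w 0 x = 0

/-- Density of the energy relative to the constant state `(1, 0)`. -/
noncomputable def energyDensity (a γ : ℝ) (η w : ℝ → ℝ → ℝ) (t x : ℝ) : ℝ :=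
  1 / 2 * η t x * w t x ^ 2 + relPot a γ (η t x)

/-- The effective velocity `w + ν ∂ₓη / η²` of Bresch and Desjardins. -/
noncomputable def effVelocity (ν : ℝ) (η w : ℝ → ℝ → ℝ) (t x : ℝ) : ℝ :=
  w t x + ν * dX η t x / η t x ^ 2

/-- The (negative) momentum flux `ν ∂ₓw - p(η) - η w²`. -/
noncomputable def stress (a γ ν : ℝ) (η w : ℝ → ℝ → ℝ) (t x : ℝ) : ℝ :=
  ν * dX w t x - a * η t x ^ γ - η t x * w t x ^ 2

lemma hasDerivAt_relPot_comp {a γ : ℝ} {f : ℝ → ℝ} {f' t : ℝ} (h : 0 < f t)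
    (hf : HasDerivAt f f' t) :
    HasDerivAt (fun s => relPot a γ (f s)) (relPotDeriv a γ (f t) * f') t :=
  (hasDerivAt_relPot h).comp t hf

namespace IsFlow

variable {a γ ν : ℝ} {η w : ℝ → ℝ → ℝ} {t x T : ℝ}

lemma hasDerivAt_pressure_snd (F : IsFlow a γ ν η w) (ht : 0 ≤ t) :
    HasDerivAt (fun y => a * η t y ^ γ) (a * γ * η t x ^ (γ - 1) * dX η t x) x :=
  ((F.smooth_density.hasDerivAt_snd t x).rpow_const (Or.inl (F.pos t x ht).ne')).const_mul a
    |>.congr_deriv (by ring)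

lemma contDiffAt_pressure (F : IsFlow a γ ν η w) (ht : 0 ≤ t) :
    ContDiffAt ℝ 1 (fun p : ℝ × ℝ => a * η p.1 p.2 ^ γ) (t, x) :=
  contDiffAt_const.mul
    (ContDiffAt.rpow_const_of_ne (F.smooth_density.contDiffAt 1 (t, x)) (F.pos t x ht).ne')

lemma contDiffAt_stress (F : IsFlow a γ ν η w) (ht : 0 ≤ t) :
    ContDiffAt ℝ 1 (uncurry (stress a γ ν η w)) (t, x) :=
  ((contDiffAt_const.mul (F.smooth_velocity.dX.contDiffAt 1 (t, x))).sub
    (F.contDiffAt_pressure ht)).sub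
    (ContDiffAt.mul (F.smooth_density.contDiffAt 1 (t, x))
      (ContDiffAt.pow (F.smooth_velocity.contDiffAt 1 (t, x)) 2))

lemma contDiffAt_energyDensity (F : IsFlow a γ ν η w) (ht : 0 ≤ t) :
    ContDiffAt ℝ 1 (uncurry (energyDensity a γ η w)) (t, x) :=
  ((contDiffAt_const.mul (F.smooth_density.contDiffAt 1 (t, x))).mul
    (ContDiffAt.pow (F.smooth_velocity.contDiffAt 1 (t, x)) 2)).add
    (ContDiffAt.comp (f := fun p : ℝ × ℝ => η p.1 p.2) (t, x) (contDiffAt_relPot (F.pos t x ht))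
      (F.smooth_density.contDiffAt 1 (t, x)))

lemma contDiffAt_effVelocity (F : IsFlow a γ ν η w) (ht : 0 ≤ t) :
    ContDiffAt ℝ 1 (uncurry (effVelocity ν η w)) (t, x) :=
  ContDiffAt.add (F.smooth_velocity.contDiffAt 1 (t, x))
    ((contDiffAt_const.mul (F.smooth_density.dX.contDiffAt 1 (t, x))).div
      (ContDiffAt.pow (F.smooth_density.contDiffAt 1 (t, x)) 2) (pow_pos (F.pos t x ht) 2).ne')

lemma dT_momentum (F : IsFlow a γ ν η w) (ht : 0 ≤ t) :
    dT (fun t x => η t x * w t x) t x = dX (stress a γ ν η w) t x := by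
  have h1 := ((F.smooth_density.hasDerivAt_fst t x).mul
    (F.smooth_velocity.hasDerivAt_fst t x)).deriv
  have h2 := ((((F.smooth_velocity.dX.hasDerivAt_snd t x).const_mul ν).sub
    (F.hasDerivAt_pressure_snd ht)).sub ((F.smooth_density.hasDerivAt_snd t x).mul
      ((F.smooth_velocity.hasDerivAt_snd t x).pow 2))).deriv
  refine h1.trans (Eq.trans ?_ h2.symm)
  simp only [Pi.pow_apply]
  push_cast
  linear_combination w t x * F.mass_eq t x ht + F.momentum_eq t x ht

lemma periodic_stress (F : IsFlow a γ ν η w) : stress a γ ν η w t (x + 1) = stress a γ ν η w t x := by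
  simp only [stress, F.periodic_density, F.periodic_velocity, dX_periodic F.periodic_velocity]

lemma integral_density (F : IsFlow a γ ν η w) (hT : 0 ≤ T) : ∫ x in (0:ℝ)..1, η T x = 1 := by
  have h := (integral_balance (F := η) (J := fun t x => η t x * w t x) (S := fun _ _ => 0)
    (fun t x _ => F.smooth_density.contDiffAt 1 _)
    (fun t x _ => (F.smooth_density.mul F.smooth_velocity).contDiffAt 1 _)
    (fun t _ => by
      have h1 := F.periodic_density t 0
      have h2 := F.periodic_velocity t 0
      simp only [zero_add] at h1 h2
      simp only [h1, h2])
    (fun t x ht => by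
      have h2 := ((F.smooth_density.hasDerivAt_snd t x).mul
        (F.smooth_velocity.hasDerivAt_snd t x)).deriv
      have h3 : dX (fun t x => η t x * w t x) t x = _ := h2
      rw [h3, F.mass_eq t x ht]
      ring) hT).2
  rw [F.mass_zero] at h
  simp only [intervalIntegral.integral_zero] at h
  linarith

lemma integral_momentum (F : IsFlow a γ ν η w) (hT : 0 ≤ T) :
    ∫ x in (0:ℝ)..1, η T x * w T x = 0 := by
  have h := (integral_balance (F := fun t x => η t x * w t x)
    (J := fun t x => -stress a γ ν η w t x) (S := fun _ _ => 0)
    (fun t x _ => (F.smooth_density.mul F.smooth_velocity).contDiffAt 1 _)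
    (fun t x ht => (F.contDiffAt_stress ht).neg)
    (fun t _ => by
      have h1 := F.periodic_stress (t := t) (x := 0)
      simp only [zero_add] at h1
      simp only [h1])
    (fun t x ht => by
      have h3 : dX (fun t x => -stress a γ ν η w t x) t x = -dX (stress a γ ν η w) t x :=
        deriv.fun_neg
      rw [h3, F.dT_momentum ht]
      ring) hT).2
  rw [F.momentum_zero] at h
  simp only [intervalIntegral.integral_zero] at h
  linarith

lemma energy_local (F : IsFlow a γ ν η w) (ht : 0 ≤ t) :
    dT (energyDensity a γ η w) t x + dX (fun t x => w t x * (energyDensity a γ η w t x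
      + a * η t x ^ γ - a - ν * dX w t x)) t x = -ν * dX w t x ^ 2 := by
  have hp := F.pos t x ht
  have rt := F.smooth_density.hasDerivAt_fst t x
  have rx := F.smooth_density.hasDerivAt_snd t x
  have ut := F.smooth_velocity.hasDerivAt_fst t x
  have ux := F.smooth_velocity.hasDerivAt_snd t x
  have uxx := F.smooth_velocity.dX.hasDerivAt_snd t x
  have h1 : dT (energyDensity a γ η w) t x = _ :=
    (((rt.const_mul (1 / 2)).mul (ut.pow 2)).add
      (hasDerivAt_relPot_comp (a := a) (γ := γ) hp rt)).deriv
  have hEx : HasDerivAt (energyDensity a γ η w t) _ x := ((rx.const_mul (1 / 2)).mul (ux.pow 2)).add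
      (hasDerivAt_relPot_comp (a := a) (γ := γ) hp rx)
  have h2 : dX (fun t x => w t x * (energyDensity a γ η w t x
      + a * η t x ^ γ - a - ν * dX w t x)) t x = _ :=
    (ux.mul (((hEx.add (F.hasDerivAt_pressure_snd ht)).sub_const a).sub (uxx.const_mul ν))).deriv
  rw [h1, h2]
  simp only [Pi.pow_apply, Pi.add_apply, Pi.sub_apply, energyDensity]
  push_cast
  linear_combination (1 / 2 * w t x ^ 2 + relPotDeriv a γ (η t x)) * F.mass_eq t x ht
    + w t x * F.momentum_eq t x ht
    - dX w t x * mul_relPotDeriv_sub_relPot (a := a) (γ := γ) hp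

lemma energy_identity (F : IsFlow a γ ν η w) (hT : 0 ≤ T) :
    (∫ x in (0:ℝ)..1, energyDensity a γ η w T x)
      + ν * (∫ t in (0:ℝ)..T, ∫ x in (0:ℝ)..1, dX w t x ^ 2)
      = ∫ x in (0:ℝ)..1, energyDensity a γ η w 0 x := by
  have h := (integral_balance (F := energyDensity a γ η w)
    (J := fun t x => w t x * (energyDensity a γ η w t x + a * η t x ^ γ - a - ν * dX w t x))
    (S := fun t x => -ν * dX w t x ^ 2)
    (fun t x ht => F.contDiffAt_energyDensity ht)
    (fun t x ht => ContDiffAt.mul (F.smooth_velocity.contDiffAt 1 (t, x))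
      ((((F.contDiffAt_energyDensity ht).add (F.contDiffAt_pressure ht)).sub
        contDiffAt_const).sub
        (contDiffAt_const.mul (F.smooth_velocity.dX.contDiffAt 1 (t, x)))))
    (fun t _ => by
      have h1 := F.periodic_density t 0
      have h2 := F.periodic_velocity t 0
      have h3 := dX_periodic F.periodic_velocity t 0
      simp only [zero_add] at h1 h2 h3
      simp only [energyDensity, h1, h2, h3])
    (fun t x ht => F.energy_local ht) hT).2
  simp only [intervalIntegral.integral_const_mul] at h
  linarith

lemma dT_dX_density (F : IsFlow a γ ν η w) (ht : 0 ≤ t) :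
    dT (dX η) t x = -(dX (dX η) t x * w t x + 2 * dX η t x * dX w t x
      + η t x * dX (dX w) t x) := by
  rw [F.smooth_density.dT_dX_comm]
  have e : dT η t = fun y => -(dX η t y * w t y + η t y * dX w t y) :=
    funext fun y => F.mass_eq t y ht
  have h := (((F.smooth_density.dX.hasDerivAt_snd t x).mul
    (F.smooth_velocity.hasDerivAt_snd t x)).add ((F.smooth_density.hasDerivAt_snd t x).mul
    (F.smooth_velocity.dX.hasDerivAt_snd t x))).neg.deriv
  rw [dX, e]
  refine h.trans ?_
  ring

lemma effVelocity_local (F : IsFlow a γ ν η w) (ht : 0 ≤ t) :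
    η t x * (dT (effVelocity ν η w) t x + w t x * dX (effVelocity ν η w) t x)
      = -(a * γ * η t x ^ (γ - 1) * dX η t x) := by
  have hp := F.pos t x ht
  have hp2 : η t x ^ 2 ≠ 0 := (pow_pos hp 2).ne'
  have rt := F.smooth_density.hasDerivAt_fst t x
  have rx := F.smooth_density.hasDerivAt_snd t x
  have rxt := F.smooth_density.dX.hasDerivAt_fst t x
  have rxx := F.smooth_density.dX.hasDerivAt_snd t x
  have ut := F.smooth_velocity.hasDerivAt_fst t x
  have ux := F.smooth_velocity.hasDerivAt_snd t x
  have h1 : dT (effVelocity ν η w) t x = _ :=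
    (ut.add ((rxt.const_mul ν).div (rt.pow 2) hp2)).deriv
  have h2 : dX (effVelocity ν η w) t x = _ :=
    (ux.add ((rxx.const_mul ν).div (rx.pow 2) hp2)).deriv
  have hm := F.momentum_eq t x ht
  rw [h1, h2, F.dT_dX_density ht, F.mass_eq t x ht]
  have hut : dT w t x = (ν * dX (dX w) t x - a * γ * η t x ^ (γ - 1) * dX η t x) / η t x
      - w t x * dX w t x := by
    rw [← hm]
    field_simp
    ring
  rw [hut]
  have hp0 := hp.ne'
  simp only [Pi.pow_apply]
  push_cast
  field_simp
  ring

lemma bd_local (F : IsFlow a γ ν η w) (ht : 0 ≤ t) :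
    dT (energyDensity a γ η (effVelocity ν η w)) t x
      + dX (fun t x => w t x * (energyDensity a γ η (effVelocity ν η w) t x
        + a * η t x ^ γ - a)) t x
      = -(ν * (a * γ * η t x ^ (γ - 1)) / η t x ^ 2) * dX η t x ^ 2 := by
  have hp := F.pos t x ht
  have rt := F.smooth_density.hasDerivAt_fst t x
  have rx := F.smooth_density.hasDerivAt_snd t x
  have ux := F.smooth_velocity.hasDerivAt_snd t x
  have hV : DifferentiableAt ℝ (uncurry (effVelocity ν η w)) (t, x) :=
    (F.contDiffAt_effVelocity ht).differentiableAt (by simp)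
  have vt := hasDerivAt_dT hV
  have vx := hasDerivAt_dX hV
  have h1 : dT (energyDensity a γ η (effVelocity ν η w)) t x = _ :=
    (((rt.const_mul (1 / 2)).mul (vt.pow 2)).add
      (hasDerivAt_relPot_comp (a := a) (γ := γ) hp rt)).deriv
  have hEx : HasDerivAt (energyDensity a γ η (effVelocity ν η w) t) _ x :=
    ((rx.const_mul (1 / 2)).mul (vx.pow 2)).add
      (hasDerivAt_relPot_comp (a := a) (γ := γ) hp rx)
  have h2 : dX (fun t x => w t x * (energyDensity a γ η (effVelocity ν η w) t x
        + a * η t x ^ γ - a)) t x = _ :=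
    (ux.mul ((hEx.add (F.hasDerivAt_pressure_snd ht)).sub_const a)).deriv
  have hVdef : effVelocity ν η w t x = w t x + ν * dX η t x / η t x ^ 2 := rfl
  have hloc := F.effVelocity_local (x := x) ht
  rw [h1, h2]
  simp only [Pi.pow_apply, Pi.add_apply, energyDensity]
  push_cast
  have hdiff : (effVelocity ν η w t x - w t x) * (a * γ * η t x ^ (γ - 1) * dX η t x)
      = ν * (a * γ * η t x ^ (γ - 1)) / η t x ^ 2 * dX η t x ^ 2 := by
    rw [hVdef]; ring
  linear_combination
    (1 / 2 * effVelocity ν η w t x ^ 2 + relPotDeriv a γ (η t x)) * F.mass_eq t x ht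
    + effVelocity ν η w t x * hloc - hdiff
    - dX w t x * mul_relPotDeriv_sub_relPot (a := a) (γ := γ) hp

lemma bd_identity (F : IsFlow a γ ν η w) (hT : 0 ≤ T) :
    IntervalIntegrable (fun t => ∫ x in (0:ℝ)..1,
        -(ν * (a * γ * η t x ^ (γ - 1)) / η t x ^ 2) * dX η t x ^ 2) volume 0 T ∧
      (∫ x in (0:ℝ)..1, energyDensity a γ η (effVelocity ν η w) T x)
        - (∫ x in (0:ℝ)..1, energyDensity a γ η (effVelocity ν η w) 0 x)
      = ∫ t in (0:ℝ)..T, ∫ x in (0:ℝ)..1,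
          -(ν * (a * γ * η t x ^ (γ - 1)) / η t x ^ 2) * dX η t x ^ 2 := by
  have hE : ∀ t x, 0 ≤ t →
      ContDiffAt ℝ 1 (uncurry (energyDensity a γ η (effVelocity ν η w))) (t, x) := fun t x ht =>
    ((contDiffAt_const.mul (F.smooth_density.contDiffAt 1 (t, x))).mul
      (ContDiffAt.pow (F.contDiffAt_effVelocity ht) 2)).add
      (ContDiffAt.comp (f := fun p : ℝ × ℝ => η p.1 p.2) (t, x) (contDiffAt_relPot (F.pos t x ht))
        (F.smooth_density.contDiffAt 1 (t, x)))
  refine integral_balance hE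
    (J := fun t x => w t x * (energyDensity a γ η (effVelocity ν η w) t x + a * η t x ^ γ - a))
    (fun t x ht => ContDiffAt.mul (F.smooth_velocity.contDiffAt 1 (t, x))
      (((hE t x ht).add (F.contDiffAt_pressure ht)).sub contDiffAt_const))
    (fun t _ => ?_) (fun t x ht => F.bd_local ht) hT
  have h1 := F.periodic_density t 0
  have h2 := F.periodic_velocity t 0
  have h3 := dX_periodic F.periodic_density t 0
  simp only [zero_add] at h1 h2 h3
  simp only [energyDensity, effVelocity, h1, h2, h3]

lemma gradient_identity (F : IsFlow a γ ν η w) (hT : 0 ≤ T) :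
    (∫ x in (0:ℝ)..1, 1 / 2 * dX w T x ^ 2) - (∫ x in (0:ℝ)..1, 1 / 2 * dX w 0 x ^ 2)
      = ∫ t in (0:ℝ)..T, ∫ x in (0:ℝ)..1, -(dX (dX w) t x * dT w t x) := by
  have hu := F.smooth_velocity
  refine (integral_balance (F := fun t x => 1 / 2 * dX w t x ^ 2)
    (J := fun t x => -(dX w t x * dT w t x))
    (fun t x _ => contDiffAt_const.mul (ContDiffAt.pow (hu.dX.contDiffAt 1 (t, x)) 2))
    (fun t x _ => (ContDiffAt.mul (hu.dX.contDiffAt 1 (t, x)) (hu.dT.contDiffAt 1 (t, x))).neg)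
    (fun t _ => ?_) (fun t x _ => ?_) hT).2
  · have h2 := dT_periodic F.periodic_velocity t 0
    have h3 := dX_periodic F.periodic_velocity t 0
    simp only [zero_add] at h2 h3
    simp only [h2, h3]
  · have h1 : dT (fun t x => 1 / 2 * dX w t x ^ 2) t x = _ :=
      (((hu.dX.hasDerivAt_fst t x).pow 2).const_mul (1 / 2)).deriv
    have h2 : dX (fun t x => -(dX w t x * dT w t x)) t x = _ :=
      ((hu.dX.hasDerivAt_snd t x).mul (hu.dT.hasDerivAt_snd t x)).neg.deriv
    rw [h1, h2, hu.dT_dX_comm]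
    push_cast
    ring

end IsFlow

/-- The antiderivative in `x` of the momentum `η w`, normalized to have mean zero. -/
noncomputable def momentumPotential (η w : ℝ → ℝ → ℝ) (t x : ℝ) : ℝ :=
  (∫ y in (0:ℝ)..x, η t y * w t y) - ∫ y in (0:ℝ)..1, (1 - y) * (η t y * w t y)

namespace IsFlow

variable {a γ ν E : ℝ} {η w : ℝ → ℝ → ℝ} {t x : ℝ}

lemma continuous_dX_stress (F : IsFlow a γ ν η w) (ht : 0 ≤ t) :
    Continuous (dX (stress a γ ν η w) t) := by
  have e : dX (stress a γ ν η w) t = dT (fun t x => η t x * w t x) t :=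
    funext fun y => (F.dT_momentum ht).symm
  rw [e]
  exact (F.smooth_density.mul F.smooth_velocity).dT.continuous_slice t

lemma hasDerivAt_stress (F : IsFlow a γ ν η w) (ht : 0 ≤ t) (x : ℝ) :
    HasDerivAt (stress a γ ν η w t) (dX (stress a γ ν η w) t x) x :=
  hasDerivAt_dX ((F.contDiffAt_stress ht).differentiableAt (by simp))

lemma continuous_stress (F : IsFlow a γ ν η w) (ht : 0 ≤ t) :
    Continuous (stress a γ ν η w t) :=
  continuous_iff_continuousAt.2 fun x => (F.hasDerivAt_stress ht x).continuousAt

lemma continuous_energyDensity (F : IsFlow a γ ν η w) (ht : 0 ≤ t) :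
    Continuous (energyDensity a γ η w t) :=
  continuous_iff_continuousAt.2 fun _ => (hasDerivAt_dX
    ((F.contDiffAt_energyDensity ht).differentiableAt (by simp))).continuousAt

lemma hasDerivAt_momentumPotential_fst (F : IsFlow a γ ν η w) (ht : 0 ≤ t) :
    HasDerivAt (fun s => momentumPotential η w s x)
      (stress a γ ν η w t x - ∫ y in (0:ℝ)..1, stress a γ ν η w t y) t := by
  have hm := F.smooth_density.mul F.smooth_velocity
  have hlin : Smooth2 (fun t y => (1 - y) * (η t y * w t y)) :=
    Smooth2.mul (f := fun _ y => 1 - y) (contDiff_const.sub contDiff_snd) hm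
  have hcs := F.continuous_dX_stress ht
  refine ((hm.hasDerivAt_intervalIntegral 0 x t).sub
    (hlin.hasDerivAt_intervalIntegral 0 1 t)).congr_deriv ?_
  have h1 : ∫ y in (0:ℝ)..x, dT (fun t x => η t x * w t x) t y
      = stress a γ ν η w t x - stress a γ ν η w t 0 := by
    simp only [F.dT_momentum ht]
    exact intervalIntegral.integral_eq_sub_of_hasDerivAt
      (fun y _ => F.hasDerivAt_stress ht y) (hcs.intervalIntegrable _ _)
  have h2 : ∫ y in (0:ℝ)..1, dT (fun t y => (1 - y) * (η t y * w t y)) t y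
      = -stress a γ ν η w t 0 + ∫ y in (0:ℝ)..1, stress a γ ν η w t y := by
    have e : ∀ y, dT (fun t y => (1 - y) * (η t y * w t y)) t y
        = (1 - y) * dX (stress a γ ν η w) t y := fun y => by
      rw [← F.dT_momentum ht]
      exact ((hm.hasDerivAt_fst t y).const_mul (1 - y)).deriv
    simp only [e]
    have hp := intervalIntegral.integral_mul_deriv_eq_deriv_mul (a := 0) (b := 1)
      (u := fun y : ℝ => 1 - y) (u' := fun _ => -1)
      (fun y _ => ((hasDerivAt_id y).const_sub 1)) (fun y _ => F.hasDerivAt_stress ht y)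
      intervalIntegrable_const (hcs.intervalIntegrable _ _)
    rw [hp]
    simp only [intervalIntegral.integral_const_mul]
    ring
  rw [h1, h2]
  ring

lemma hasDerivAt_momentumPotential_snd (F : IsFlow a γ ν η w) :
    HasDerivAt (momentumPotential η w t) (η t x * w t x) x :=
  (intervalIntegral.integral_hasDerivAt_right
    (((F.smooth_density.mul F.smooth_velocity).continuous_slice t).intervalIntegrable _ _)
    (((F.smooth_density.mul F.smooth_velocity).continuous_slice t).stronglyMeasurableAtFilter _ _)
    ((F.smooth_density.mul F.smooth_velocity).continuous_slice t).continuousAt).sub_const _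

lemma continuous_momentumPotential (F : IsFlow a γ ν η w) :
    Continuous (uncurry (momentumPotential η w)) := by
  have hm := (F.smooth_density.mul F.smooth_velocity).continuous
  refine Continuous.sub ?_ ?_
  · exact intervalIntegral.continuous_parametric_intervalIntegral_of_continuous
      (f := fun (p : ℝ × ℝ) y => η p.1 y * w p.1 y)
      (hm.comp (continuous_fst.fst.prodMk continuous_snd)) continuous_snd
  · refine (continuous_intervalIntegral_slice (f := fun t y => (1 - y) * (η t y * w t y))
      ?_ 0 1).comp continuous_fst
    exact (continuous_const.sub continuous_snd).mul hm

lemma periodic_momentumPotential (F : IsFlow a γ ν η w) (ht : 0 ≤ t) :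
    momentumPotential η w t (x + 1) = momentumPotential η w t x := by
  have hm := (F.smooth_density.mul F.smooth_velocity).continuous_slice t
  have hp : Function.Periodic (fun y => η t y * w t y) 1 := fun y => by
    simp only [F.periodic_density, F.periodic_velocity]
  have h := hp.intervalIntegral_add_eq x 0
  rw [zero_add, F.integral_momentum ht] at h
  rw [momentumPotential, momentumPotential, ← intervalIntegral.integral_add_adjacent_intervals
    (hm.intervalIntegrable 0 x) (hm.intervalIntegrable x (x + 1)), h, add_zero]

lemma integral_energyDensity_le (F : IsFlow a γ ν η w) (hν : 0 ≤ ν) (ht : 0 ≤ t)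
    (hE : ∫ x in (0:ℝ)..1, energyDensity a γ η w 0 x ≤ E) :
    ∫ x in (0:ℝ)..1, energyDensity a γ η w t x ≤ E := by
  have h := F.energy_identity ht
  have : 0 ≤ ∫ t in (0:ℝ)..t, ∫ x in (0:ℝ)..1, dX w t x ^ 2 :=
    intervalIntegral.integral_nonneg ht fun s _ =>
      intervalIntegral.integral_nonneg zero_le_one fun x _ => sq_nonneg _
  nlinarith

lemma abs_momentumPotential_le (F : IsFlow a γ ν η w) (ha : 0 ≤ a) (hγ : 0 ≤ γ) (ht : 0 ≤ t)
    (hE : ∫ x in (0:ℝ)..1, energyDensity a γ η w t x ≤ E) (x : ℝ) :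
    |momentumPotential η w t x| ≤ 1 + 2 * E := by
  have hη := F.smooth_density.continuous_slice t
  have hw := F.smooth_velocity.continuous_slice t
  have hm : Continuous fun y => η t y * w t y := hη.mul hw
  have hI : ∫ y in (0:ℝ)..1, |η t y * w t y| ≤ 1 / 2 + E := by
    calc ∫ y in (0:ℝ)..1, |η t y * w t y|
        ≤ ∫ y in (0:ℝ)..1, (1 / 2 * η t y + energyDensity a γ η w t y) := by
          refine intervalIntegral.integral_mono_on zero_le_one (hm.abs.intervalIntegrable _ _)
            (((hη.const_mul _).add (F.continuous_energyDensity ht)).intervalIntegrable _ _)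
            fun y _ => ?_
          have hp := F.pos t y ht
          have hH := relPot_nonneg ha hγ hp
          have h1 : |w t y| ≤ 1 / 2 + 1 / 2 * w t y ^ 2 := by
            rw [← sq_abs (w t y)]
            nlinarith [sq_nonneg (|w t y| - 1)]
          rw [abs_mul, abs_of_pos hp, energyDensity]
          nlinarith
      _ = 1 / 2 + ∫ y in (0:ℝ)..1, energyDensity a γ η w t y := by
          rw [intervalIntegral.integral_add ((hη.const_mul _).intervalIntegrable _ _)
            ((F.continuous_energyDensity ht).intervalIntegrable _ _),
            intervalIntegral.integral_const_mul, F.integral_density ht]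
          ring
      _ ≤ _ := by gcongr
  obtain ⟨z, hz, hxz⟩ := Function.Periodic.exists_mem_Ico₀
    (f := momentumPotential η w t) (fun y => F.periodic_momentumPotential ht) one_pos x
  rw [hxz]
  have h1 : |∫ y in (0:ℝ)..z, η t y * w t y| ≤ 1 / 2 + E := by
    refine (intervalIntegral.abs_integral_le_integral_abs hz.1).trans (le_trans ?_ hI)
    exact intervalIntegral.integral_mono_interval le_rfl hz.1 hz.2.le
      (Filter.Eventually.of_forall fun y => abs_nonneg _) (hm.abs.intervalIntegrable _ _)
  have h2 : |∫ y in (0:ℝ)..1, (1 - y) * (η t y * w t y)| ≤ 1 / 2 + E := by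
    refine (intervalIntegral.abs_integral_le_integral_abs zero_le_one).trans (le_trans ?_ hI)
    refine intervalIntegral.integral_mono_on zero_le_one
      (Continuous.intervalIntegrable (by fun_prop) _ _)
      (hm.abs.intervalIntegrable _ _) fun y hy => ?_
    rw [abs_mul]
    refine mul_le_of_le_one_left (abs_nonneg _) ?_
    rw [abs_le]
    constructor <;> linarith [hy.1, hy.2]
  calc |momentumPotential η w t z| ≤ _ := abs_sub _ _
    _ ≤ _ := by linarith

lemma neg_integral_stress_mem (F : IsFlow a γ ν η w) (ha : 0 ≤ a) (hγ1 : 1 ≤ γ) (hγ2 : γ ≤ 2)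
    (ht : 0 ≤ t) (hE : ∫ x in (0:ℝ)..1, energyDensity a γ η w t x ≤ E) :
    -(∫ x in (0:ℝ)..1, stress a γ ν η w t x) ∈ Icc a (a + 2 * E) := by
  have hη := F.smooth_density.continuous_slice t
  have hw := F.smooth_velocity.continuous_slice t
  have hwx := F.smooth_velocity.dX.continuous_slice t
  have hs := F.continuous_stress ht
  have he := F.continuous_energyDensity ht
  have hbase : ∫ x in (0:ℝ)..1, (-ν * dX w t x + a * γ * η t x + (a - a * γ)) = a := by
    have h0 : ∫ x in (0:ℝ)..1, dX w t x = 0 := by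
      have h1 := F.periodic_velocity t 0
      rw [zero_add] at h1
      rw [intervalIntegral.integral_eq_sub_of_hasDerivAt
        (fun y _ => F.smooth_velocity.hasDerivAt_snd t y) (hwx.intervalIntegrable _ _), h1,
        sub_self]
    rw [intervalIntegral.integral_add (Continuous.intervalIntegrable (by fun_prop) _ _)
      (Continuous.intervalIntegrable (by fun_prop) _ _), intervalIntegral.integral_add
      (Continuous.intervalIntegrable (by fun_prop) _ _)
      (Continuous.intervalIntegrable (by fun_prop) _ _), intervalIntegral.integral_const_mul,
      intervalIntegral.integral_const_mul, h0, F.integral_density ht,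
      intervalIntegral.integral_const]
    simp
  have hpt : ∀ x, -stress a γ ν η w t x = -ν * dX w t x + a * γ * η t x + (a - a * γ)
      + ((γ - 1) * relPot a γ (η t x) + η t x * w t x ^ 2) := fun x => by
    rw [stress, pressure_eq_relPot]
    ring
  have hH : ∀ x, 0 ≤ relPot a γ (η t x) := fun x =>
    relPot_nonneg ha (by linarith) (F.pos t x ht)
  rw [← intervalIntegral.integral_neg]
  constructor
  · refine hbase.ge.trans (intervalIntegral.integral_mono_on zero_le_one
      (Continuous.intervalIntegrable (by fun_prop) _ _)
      (Continuous.intervalIntegrable (by fun_prop) _ _) fun x _ => ?_)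
    rw [hpt]
    have h1 := mul_nonneg (sub_nonneg.2 hγ1) (hH x)
    have h2 := mul_nonneg (F.pos t x ht).le (sq_nonneg (w t x))
    linarith
  · calc ∫ x in (0:ℝ)..1, -stress a γ ν η w t x
        ≤ ∫ x in (0:ℝ)..1, ((-ν * dX w t x + a * γ * η t x + (a - a * γ))
          + 2 * energyDensity a γ η w t x) := by
          refine intervalIntegral.integral_mono_on zero_le_one
            (Continuous.intervalIntegrable (by fun_prop) _ _)
            (Continuous.intervalIntegrable (by fun_prop) _ _) fun x _ => ?_
          rw [hpt, energyDensity]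
          nlinarith [hH x]
      _ = a + 2 * ∫ x in (0:ℝ)..1, energyDensity a γ η w t x := by
          rw [intervalIntegral.integral_add (Continuous.intervalIntegrable (by fun_prop) _ _)
            (Continuous.intervalIntegrable (by fun_prop) _ _), hbase,
            intervalIntegral.integral_const_mul]
      _ ≤ _ := by linarith

/-- Along particle paths, `ν log η` plus the momentum potential is driven by the pressure alone. -/
lemma log_density_transport (F : IsFlow a γ ν η w) (ht : 0 ≤ t) (x : ℝ) :
    ∃ Mt Mx, HasDerivAt (fun s => ν * Real.log (η s x) + momentumPotential η w s x) Mt t ∧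
      HasDerivAt (fun y => ν * Real.log (η t y) + momentumPotential η w t y) Mx x ∧
      Mt + w t x * Mx = -(∫ y in (0:ℝ)..1, stress a γ ν η w t y) - a * η t x ^ γ := by
  have hp := (F.pos t x ht).ne'
  refine ⟨_, _, (((F.smooth_density.hasDerivAt_fst t x).log hp).const_mul ν).add
    (F.hasDerivAt_momentumPotential_fst ht),
    (((F.smooth_density.hasDerivAt_snd t x).log hp).const_mul ν).add
    F.hasDerivAt_momentumPotential_snd, ?_⟩
  rw [F.mass_eq t x ht, stress]
  field_simp
  ring

end IsFlow

/-- Bounds on the density away from vacuum and infinity, uniform in time. -/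
lemma exists_density_bounds {a γ ν ςlow ςbar E : ℝ} (ha : 0 < a) (hγ1 : 1 ≤ γ) (hγ2 : γ ≤ 2)
    (hν : 0 < ν) (hςlow : 0 < ςlow) :
    ∃ lo hi : ℝ, 0 < lo ∧ 0 < hi ∧ ∀ η w : ℝ → ℝ → ℝ, IsFlow a γ ν η w → (∀ x, ςlow ≤ η 0 x) →
      (∀ x, η 0 x ≤ ςbar) → ∫ x in (0:ℝ)..1, energyDensity a γ η w 0 x ≤ E →
      ∀ t x, 0 ≤ t → lo ≤ η t x ∧ η t x ≤ hi := by
  set r₁ := min ςlow 1 with hr₁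
  set r₂ := max (max ςbar 1) (1 + 2 * E / a) with hr₂
  set B := 1 + 2 * E with hB
  have hr₁pos : 0 < r₁ := lt_min hςlow one_pos
  have hr₂pos : 0 < r₂ := one_pos.trans_le ((le_max_right _ _).trans (le_max_left _ _))
  refine ⟨Real.exp ((ν * Real.log r₁ - 2 * B) / ν), Real.exp ((ν * Real.log r₂ + 2 * B) / ν),
    Real.exp_pos _, Real.exp_pos _, fun η w F hlow hhigh hE => ?_⟩
  have hEt : ∀ t, 0 ≤ t → ∫ x in (0:ℝ)..1, energyDensity a γ η w t x ≤ E := fun t ht =>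
    F.integral_energyDensity_le hν.le ht hE
  have hΦ : ∀ t x, 0 ≤ t → |momentumPotential η w t x| ≤ B := fun t x ht =>
    F.abs_momentumPotential_le ha.le (by linarith) ht (hEt t ht) x
  choose! Mt Mx hMt hMx hM using fun t x (ht : 0 ≤ t) => F.log_density_transport ht x
  have hcont : ContinuousOn
      (uncurry fun t x => ν * Real.log (η t x) + momentumPotential η w t x) (Ici 0 ×ˢ univ) := by
    refine ContinuousOn.add (continuousOn_const.mul ?_) F.continuous_momentumPotential.continuousOn
    exact ContinuousOn.log F.smooth_density.continuous.continuousOn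
      fun p hp => (F.pos p.1 p.2 hp.1).ne'
  have hper : ∀ t x, 0 ≤ t → ν * Real.log (η t (x + 1)) + momentumPotential η w t (x + 1)
      = ν * Real.log (η t x) + momentumPotential η w t x := fun t x ht => by
    rw [F.periodic_density, F.periodic_momentumPotential ht]
  have hup : ∀ t x, 0 ≤ t →
      ν * Real.log (η t x) + momentumPotential η w t x ≤ ν * Real.log r₂ + B := by
    refine fun t x ht => transport_max_principle (v := w) hcont hper hMt hMx ?_ ?_ t x ht
    · intro t x ht hK
      have hp := F.pos t x ht
      have h1 : r₂ < η t x := by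
        rw [← Real.log_lt_log_iff hr₂pos hp]
        have := (abs_le.1 (hΦ t x ht)).2
        nlinarith
      have h2 : 1 ≤ η t x := (((le_max_right _ _).trans (le_max_left _ _)).trans_lt h1).le
      have h3 : 1 + 2 * E / a < η t x := (le_max_right _ _).trans_lt h1
      have h4 : η t x ≤ η t x ^ γ := by
        simpa using Real.rpow_le_rpow_of_exponent_le h2 hγ1
      have h5 : a + 2 * E < a * η t x ^ γ := by
        calc a + 2 * E = a * (1 + 2 * E / a) := by field_simp
          _ < a * η t x := by gcongr
          _ ≤ _ := by gcongr
      have h6 := (F.neg_integral_stress_mem ha.le hγ1 hγ2 ht (hEt t ht)).2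
      rw [hM t x ht]
      linarith
    · intro x
      have h1 : Real.log (η 0 x) ≤ Real.log r₂ := Real.log_le_log (F.pos 0 x le_rfl)
        ((hhigh x).trans ((le_max_left _ _).trans (le_max_left _ _)))
      have := (abs_le.1 (hΦ 0 x le_rfl)).2
      nlinarith
  have hdown : ∀ t x, 0 ≤ t →
      -(ν * Real.log (η t x) + momentumPotential η w t x) ≤ -(ν * Real.log r₁ - B) := by
    refine fun t x ht => transport_max_principle (v := w)
      (M := fun t x => -(ν * Real.log (η t x) + momentumPotential η w t x)) hcont.neg
      (fun t x ht => congrArg Neg.neg (hper t x ht)) (fun t x ht => (hMt t x ht).neg)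
      (fun t x ht => (hMx t x ht).neg) ?_ ?_ t x ht
    · intro t x ht hK
      have hp := F.pos t x ht
      have h1 : η t x < r₁ := by
        rw [← Real.log_lt_log_iff hp hr₁pos]
        have := (abs_le.1 (hΦ t x ht)).1
        have hK' : ν * Real.log (η t x) + momentumPotential η w t x < ν * Real.log r₁ - B :=
          neg_lt_neg_iff.1 hK
        nlinarith
      have h2 : η t x ^ γ < 1 :=
        Real.rpow_lt_one hp.le (h1.trans_le (min_le_right _ _)) (by linarith)
      have h5 : a * η t x ^ γ < a := by nlinarith
      have h6 := (F.neg_integral_stress_mem ha.le hγ1 hγ2 ht (hEt t ht)).1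
      have := hM t x ht
      linarith
    · intro x
      have h1 : Real.log r₁ ≤ Real.log (η 0 x) :=
        Real.log_le_log hr₁pos ((min_le_left _ _).trans (hlow x))
      have := (abs_le.1 (hΦ 0 x le_rfl)).1
      nlinarith
  intro t x ht
  have hp := F.pos t x ht
  have hΦ' := abs_le.1 (hΦ t x ht)
  constructor
  · rw [← Real.le_log_iff_exp_le hp, div_le_iff₀ hν]
    linarith [hdown t x ht]
  · rw [← Real.log_le_iff_le_exp hp, le_div_iff₀ hν]
    linarith [hup t x ht]

/-- The integrand of the squared `H¹` distance of `(η, w)` to the constant state `(1, 0)`. -/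
noncomputable def sobolevDensity (η w : ℝ → ℝ → ℝ) (t x : ℝ) : ℝ :=
  (η t x - 1) ^ 2 + dX η t x ^ 2 + (w t x ^ 2 + dX w t x ^ 2)

lemma lintegral_Ioi_le_of_intervalIntegral_le {f : ℝ → ℝ} (hf : Continuous f) (h0 : ∀ t, 0 ≤ f t)
    {C : ℝ} (h : ∀ T, 0 ≤ T → ∫ t in (0:ℝ)..T, f t ≤ C) :
    ∫⁻ t in Ioi (0:ℝ), ENNReal.ofReal (f t) ≤ ENNReal.ofReal C := by
  have hcov : AECover (volume.restrict (Ioi (0:ℝ))) Filter.atTop fun T : ℝ => Iic T :=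
    aecover_Iic Filter.tendsto_id
  refine le_of_tendsto (hcov.lintegral_tendsto_of_countably_generated
    hf.measurable.ennreal_ofReal.aemeasurable) ?_
  filter_upwards [Filter.eventually_ge_atTop 0] with T hT
  rw [Measure.restrict_restrict measurableSet_Iic, inter_comm, Ioi_inter_Iic,
    ← ofReal_integral_eq_lintegral_ofReal
      (hf.integrableOn_Icc.mono_set Ioc_subset_Icc_self) (Filter.Eventually.of_forall h0),
    ← intervalIntegral.integral_of_le hT]
  exact ENNReal.ofReal_le_ofReal (h T hT)

namespace IsFlow

variable {a γ ν E lo hi : ℝ} {η w : ℝ → ℝ → ℝ} {t x T : ℝ}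

lemma continuous_sobolevDensity (F : IsFlow a γ ν η w) : Continuous (sobolevDensity η w t) := by
  have h1 := F.smooth_density.continuous_slice t
  have h2 := F.smooth_velocity.continuous_slice t
  have h3 := F.smooth_density.dX.continuous_slice t
  have h4 := F.smooth_velocity.dX.continuous_slice t
  unfold sobolevDensity
  fun_prop

lemma energyDensity_le (ha : 0 ≤ a) (hγ1 : 1 ≤ γ) (hγ2 : γ ≤ 2) {m M : ℝ} (hm : 0 < m)
    (hm1 : m ≤ 1) (hlo : m ≤ η t x) (hhi : η t x ≤ M) (v : ℝ → ℝ → ℝ) :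
    energyDensity a γ η v t x ≤ M / 2 * v t x ^ 2 + a * γ * m ^ (γ - 2) * (η t x - 1) ^ 2 := by
  have h1 := relPot_le ha (by linarith : (0:ℝ) ≤ γ) hγ2 hm hm1 hlo
  have h2 : η t x * v t x ^ 2 ≤ M * v t x ^ 2 := by gcongr
  rw [energyDensity]
  linarith

lemma exists_initial_bound {ςlow ςbar : ℝ} (ha : 0 < a) (hγ1 : 1 ≤ γ) (hγ2 : γ ≤ 2)
    (hςlow : 0 < ςlow) (hςord : ςlow ≤ ςbar) :
    ∃ C, 0 < C ∧ ∀ η w, IsFlow a γ ν η w → (∀ x, ςlow ≤ η 0 x) → (∀ x, η 0 x ≤ ςbar) →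
      (∫ x in (0:ℝ)..1, energyDensity a γ η w 0 x ≤ C * ∫ x in (0:ℝ)..1, sobolevDensity η w 0 x) ∧
      ∫ x in (0:ℝ)..1, energyDensity a γ η (effVelocity ν η w) 0 x
        ≤ C * ∫ x in (0:ℝ)..1, sobolevDensity η w 0 x := by
  set m := min ςlow 1 with hmdef
  have hm : 0 < m := lt_min hςlow one_pos
  have hM : 0 < ςbar := hςlow.trans_le hςord
  have hγ0 : 0 < γ := by linarith
  have hmp : 0 < m ^ (γ - 2) := Real.rpow_pos_of_pos hm _
  set A := a * γ * m ^ (γ - 2) with hA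
  have hApos : 0 < A := by positivity
  set C := ςbar + ςbar * ν ^ 2 / ςlow ^ 4 + A with hC
  have hterm : 0 ≤ ςbar * ν ^ 2 / ςlow ^ 4 := by positivity
  refine ⟨C, by positivity, fun η w F hlow hhigh => ?_⟩
  have hbase : ∀ v x, energyDensity a γ η v 0 x ≤ ςbar / 2 * v 0 x ^ 2 + A * (η 0 x - 1) ^ 2 :=
    fun v x => energyDensity_le ha.le hγ1 hγ2 hm (min_le_right _ _)
      ((min_le_left _ _).trans (hlow x)) (hhigh x) v
  have hd := F.continuous_sobolevDensity (t := 0)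
  constructor
  · rw [← intervalIntegral.integral_const_mul]
    refine intervalIntegral.integral_mono_on zero_le_one
      ((F.continuous_energyDensity le_rfl).intervalIntegrable _ _)
      ((hd.const_mul C).intervalIntegrable _ _) fun x _ => (hbase w x).trans ?_
    rw [sobolevDensity]
    have e1 : ςbar / 2 * w 0 x ^ 2 ≤ C * w 0 x ^ 2 := by gcongr; linarith
    have e2 : A * (η 0 x - 1) ^ 2 ≤ C * (η 0 x - 1) ^ 2 := by gcongr; linarith
    have e3 : 0 ≤ C * (dX η 0 x ^ 2 + dX w 0 x ^ 2) := by positivity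
    linarith
  · have hcont : Continuous (energyDensity a γ η (effVelocity ν η w) 0) := by
      refine continuous_iff_continuousAt.2 fun x => ?_
      have hV := (hasDerivAt_dX ((F.contDiffAt_effVelocity (x := x) le_rfl).differentiableAt
        (by simp))).continuousAt
      have hη := (F.smooth_density.continuous_slice 0).continuousAt (x := x)
      have hH := (hasDerivAt_relPot_comp (a := a) (γ := γ) (F.pos 0 x le_rfl)
        (F.smooth_density.hasDerivAt_snd 0 x)).continuousAt
      exact ((hη.const_mul _).mul (hV.pow 2)).add hH
    rw [← intervalIntegral.integral_const_mul]
    refine intervalIntegral.integral_mono_on zero_le_one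
      (hcont.intervalIntegrable _ _)
      ((hd.const_mul C).intervalIntegrable _ _) fun x _ => (hbase _ x).trans ?_
    rw [sobolevDensity]
    have hp := F.pos 0 x le_rfl
    have hV : effVelocity ν η w 0 x ^ 2 ≤ 2 * w 0 x ^ 2 + 2 * (ν ^ 2 / ςlow ^ 4) * dX η 0 x ^ 2 := by
      have h1 : ν ^ 2 / η 0 x ^ 4 ≤ ν ^ 2 / ςlow ^ 4 := by
        gcongr
        exact hlow x
      have h2 : (ν * dX η 0 x / η 0 x ^ 2) ^ 2 = ν ^ 2 / η 0 x ^ 4 * dX η 0 x ^ 2 := by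
        field_simp
      have h3 : ν ^ 2 / η 0 x ^ 4 * dX η 0 x ^ 2 ≤ ν ^ 2 / ςlow ^ 4 * dX η 0 x ^ 2 := by gcongr
      rw [effVelocity]
      nlinarith [sq_nonneg (w 0 x - ν * dX η 0 x / η 0 x ^ 2)]
    have e0 : ςbar / 2 * effVelocity ν η w 0 x ^ 2
        ≤ ςbar * w 0 x ^ 2 + ςbar * ν ^ 2 / ςlow ^ 4 * dX η 0 x ^ 2 := by
      calc ςbar / 2 * effVelocity ν η w 0 x ^ 2
          ≤ ςbar / 2 * (2 * w 0 x ^ 2 + 2 * (ν ^ 2 / ςlow ^ 4) * dX η 0 x ^ 2) := by gcongr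
        _ = _ := by ring
    have e1 : ςbar * w 0 x ^ 2 ≤ C * w 0 x ^ 2 := by gcongr; linarith
    have e2 : A * (η 0 x - 1) ^ 2 ≤ C * (η 0 x - 1) ^ 2 := by gcongr; linarith
    have e3 : ςbar * ν ^ 2 / ςlow ^ 4 * dX η 0 x ^ 2 ≤ C * dX η 0 x ^ 2 := by gcongr; linarith
    have e4 : 0 ≤ C * dX w 0 x ^ 2 := by positivity
    linarith

lemma integral_dX_velocity_sq_le (F : IsFlow a γ ν η w) (ha : 0 ≤ a) (hγ : 0 ≤ γ) (hν : 0 < ν)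
    (hT : 0 ≤ T) (hE : ∫ x in (0:ℝ)..1, energyDensity a γ η w 0 x ≤ E) :
    ∫ t in (0:ℝ)..T, ∫ x in (0:ℝ)..1, dX w t x ^ 2 ≤ E / ν := by
  have h := F.energy_identity hT
  have h0 : 0 ≤ ∫ x in (0:ℝ)..1, energyDensity a γ η w T x :=
    intervalIntegral.integral_nonneg zero_le_one fun x _ => by
      have hp := F.pos T x hT
      have hH := relPot_nonneg ha hγ hp
      rw [energyDensity]
      positivity
  rw [le_div_iff₀ hν]
  linarith

lemma integral_velocity_sq_le (F : IsFlow a γ ν η w) (ha : 0 ≤ a) (hγ : 0 ≤ γ) (ht : 0 ≤ t)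
    (hlo : 0 < lo) (hη : ∀ x, lo ≤ η t x)
    (hE : ∫ x in (0:ℝ)..1, energyDensity a γ η w t x ≤ E) :
    ∫ x in (0:ℝ)..1, w t x ^ 2 ≤ 2 * E / lo := by
  have h : ∫ x in (0:ℝ)..1, lo / 2 * w t x ^ 2 ≤ ∫ x in (0:ℝ)..1, energyDensity a γ η w t x := by
    refine intervalIntegral.integral_mono_on zero_le_one
      ((((F.smooth_velocity.continuous_slice t).pow 2).const_mul _).intervalIntegrable _ _)
      ((F.continuous_energyDensity ht).intervalIntegrable _ _) fun x _ => ?_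
    have hH := relPot_nonneg ha hγ (F.pos t x ht)
    have h2 : lo * w t x ^ 2 ≤ η t x * w t x ^ 2 := by gcongr; exact hη x
    rw [energyDensity]
    linarith
  rw [intervalIntegral.integral_const_mul] at h
  rw [le_div_iff₀ hlo]
  linarith

lemma integral_dX_density_sq_le (F : IsFlow a γ ν η w) (ha : 0 < a) (hγ1 : 1 ≤ γ) (hγ2 : γ ≤ 2)
    (hν : 0 < ν) (hT : 0 ≤ T) (hhi : 0 < hi) (hη : ∀ t x, 0 ≤ t → η t x ≤ hi)
    (hE : ∫ x in (0:ℝ)..1, energyDensity a γ η (effVelocity ν η w) 0 x ≤ E) :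
    ∫ t in (0:ℝ)..T, ∫ x in (0:ℝ)..1, dX η t x ^ 2 ≤ E / (ν * (a * γ * hi ^ (γ - 3))) := by
  obtain ⟨hint, h⟩ := F.bd_identity hT
  have h0 : 0 ≤ ∫ x in (0:ℝ)..1, energyDensity a γ η (effVelocity ν η w) T x :=
    intervalIntegral.integral_nonneg zero_le_one fun x _ => by
      have hp := F.pos T x hT
      have hH := relPot_nonneg ha.le (by linarith : (0:ℝ) ≤ γ) hp
      rw [energyDensity]
      positivity
  have hγ0 : 0 < γ := by linarith
  have hhp : 0 < hi ^ (γ - 3) := Real.rpow_pos_of_pos hhi _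
  set c := ν * (a * γ * hi ^ (γ - 3)) with hc
  have hcpos : 0 < c := by positivity
  have hle : ∫ t in (0:ℝ)..T, ∫ x in (0:ℝ)..1,
        -(ν * (a * γ * η t x ^ (γ - 1)) / η t x ^ 2) * dX η t x ^ 2
      ≤ ∫ t in (0:ℝ)..T, -c * ∫ x in (0:ℝ)..1, dX η t x ^ 2 := by
    refine intervalIntegral.integral_mono_on hT hint
      (((F.smooth_density.dX.continuous_integral_sq 0 1).const_mul _).intervalIntegrable _ _)
      fun t ht => ?_
    rw [← intervalIntegral.integral_const_mul]
    have hηc := F.smooth_density.continuous_slice t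
    have hηx := F.smooth_density.dX.continuous_slice t
    have hpow : Continuous fun x => η t x ^ (γ - 1) :=
      hηc.rpow_const fun x => Or.inl (F.pos t x ht.1).ne'
    refine intervalIntegral.integral_mono_on zero_le_one
      (Continuous.intervalIntegrable ?_ _ _)
      (Continuous.intervalIntegrable (by fun_prop) _ _) fun x _ => ?_
    · exact (((hpow.const_mul _).const_mul _).div (hηc.pow 2)
        fun x => (pow_pos (F.pos t x ht.1) 2).ne').neg.mul (hηx.pow 2)
    · have hp := F.pos t x ht.1
      have h1 : η t x ^ (γ - 3) = η t x ^ (γ - 1) / η t x ^ 2 := by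
        rw [show γ - 3 = (γ - 1) - 2 by ring, Real.rpow_sub hp, Real.rpow_two]
      have h2 : hi ^ (γ - 3) ≤ η t x ^ (γ - 3) :=
        Real.rpow_le_rpow_of_nonpos hp (hη t x ht.1) (by linarith)
      have h3 : c ≤ ν * (a * γ * η t x ^ (γ - 1)) / η t x ^ 2 := by
        calc c ≤ ν * (a * γ * η t x ^ (γ - 3)) := by rw [hc]; gcongr
          _ = _ := by rw [h1]; ring
      have h4 := mul_le_mul_of_nonneg_right h3 (sq_nonneg (dX η t x))
      linarith
  rw [intervalIntegral.integral_const_mul] at hle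
  rw [le_div_iff₀ hcpos]
  linarith

lemma neg_dXX_mul_dT_le (F : IsFlow a γ ν η w) (ha : 0 < a) (hγ1 : 1 ≤ γ) (hγ2 : γ ≤ 2)
    (hν : 0 < ν) (ht : 0 ≤ t) (hlo : 0 < lo) (hη : lo ≤ η t x ∧ η t x ≤ hi) :
    -(dX (dX w) t x * dT w t x) ≤ -(ν / hi / 2) * dX (dX w) t x ^ 2
      + (a * γ * lo ^ (γ - 2)) ^ 2 / (ν / hi) * dX η t x ^ 2
      + 1 / (ν / hi) * (w t x ^ 2 * dX w t x ^ 2) := by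
  have hp := F.pos t x ht
  have hhi : 0 < hi := hp.trans_le hη.2
  have hut : dT w t x = ν / η t x * dX (dX w) t x - a * γ * η t x ^ (γ - 2) * dX η t x
      - w t x * dX w t x := by
    have h1 : η t x ^ (γ - 2) = η t x ^ (γ - 1) / η t x := by
      rw [show γ - 2 = (γ - 1) - 1 by ring, Real.rpow_sub_one hp.ne']
    have hm := F.momentum_eq t x ht
    rw [h1]
    field_simp
    linarith
  rw [hut]
  have hδ : 0 < ν / hi := by positivity
  have hδ' : ν / hi ≤ ν / η t x := by gcongr; exact hη.2
  have hq0 : 0 ≤ a * γ * η t x ^ (γ - 2) := by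
    have := Real.rpow_nonneg hp.le (γ - 2)
    have : 0 ≤ γ := by linarith
    positivity
  have hq : a * γ * η t x ^ (γ - 2) ≤ a * γ * lo ^ (γ - 2) := by
    have : 0 ≤ γ := by linarith
    have := Real.rpow_le_rpow_of_nonpos hlo hη.1 (by linarith : γ - 2 ≤ 0)
    gcongr
  set δ := ν / hi
  set q := a * γ * η t x ^ (γ - 2)
  set B := a * γ * lo ^ (γ - 2)
  set z := dX (dX w) t x
  set r := dX η t x
  set u := w t x * dX w t x with hu
  have e1 : δ * z ^ 2 ≤ ν / η t x * z ^ 2 := by gcongr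
  have young : ∀ b : ℝ, b * z ≤ δ / 4 * z ^ 2 + b ^ 2 / δ := fun b => by
    have h : δ / 4 * z ^ 2 + b ^ 2 / δ - b * z = (δ / 2 * z - b) ^ 2 / δ := by
      field_simp
      ring
    have : 0 ≤ (δ / 2 * z - b) ^ 2 / δ := by positivity
    linarith
  have e2 := young (q * r)
  have e3 := young u
  have e4 : (q * r) ^ 2 / δ ≤ B ^ 2 / δ * r ^ 2 := by
    calc (q * r) ^ 2 / δ = q ^ 2 / δ * r ^ 2 := by ring
      _ ≤ _ := by gcongr
  have e5 : u ^ 2 / δ = 1 / δ * (w t x ^ 2 * dX w t x ^ 2) := by rw [hu]; ring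
  linarith

lemma integral_dXX_velocity_sq_le (F : IsFlow a γ ν η w) (ha : 0 < a) (hγ1 : 1 ≤ γ) (hγ2 : γ ≤ 2)
    (hν : 0 < ν) (hT : 0 ≤ T) (hlo : 0 < lo) (hhi : 0 < hi)
    (hη : ∀ t x, 0 ≤ t → lo ≤ η t x ∧ η t x ≤ hi) {K : ℝ}
    (hK : ∀ t, 0 ≤ t → ∫ x in (0:ℝ)..1, w t x ^ 2 ≤ K) :
    ν / hi / 4 * (∫ t in (0:ℝ)..T, ∫ x in (0:ℝ)..1, dX (dX w) t x ^ 2)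
      ≤ (∫ x in (0:ℝ)..1, 1 / 2 * dX w 0 x ^ 2)
        + (a * γ * lo ^ (γ - 2)) ^ 2 / (ν / hi) *
          (∫ t in (0:ℝ)..T, ∫ x in (0:ℝ)..1, dX η t x ^ 2)
        + 1 / (ν / hi) * (4 / (9 * (ν / hi) ^ 2) * K ^ 2) *
          ∫ t in (0:ℝ)..T, ∫ x in (0:ℝ)..1, dX w t x ^ 2 := by
  have hδ : 0 < ν / hi := by positivity
  have hid := F.gradient_identity hT
  have hYT : 0 ≤ ∫ x in (0:ℝ)..1, 1 / 2 * dX w T x ^ 2 :=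
    intervalIntegral.integral_nonneg zero_le_one fun x _ => by positivity
  have hu := F.smooth_velocity
  have hslice : ∀ t, 0 ≤ t → ∫ x in (0:ℝ)..1, -(dX (dX w) t x * dT w t x)
      ≤ -(ν / hi / 4) * (∫ x in (0:ℝ)..1, dX (dX w) t x ^ 2)
        + (a * γ * lo ^ (γ - 2)) ^ 2 / (ν / hi) * (∫ x in (0:ℝ)..1, dX η t x ^ 2)
        + 1 / (ν / hi) * (4 / (9 * (ν / hi) ^ 2) * K ^ 2) * ∫ x in (0:ℝ)..1, dX w t x ^ 2 := by
    intro t ht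
    have h1 := hu.continuous_slice t
    have h2 := hu.dX.continuous_slice t
    have h3 := hu.dX.dX.continuous_slice t
    have h4 := hu.dT.continuous_slice t
    have h5 := F.smooth_density.dX.continuous_slice t
    have hK0 : 0 ≤ ∫ x in (0:ℝ)..1, w t x ^ 2 :=
      intervalIntegral.integral_nonneg zero_le_one fun x _ => sq_nonneg _
    have hY0 : 0 ≤ ∫ x in (0:ℝ)..1, dX w t x ^ 2 :=
      intervalIntegral.integral_nonneg zero_le_one fun x _ => sq_nonneg _
    have hper := F.periodic_velocity t 0
    have hper' := dX_periodic F.periodic_velocity t 0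
    rw [zero_add] at hper hper'
    have hinterp := integral_sq_mul_sq_le (fun x => hu.hasDerivAt_snd t x)
      (fun x => hu.dX.hasDerivAt_snd t x) h3 hper hper'
      (exists_zero_of_integral_mul_eq_zero (F.smooth_density.continuous_slice t) h1
        (fun x => F.pos t x ht) (F.integral_momentum ht)) hδ
    have hmono : ∫ x in (0:ℝ)..1, -(dX (dX w) t x * dT w t x)
        ≤ ∫ x in (0:ℝ)..1, (-(ν / hi / 2) * dX (dX w) t x ^ 2
          + (a * γ * lo ^ (γ - 2)) ^ 2 / (ν / hi) * dX η t x ^ 2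
          + 1 / (ν / hi) * (w t x ^ 2 * dX w t x ^ 2)) :=
      intervalIntegral.integral_mono_on zero_le_one
        (Continuous.intervalIntegrable (by fun_prop) _ _)
        (Continuous.intervalIntegrable (by fun_prop) _ _)
        fun x _ => F.neg_dXX_mul_dT_le ha hγ1 hγ2 hν ht hlo (hη t x ht)
    rw [intervalIntegral.integral_add (Continuous.intervalIntegrable (by fun_prop) _ _)
      (Continuous.intervalIntegrable (by fun_prop) _ _), intervalIntegral.integral_add
      (Continuous.intervalIntegrable (by fun_prop) _ _)
      (Continuous.intervalIntegrable (by fun_prop) _ _), intervalIntegral.integral_const_mul,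
      intervalIntegral.integral_const_mul, intervalIntegral.integral_const_mul] at hmono
    have hKsq : 4 / (9 * (ν / hi) ^ 2) * (∫ x in (0:ℝ)..1, w t x ^ 2) ^ 2
          * (∫ x in (0:ℝ)..1, dX w t x ^ 2)
        ≤ 4 / (9 * (ν / hi) ^ 2) * K ^ 2 * ∫ x in (0:ℝ)..1, dX w t x ^ 2 := by
      gcongr
      exact hK t ht
    set δ := ν / hi
    have hfin := mul_le_mul_of_nonneg_left (hinterp.trans (add_le_add_right hKsq _))
      (one_div_pos.2 hδ).le
    have he : 1 / δ * (δ ^ 2 / 4 * (∫ x in (0:ℝ)..1, dX (dX w) t x ^ 2))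
        = δ / 4 * ∫ x in (0:ℝ)..1, dX (dX w) t x ^ 2 := by
      field_simp
    rw [mul_add, he] at hfin
    linarith
  have hZc := hu.dX.dX.continuous_integral_sq 0 1
  have hRc := F.smooth_density.dX.continuous_integral_sq 0 1
  have hYc := hu.dX.continuous_integral_sq 0 1
  have hSc := continuous_intervalIntegral_slice (f := fun t x => -(dX (dX w) t x * dT w t x))
    (hu.dX.dX.continuous.mul hu.dT.continuous).neg 0 1
  have hZi := (hZc.const_mul (-(ν / hi / 4))).intervalIntegrable (μ := volume) 0 T
  have hRi := (hRc.const_mul ((a * γ * lo ^ (γ - 2)) ^ 2 / (ν / hi))).intervalIntegrable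
    (μ := volume) 0 T
  have hYi := (hYc.const_mul (1 / (ν / hi) * (4 / (9 * (ν / hi) ^ 2) * K ^ 2))).intervalIntegrable
    (μ := volume) 0 T
  have htime := intervalIntegral.integral_mono_on hT (hSc.intervalIntegrable 0 T)
    ((hZi.add hRi).add hYi) fun t ht => hslice t ht.1
  rw [intervalIntegral.integral_add (hZi.add hRi) hYi, intervalIntegral.integral_add hZi hRi,
    intervalIntegral.integral_const_mul,
    intervalIntegral.integral_const_mul, intervalIntegral.integral_const_mul] at htime
  linarith

end IsFlow

/-- The space-time bound on `∂ₓ²w` over finite time intervals, in terms of the relative energy. -/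
lemma exists_dXX_velocity_bound {a γ ν ςlow ςbar E : ℝ} (ha : 0 < a) (hγ1 : 1 ≤ γ) (hγ2 : γ ≤ 2)
    (hν : 0 < ν) (hςlow : 0 < ςlow) (hςord : ςlow ≤ ςbar) :
    ∃ C : ℝ, 0 < C ∧ ∀ η w : ℝ → ℝ → ℝ, IsFlow a γ ν η w → (∀ x, ςlow ≤ η 0 x) →
      (∀ x, η 0 x ≤ ςbar) → ∫ x in (0:ℝ)..1, energyDensity a γ η w 0 x ≤ E → ∀ T, 0 ≤ T →
      ∫ t in (0:ℝ)..T, ∫ x in (0:ℝ)..1, dX (dX w) t x ^ 2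
        ≤ C * ∫ x in (0:ℝ)..1, sobolevDensity η w 0 x := by
  obtain ⟨lo, hi, hlo, hhi, hbd⟩ := exists_density_bounds (ςbar := ςbar) (E := E) ha hγ1 hγ2 hν hςlow
  obtain ⟨C₁, hC₁, hinit⟩ := IsFlow.exists_initial_bound (ν := ν) ha hγ1 hγ2 hςlow hςord
  have hγ0 : 0 < γ := by linarith
  have hhp : 0 < hi ^ (γ - 3) := Real.rpow_pos_of_pos hhi _
  set c := ν * (a * γ * hi ^ (γ - 3)) with hc
  have hcpos : 0 < c := by positivity
  set δ := ν / hi with hδ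
  have hδpos : 0 < δ := by positivity
  set k₁ := (a * γ * lo ^ (γ - 2)) ^ 2 / δ with hk₁
  set k₂ := 1 / δ * (4 / (9 * δ ^ 2) * (2 * E / lo) ^ 2) with hk₂
  have hk₁0 : 0 ≤ k₁ := by positivity
  have hk₂0 : 0 ≤ k₂ := by positivity
  refine ⟨4 / δ * (1 / 2 + k₁ * (C₁ / c) + k₂ * (C₁ / ν)), by positivity,
    fun η w F hlow hhigh hE T hT => ?_⟩
  have hη := hbd η w F hlow hhigh hE
  obtain ⟨hE1, hE2⟩ := hinit η w F hlow hhigh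
  have hmain := F.integral_dXX_velocity_sq_le ha hγ1 hγ2 hν hT hlo hhi hη (K := 2 * E / lo)
    fun t ht => F.integral_velocity_sq_le ha.le hγ0.le ht hlo (fun x => (hη t x ht).1)
      (F.integral_energyDensity_le hν.le ht hE)
  have hY := F.integral_dX_velocity_sq_le ha.le hγ0.le hν hT hE1
  have hR := F.integral_dX_density_sq_le ha hγ1 hγ2 hν hT hhi (fun t x ht => (hη t x ht).2) hE2
  have h0 : ∫ x in (0:ℝ)..1, 1 / 2 * dX w 0 x ^ 2
      ≤ 1 / 2 * ∫ x in (0:ℝ)..1, sobolevDensity η w 0 x := by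
    rw [← intervalIntegral.integral_const_mul]
    have hwx := F.smooth_velocity.dX.continuous_slice 0
    refine intervalIntegral.integral_mono_on zero_le_one
      (Continuous.intervalIntegrable (by fun_prop) _ _)
      ((F.continuous_sobolevDensity.const_mul _).intervalIntegrable _ _) fun x _ => ?_
    rw [sobolevDensity]
    nlinarith [sq_nonneg (η 0 x - 1), sq_nonneg (dX η 0 x), sq_nonneg (w 0 x)]
  set D := ∫ x in (0:ℝ)..1, sobolevDensity η w 0 x
  set Z := ∫ t in (0:ℝ)..T, ∫ x in (0:ℝ)..1, dX (dX w) t x ^ 2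
  have hle : δ / 4 * Z ≤ 1 / 2 * D + k₁ * (C₁ * D / c) + k₂ * (C₁ * D / ν) := by
    refine hmain.trans ?_
    gcongr
  calc Z = 4 / δ * (δ / 4 * Z) := by field_simp
    _ ≤ 4 / δ * (1 / 2 * D + k₁ * (C₁ * D / c) + k₂ * (C₁ * D / ν)) := by gcongr
    _ = _ := by ring

lemma sobolevDensity_integral_eq {a γ ν : ℝ} {η w : ℝ → ℝ → ℝ} (F : IsFlow a γ ν η w) :
    ∫ x in (0:ℝ)..1, sobolevDensity η w 0 x = HSq 1 (fun x => η 0 x - 1) + HSq 1 (w 0) := by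
  have h1 := F.smooth_density.continuous_slice 0
  have h2 := F.smooth_velocity.continuous_slice 0
  have h3 := F.smooth_density.dX.continuous_slice 0
  have h4 := F.smooth_velocity.dX.continuous_slice 0
  have e : deriv (fun x => η 0 x - 1) = dX η 0 := by
    ext x
    rw [deriv_sub_const]
    rfl
  have e' : deriv (w 0) = dX w 0 := rfl
  simp only [HSq, Finset.sum_range_succ, Finset.sum_range_zero, zero_add, iterate_zero, iterate_one,
    id_eq, e, e', sobolevDensity]
  rw [intervalIntegral.integral_add, intervalIntegral.integral_add, intervalIntegral.integral_add]
  all_goals exact Continuous.intervalIntegrable (by fun_prop) _ _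

lemma integral_energyDensity_le_Ppot {a γ ν : ℝ} {η w : ℝ → ℝ → ℝ} (ha : 0 ≤ a) (hγ : 1 ≤ γ)
    (F : IsFlow a γ ν η w) :
    ∫ x in (0:ℝ)..1, energyDensity a γ η w 0 x
      ≤ ∫ x in (0:ℝ)..1, ((1 / 2) * η 0 x * (w 0 x) ^ 2 + Ppot a γ (η 0 x)) := by
  obtain ⟨c, d, h⟩ := relPot_eq_Ppot (a := a) (γ := γ)
  obtain ⟨hc, hP⟩ := h ha hγ
  have h1 := F.smooth_density.continuous_slice 0
  have he := F.continuous_energyDensity (t := 0) le_rfl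
  have e : ∀ x, (1 / 2) * η 0 x * (w 0 x) ^ 2 + Ppot a γ (η 0 x)
      = energyDensity a γ η w 0 x + (d * η 0 x + (c - d)) := fun x => by
    rw [energyDensity, hP]
    ring
  simp only [e]
  rw [intervalIntegral.integral_add (he.intervalIntegrable _ _)
    (Continuous.intervalIntegrable (by fun_prop) _ _), intervalIntegral.integral_add
    (Continuous.intervalIntegrable (by fun_prop) _ _) intervalIntegrable_const,
    intervalIntegral.integral_const_mul, F.mass_zero, intervalIntegral.integral_const]
  simp
  exact hc

end

/-- **Space–time bound for `∂ₓ² w`** (Lemma `prop-vxx-L2`): there is `C > 0`,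
depending only on `(a, γ, ν, ς̄₀, ς̲₀, Ē)`, such that every global smooth
solution of the 1D isentropic compressible Navier–Stokes system on
`[0,∞) × 𝕋` with `ς̲₀ ≤ η₀ ≤ ς̄₀`, `∫_𝕋 η₀ = 1`, `∫_𝕋 η₀ w₀ = 0` and initial
energy `E₀₀ ≤ Ē` satisfies `∫₀^∞ ∫_𝕋 (∂ₓ² w)² dx dt ≤ C E₁₀`, where
`E₁₀ = ‖η₀ - 1‖²_{H¹} + ‖w₀‖²_{H¹}` (the time integral is taken in the sense
of the lower Lebesgue integral of the nonnegative integrand). -/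
theorem spacetime_wxx_bound (a γ ν ςlow ςbar Ebar : ℝ)
    (ha : 0 < a) (hγ1 : 1 ≤ γ) (hγ2 : γ ≤ 2) (hν : 0 < ν)
    (hςlow : 0 < ςlow) (hςord : ςlow ≤ ςbar) (hEbar : 0 < Ebar) :
    ∃ C : ℝ, 0 < C ∧
      ∀ η w : ℝ → ℝ → ℝ,
        ContDiff ℝ (⊤ : ℕ∞) (Function.uncurry η) →
        ContDiff ℝ (⊤ : ℕ∞) (Function.uncurry w) →
        (∀ t x : ℝ, η t (x + 1) = η t x) →
        (∀ t x : ℝ, w t (x + 1) = w t x) →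
        (∀ t x : ℝ, 0 ≤ t → 0 < η t x) →
        (∀ t x : ℝ, 0 ≤ t →
          deriv (fun s => η s x) t + deriv (fun y => η t y * w t y) x = 0) →
        (∀ t x : ℝ, 0 ≤ t →
          η t x * (deriv (fun s => w s x) t + w t x * deriv (w t) x)
            - ν * deriv (deriv (w t)) x + deriv (fun y => a * η t y ^ γ) x = 0) →
        (∀ x : ℝ, ςlow ≤ η 0 x) →
        (∀ x : ℝ, η 0 x ≤ ςbar) →
        (∫ x in (0:ℝ)..1, η 0 x) = 1 →
        (∫ x in (0:ℝ)..1, η 0 x * w 0 x) = 0 →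
        (∫ x in (0:ℝ)..1, ((1 / 2) * η 0 x * (w 0 x) ^ 2 + Ppot a γ (η 0 x))) ≤ Ebar →
        (∫⁻ t in Set.Ioi (0:ℝ),
            ENNReal.ofReal (∫ x in (0:ℝ)..1, (deriv (deriv (w t)) x) ^ 2))
          ≤ ENNReal.ofReal (C * (HSq 1 (fun x => η 0 x - 1) + HSq 1 (w 0))) := by
  obtain ⟨C, hC, hbound⟩ := exists_dXX_velocity_bound (E := Ebar) ha hγ1 hγ2 hν hςlow hςord
  refine ⟨C, hC, fun η w hη hw hηper hwper hpos hmass hmom hlow hhigh hmass₀ hmom₀ hE => ?_⟩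
  have hη' : Smooth2 η := hη
  have hw' : Smooth2 w := hw
  have F : IsFlow a γ ν η w :=
    { smooth_density := hη'
      smooth_velocity := hw'
      periodic_density := hηper
      periodic_velocity := hwper
      pos := hpos
      mass_eq := fun t x ht => by
        have h := hmass t x ht
        have h2 : deriv (fun y => η t y * w t y) x = _ :=
          ((hη'.hasDerivAt_snd t x).mul (hw'.hasDerivAt_snd t x)).deriv
        rw [h2] at h
        exact eq_neg_of_add_eq_zero_left h
      momentum_eq := fun t x ht => by
        have h := hmom t x ht
        have h2 : deriv (fun y => a * η t y ^ γ) x = _ :=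
          (((hη'.hasDerivAt_snd t x).rpow_const (p := γ)
            (Or.inl (hpos t x ht).ne')).const_mul a).deriv
        rw [h2] at h
        have h3 : η t x * (dT w t x + w t x * dX w t x) - ν * dX (dX w) t x
          + a * (dX η t x * γ * η t x ^ (γ - 1)) = 0 := h
        linarith
      mass_zero := hmass₀
      momentum_zero := hmom₀ }
  rw [← sobolevDensity_integral_eq F]
  refine lintegral_Ioi_le_of_intervalIntegral_le
    (hw'.dX.dX.continuous_integral_sq 0 1)
    (fun t => intervalIntegral.integral_nonneg zero_le_one fun x _ => sq_nonneg _) ?_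
  exact hbound η w F hlow hhigh ((integral_energyDensity_le_Ppot ha.le hγ1 F).trans hE)
end

section
/- Fix a > 0, γ ∈ [1,2], ν > 0, constants 0 < ς̲₀ ≤ ς̄₀ and Ē₁ > 0. There exist positive constants C and α, depending only on (a, γ, ν, ς̄₀, ς̲₀, Ē₁), with the following property: for every global smooth solution (η, w) of the 1D isentropic compressible Navier–Stokes system on [0,∞) × T whose initial data satisfy ς̲₀ ≤ η₀ ≤ ς̄₀, ∫_T η₀ dx = 1, ∫_T η₀ w₀ dx = 0 and E₁₀ := ‖η₀ − 1‖²_{H¹(T)} + ‖w₀‖²_{H¹(T)} ≤ Ē₁, one has for all t ≥ 0, with the material derivative D_t w := ∂_t w + w ∂_x w and E₂₀ := ‖η₀ − 1‖²_{H²(T)} + ‖w₀‖²_{H²(T)}: ∫_T η |D_t w|²(t,x) dx ≤ C E₂₀ e^{−α t}, and moreover ∫₀^∞ ∫_T |∂_x (D_t w)|²(t,x) dx dt ≤ C E₂₀. -/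
open MeasureTheory

/-- The material derivative `D_t w = ∂ₜ w + w ∂ₓ w` of `w : ℝ → ℝ → ℝ`. -/
noncomputable def matDeriv (w : ℝ → ℝ → ℝ) (t x : ℝ) : ℝ :=
  deriv (fun s => w s x) t + w t x * deriv (w t) x

namespace NavierStokes

open Set Filter Topology intervalIntegral
open scoped ContDiff

/-- The time derivative of a function of time and space. -/
noncomputable def dt (f : ℝ → ℝ → ℝ) (t x : ℝ) : ℝ := deriv (fun s => f s x) t

/-- The space derivative of a function of time and space. -/
noncomputable def dx (f : ℝ → ℝ → ℝ) (t x : ℝ) : ℝ := deriv (f t) x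

/-- Smoothness at every point of nonnegative time. -/
def SmoothFwd (f : ℝ → ℝ → ℝ) : Prop :=
  ∀ t x : ℝ, 0 ≤ t → ContDiffAt ℝ ∞ (Function.uncurry f) (t, x)

namespace SmoothFwd

variable {f g : ℝ → ℝ → ℝ} {t : ℝ}

lemma hasDerivAt_fderiv_time {t x : ℝ} (h : DifferentiableAt ℝ (Function.uncurry f) (t, x)) :
    HasDerivAt (fun s => f s x) (fderiv ℝ (Function.uncurry f) (t, x) (1, 0)) t := by
  have h1 : HasDerivAt (fun s : ℝ => (s, x)) ((1 : ℝ), (0 : ℝ)) t :=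
    (hasDerivAt_id t).prodMk (hasDerivAt_const t x)
  exact HasFDerivAt.comp_hasDerivAt t (f := fun s : ℝ => (s, x)) h.hasFDerivAt h1

lemma hasDerivAt_fderiv_space {t x : ℝ} (h : DifferentiableAt ℝ (Function.uncurry f) (t, x)) :
    HasDerivAt (f t) (fderiv ℝ (Function.uncurry f) (t, x) (0, 1)) x := by
  have h1 : HasDerivAt (fun s : ℝ => (t, s)) ((0 : ℝ), (1 : ℝ)) x :=
    (hasDerivAt_const x t).prodMk (hasDerivAt_id x)
  exact HasFDerivAt.comp_hasDerivAt x (f := fun s : ℝ => (t, s)) h.hasFDerivAt h1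

lemma differentiableAt (hf : SmoothFwd f) (ht : 0 ≤ t) (x : ℝ) :
    DifferentiableAt ℝ (Function.uncurry f) (t, x) :=
  (hf t x ht).differentiableAt (by simp)

lemma hasDerivAt_time (hf : SmoothFwd f) (ht : 0 ≤ t) (x : ℝ) :
    HasDerivAt (fun s => f s x) (dt f t x) t :=
  (hasDerivAt_fderiv_time (hf.differentiableAt ht x)).differentiableAt.hasDerivAt

lemma hasDerivAt_space (hf : SmoothFwd f) (ht : 0 ≤ t) (x : ℝ) :
    HasDerivAt (f t) (dx f t x) x :=
  (hasDerivAt_fderiv_space (hf.differentiableAt ht x)).differentiableAt.hasDerivAt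

lemma eventually_differentiableAt (hf : SmoothFwd f) (ht : 0 ≤ t) (x : ℝ) :
    ∀ᶠ p in 𝓝 (t, x), DifferentiableAt ℝ (Function.uncurry f) p := by
  have h1 : ContDiffAt ℝ 1 (Function.uncurry f) (t, x) := (hf t x ht).of_le (by exact_mod_cast le_top)
  exact (h1.eventually (by simp)).mono fun p hp => hp.differentiableAt (by simp)

lemma dt_eventuallyEq (hf : SmoothFwd f) (ht : 0 ≤ t) (x : ℝ) :
    Function.uncurry (dt f) =ᶠ[𝓝 (t, x)]
      fun p => fderiv ℝ (Function.uncurry f) p (1, 0) :=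
  (hf.eventually_differentiableAt ht x).mono fun _ hp => (hasDerivAt_fderiv_time hp).deriv

lemma dx_eventuallyEq (hf : SmoothFwd f) (ht : 0 ≤ t) (x : ℝ) :
    Function.uncurry (dx f) =ᶠ[𝓝 (t, x)]
      fun p => fderiv ℝ (Function.uncurry f) p (0, 1) :=
  (hf.eventually_differentiableAt ht x).mono fun _ hp => (hasDerivAt_fderiv_space hp).deriv

lemma contDiffAt_fderiv (hf : SmoothFwd f) (ht : 0 ≤ t) (x : ℝ) :
    ContDiffAt ℝ ∞ (fderiv ℝ (Function.uncurry f)) (t, x) :=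
  (hf t x ht).fderiv_right (by simp)

lemma dt (hf : SmoothFwd f) : SmoothFwd (dt f) := fun _ x ht =>
  ((hf.contDiffAt_fderiv ht x).clm_apply contDiffAt_const).congr_of_eventuallyEq
    (hf.dt_eventuallyEq ht x)

lemma dx (hf : SmoothFwd f) : SmoothFwd (dx f) := fun _ x ht =>
  ((hf.contDiffAt_fderiv ht x).clm_apply contDiffAt_const).congr_of_eventuallyEq
    (hf.dx_eventuallyEq ht x)

lemma dt_dx (hf : SmoothFwd f) (ht : 0 ≤ t) (x : ℝ) :
    NavierStokes.dt (NavierStokes.dx f) t x = NavierStokes.dx (NavierStokes.dt f) t x := by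
  have hd : DifferentiableAt ℝ (fderiv ℝ (Function.uncurry f)) (t, x) :=
    (hf.contDiffAt_fderiv ht x).differentiableAt (by simp)
  have h1 := (hasDerivAt_fderiv_time (hf.dx.differentiableAt ht x)).deriv
  have h2 := (hasDerivAt_fderiv_space (hf.dt.differentiableAt ht x)).deriv
  rw [(hf.dx_eventuallyEq ht x).fderiv_eq, fderiv_clm_apply hd (differentiableAt_const _)] at h1
  rw [(hf.dt_eventuallyEq ht x).fderiv_eq, fderiv_clm_apply hd (differentiableAt_const _)] at h2
  have hs : IsSymmSndFDerivAt ℝ (Function.uncurry f) (t, x) :=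
    (hf t x ht).isSymmSndFDerivAt (by
      rw [minSmoothness_of_isRCLikeNormedField]
      exact (WithTop.coe_le_coe (b := (2 : ℕ∞))).2 le_top)
  refine h1.trans (Eq.trans ?_ h2.symm)
  simpa using hs.eq (1, 0) (0, 1)

lemma continuousOn (hf : SmoothFwd f) :
    ContinuousOn (Function.uncurry f) (Ici 0 ×ˢ univ) := fun p hp =>
  (hf p.1 p.2 hp.1).continuousAt.continuousWithinAt

lemma continuous_space (hf : SmoothFwd f) (ht : 0 ≤ t) : Continuous (f t) :=
  continuous_iff_continuousAt.2 fun x => (hf.hasDerivAt_space ht x).continuousAt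

lemma const (c : ℝ) : SmoothFwd fun _ _ => c := fun _ _ _ => contDiffAt_const

lemma add (hf : SmoothFwd f) (hg : SmoothFwd g) : SmoothFwd fun t x => f t x + g t x :=
  fun t x ht => (hf t x ht).add (hg t x ht)

lemma sub (hf : SmoothFwd f) (hg : SmoothFwd g) : SmoothFwd fun t x => f t x - g t x :=
  fun t x ht => (hf t x ht).sub (hg t x ht)

lemma mul (hf : SmoothFwd f) (hg : SmoothFwd g) : SmoothFwd fun t x => f t x * g t x :=
  fun t x ht => (hf t x ht).mul (hg t x ht)

lemma pow (hf : SmoothFwd f) (n : ℕ) : SmoothFwd fun t x => f t x ^ n :=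
  fun t x ht => (hf t x ht).pow n

lemma comp {h : ℝ → ℝ} (hf : SmoothFwd f)
    (hh : ∀ t x, 0 ≤ t → ContDiffAt ℝ ∞ h (f t x)) : SmoothFwd fun t x => h (f t x) :=
  fun t x ht => ContDiffAt.comp (g := h) (f := Function.uncurry f) (t, x) (hh t x ht) (hf t x ht)

lemma continuousOn_integral (hf : SmoothFwd f) :
    ContinuousOn (fun t => ∫ x in (0 : ℝ)..1, f t x) (Ici 0) := by
  have := hf.continuousOn
  rw [continuousOn_iff_continuous_domRestrict]
  refine intervalIntegral.continuous_parametric_intervalIntegral_of_continuous'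
    (f := fun (t : Ici (0 : ℝ)) x => f t x) ?_ 0 1
  exact this.comp_continuous (by fun_prop : Continuous fun p : Ici (0 : ℝ) × ℝ => ((p.1 : ℝ), p.2))
    fun p => ⟨p.1.2, trivial⟩

lemma hasDerivAt_integral (hf : SmoothFwd f) (ht : 0 < t) :
    HasDerivAt (fun t => ∫ x in (0 : ℝ)..1, f t x)
      (∫ x in (0 : ℝ)..1, NavierStokes.dt f t x) t := by
  have hK : IsCompact (Icc (t / 2) (t + 1) ×ˢ Icc (0 : ℝ) 1) := isCompact_Icc.prod isCompact_Icc
  have hc : ContinuousOn (Function.uncurry (NavierStokes.dt f))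
      (Icc (t / 2) (t + 1) ×ˢ Icc (0 : ℝ) 1) :=
    hf.dt.continuousOn.mono fun p hp => ⟨le_trans (by positivity) hp.1.1, trivial⟩
  obtain ⟨C, hC⟩ := hK.exists_bound_of_continuousOn hc
  have hs : Ioo (t / 2) (t + 1) ∈ 𝓝 t := Ioo_mem_nhds (by linarith) (by linarith)
  refine (intervalIntegral.hasDerivAt_integral_of_dominated_loc_of_deriv_le
    (F := f) (F' := NavierStokes.dt f) (bound := fun _ => C) hs ?_ ?_ ?_ ?_ ?_ ?_).2
  · filter_upwards [lt_mem_nhds ht] with s hs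
    exact (hf.continuous_space hs.le).aestronglyMeasurable
  · exact (hf.continuous_space ht.le).intervalIntegrable _ _
  · exact (hf.dt.continuous_space ht.le).aestronglyMeasurable
  · refine Eventually.of_forall fun x hx s hs => ?_
    rw [uIoc_of_le zero_le_one] at hx
    exact hC (s, x) ⟨⟨hs.1.le, hs.2.le⟩, hx.1.le, hx.2⟩
  · simp
  · refine Eventually.of_forall fun x _ s hs => ?_
    exact hf.hasDerivAt_time (by linarith [hs.1]) x

lemma integral_dx (hf : SmoothFwd f) (ht : 0 ≤ t) (hper : f t 1 = f t 0) :
    ∫ x in (0 : ℝ)..1, NavierStokes.dx f t x = 0 := by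
  rw [intervalIntegral.integral_eq_sub_of_hasDerivAt
    (fun x _ => hf.hasDerivAt_space ht x) ((hf.dx.continuous_space ht).intervalIntegrable _ _),
    hper, sub_self]

/-- A local balance law with periodic flux integrates to a balance law for the total. -/
lemma hasDerivAt_integral_of_balance {d : ℝ → ℝ} (hf : SmoothFwd f) (hg : SmoothFwd g)
    (ht : 0 < t) (hper : g t 1 = g t 0)
    (h : ∀ x, NavierStokes.dt f t x = NavierStokes.dx g t x - d x) :
    HasDerivAt (fun t => ∫ x in (0 : ℝ)..1, f t x) (-∫ x in (0 : ℝ)..1, d x) t := by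
  have h1 := hf.hasDerivAt_integral ht
  have h2 : ∀ x, d x = NavierStokes.dx g t x - NavierStokes.dt f t x := fun x => by
    rw [h x]; ring
  have h3 : ∫ x in (0 : ℝ)..1, d x = -∫ x in (0 : ℝ)..1, NavierStokes.dt f t x := by
    simp_rw [h2]
    rw [intervalIntegral.integral_sub ((hg.dx.continuous_space ht.le).intervalIntegrable _ _)
      ((hf.dt.continuous_space ht.le).intervalIntegrable _ _), hg.integral_dx ht.le hper, zero_sub]
  rwa [h3, neg_neg]

end SmoothFwd

/-- A function on the unit interval orthogonal to a positive weight vanishes somewhere. -/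
lemma exists_eq_zero_of_integral_mul_eq_zero {ρ f : ℝ → ℝ} (hρ : Continuous ρ) (hf : Continuous f)
    (hpos : ∀ x, 0 < ρ x) (h : ∫ x in (0 : ℝ)..1, ρ x * f x = 0) : ∃ x ∈ Icc (0 : ℝ) 1, f x = 0 := by
  by_contra! hne
  have key : (∀ x ∈ Icc (0 : ℝ) 1, 0 < f x) ∨ ∀ x ∈ Icc (0 : ℝ) 1, f x < 0 := by
    by_contra! hcon
    obtain ⟨⟨x, hx, hfx⟩, y, hy, hfy⟩ := hcon
    obtain ⟨z, hz, hfz⟩ := isPreconnected_Icc.intermediate_value hx hy hf.continuousOn ⟨hfx, hfy⟩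
    exact hne z hz hfz
  rcases key with hp | hp
  · exact (intervalIntegral.integral_pos zero_lt_one (hρ.mul hf).continuousOn
      (fun x hx => (mul_pos (hpos x) (hp x ⟨hx.1.le, hx.2⟩)).le)
      ⟨0, by simp, mul_pos (hpos 0) (hp 0 (by simp))⟩).ne' h
  · have := intervalIntegral.integral_pos zero_lt_one (hρ.mul hf).neg.continuousOn
      (fun x hx => (neg_pos.2 (mul_neg_of_pos_of_neg (hpos x) (hp x ⟨hx.1.le, hx.2⟩))).le)
      ⟨0, by simp, neg_pos.2 (mul_neg_of_pos_of_neg (hpos 0) (hp 0 (by simp)))⟩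
    simp only [Pi.neg_apply, Pi.mul_apply, intervalIntegral.integral_neg] at this
    linarith

lemma abs_sub_le_integral_abs {f g : ℝ → ℝ} (hg : Continuous g) (hd : ∀ x, HasDerivAt f (g x) x)
    {x y : ℝ} (hx : x ∈ Icc (0 : ℝ) 1) (hy : y ∈ Icc (0 : ℝ) 1) :
    |f x - f y| ≤ ∫ s in (0 : ℝ)..1, |g s| := by
  wlog hxy : y ≤ x generalizing x y
  · rw [abs_sub_comm]
    exact this hy hx (le_of_not_ge hxy)
  rw [← intervalIntegral.integral_eq_sub_of_hasDerivAt (fun z _ => hd z)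
    (hg.intervalIntegrable _ _)]
  refine (intervalIntegral.abs_integral_le_integral_abs hxy).trans ?_
  exact intervalIntegral.integral_mono_interval hy.1 hxy hx.2
    (Eventually.of_forall fun _ => abs_nonneg _) (hg.abs.intervalIntegrable _ _)

/-- A one-dimensional Poincaré inequality for functions with a zero. -/
lemma sq_le_integral_sq {f g : ℝ → ℝ} (hg : Continuous g) (hd : ∀ x, HasDerivAt f (g x) x)
    {x y : ℝ} (hx : x ∈ Icc (0 : ℝ) 1) (hy : y ∈ Icc (0 : ℝ) 1) (h0 : f y = 0) :
    f x ^ 2 ≤ ∫ s in (0 : ℝ)..1, g s ^ 2 := by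
  have h1 := abs_sub_le_integral_abs hg hd hx hy
  rw [h0, sub_zero] at h1
  set c := ∫ s in (0 : ℝ)..1, |g s| with hc
  have h2 : 0 ≤ ∫ s in (0 : ℝ)..1, (|g s| - c) ^ 2 :=
    intervalIntegral.integral_nonneg zero_le_one fun _ _ => sq_nonneg _
  have h3 : ∫ s in (0 : ℝ)..1, (|g s| - c) ^ 2 = (∫ s in (0 : ℝ)..1, g s ^ 2) - c ^ 2 := by
    have : ∀ s, (|g s| - c) ^ 2 = g s ^ 2 - (2 * c) * |g s| + c ^ 2 := fun s => by
      rw [← sq_abs (g s)]; ring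
    simp_rw [this]
    rw [intervalIntegral.integral_add (Continuous.intervalIntegrable (by fun_prop) _ _)
      (Continuous.intervalIntegrable (by fun_prop) _ _),
      intervalIntegral.integral_sub (Continuous.intervalIntegrable (by fun_prop) _ _)
      (Continuous.intervalIntegrable (by fun_prop) _ _), intervalIntegral.integral_const_mul, ← hc]
    simp
    ring
  calc f x ^ 2 = |f x| ^ 2 := (sq_abs _).symm
    _ ≤ c ^ 2 := by gcongr
    _ ≤ _ := by linarith

/-- The potential energy per unit mass for the pressure law `a * s ^ γ`, relative to density one. -/
noncomputable def potential (a γ r : ℝ) : ℝ :=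
  if γ = 1 then a * (Real.log r + r⁻¹ - 1)
  else a * ((r ^ (γ - 1) - 1) / (γ - 1) + r⁻¹ - 1)

section potential

variable {a γ r m M : ℝ}

lemma contDiffAt_potential (hr : 0 < r) : ContDiffAt ℝ ∞ (potential a γ) r := by
  unfold potential
  split_ifs
  · exact contDiffAt_const.mul (((Real.contDiffAt_log.2 hr.ne').add
      (contDiffAt_inv ℝ hr.ne')).sub contDiffAt_const)
  · exact contDiffAt_const.mul (((((Real.contDiffAt_rpow_const_of_ne hr.ne').sub
      contDiffAt_const).div_const _).add (contDiffAt_inv ℝ hr.ne')).sub contDiffAt_const)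

lemma hasDerivAt_potential (hr : 0 < r) :
    HasDerivAt (potential a γ) ((a * r ^ γ - a) / r ^ 2) r := by
  unfold potential
  split_ifs with h
  · refine ((((Real.hasDerivAt_log hr.ne').add
      (hasDerivAt_inv hr.ne')).sub_const 1).const_mul a).congr_deriv ?_
    rw [h, Real.rpow_one]
    field_simp
    ring
  · have h' : γ - 1 ≠ 0 := sub_ne_zero.2 h
    refine ((((((Real.hasDerivAt_rpow_const (p := γ - 1) (Or.inl hr.ne')).sub_const 1).div_const
      (γ - 1)).add (hasDerivAt_inv hr.ne')).sub_const 1).const_mul a).congr_deriv ?_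
    have : r ^ γ = r ^ (γ - 1 - 1) * r ^ 2 := by
      rw [← Real.rpow_natCast r 2, ← Real.rpow_add hr]; congr 1; push_cast; ring
    rw [this]
    field_simp
    ring

lemma potential_one : potential a γ 1 = 0 := by
  unfold potential
  split_ifs <;> simp

lemma potential_nonneg (ha : 0 < a) (hγ : 1 ≤ γ) (hr : 0 < r) : 0 ≤ potential a γ r := by
  rw [← potential_one (a := a) (γ := γ)]
  rcases le_total 1 r with h | h
  · refine (monotoneOn_of_deriv_nonneg (f := potential a γ) (convex_Ici 1) ?_ ?_ ?_)
      (mem_Ici.2 le_rfl) (mem_Ici.2 h) h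
    · exact fun x hx => (hasDerivAt_potential
        (zero_lt_one.trans_le hx)).continuousAt.continuousWithinAt
    · intro x hx
      rw [interior_Ici] at hx
      exact (hasDerivAt_potential (zero_lt_one.trans hx)).differentiableAt.differentiableWithinAt
    · intro x hx
      rw [interior_Ici] at hx
      rw [(hasDerivAt_potential (zero_lt_one.trans hx)).deriv]
      have : 1 ≤ x ^ γ := Real.one_le_rpow hx.le (by linarith)
      exact div_nonneg (by nlinarith) (sq_nonneg _)
  · refine (antitoneOn_of_deriv_nonpos (f := potential a γ) (convex_Ioc 0 1) ?_ ?_ ?_)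
      ⟨hr, h⟩ (right_mem_Ioc.2 zero_lt_one) h
    · exact fun x hx => (hasDerivAt_potential hx.1).continuousAt.continuousWithinAt
    · intro x hx
      rw [interior_Ioc] at hx
      exact (hasDerivAt_potential hx.1).differentiableAt.differentiableWithinAt
    · intro x hx
      rw [interior_Ioc] at hx
      rw [(hasDerivAt_potential hx.1).deriv]
      have : x ^ γ ≤ 1 := Real.rpow_le_one hx.1.le hx.2.le (by linarith)
      exact div_nonpos_of_nonpos_of_nonneg (by nlinarith) (sq_nonneg _)

lemma abs_rpow_sub_one_le (hγ : 1 ≤ γ) (hm : 0 < m) (hm1 : m ≤ 1) (hM1 : 1 ≤ M)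
    (h : r ∈ Icc m M) : |r ^ γ - 1| ≤ γ * M ^ (γ - 1) * |r - 1| := by
  have := (convex_Icc m M).norm_image_sub_le_of_norm_hasDerivWithin_le
    (f := fun s : ℝ => s ^ γ) (f' := fun s => γ * s ^ (γ - 1)) (C := γ * M ^ (γ - 1))
    (fun s hs => (Real.hasDerivAt_rpow_const (Or.inr hγ)).hasDerivWithinAt) (fun s hs => ?_)
    (show (1 : ℝ) ∈ Icc m M from ⟨hm1, hM1⟩) h
  · simpa using this
  · have hs0 : 0 < s := hm.trans_le hs.1
    rw [Real.norm_of_nonneg (by positivity)]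
    gcongr
    exact hs.2

lemma potential_le (ha : 0 < a) (hγ : 1 ≤ γ) (hm : 0 < m) (hm1 : m ≤ 1) (hM1 : 1 ≤ M)
    (h : r ∈ Icc m M) :
    potential a γ r ≤ a * (γ * M ^ (γ - 1)) / m ^ 2 * (r - 1) ^ 2 := by
  have hsub : uIcc 1 r ⊆ Icc m M := uIcc_subset_Icc ⟨hm1, hM1⟩ h
  have := (convex_uIcc 1 r).norm_image_sub_le_of_norm_hasDerivWithin_le
    (f := potential a γ) (f' := fun s => (a * s ^ γ - a) / s ^ 2)
    (C := a * (γ * M ^ (γ - 1)) / m ^ 2 * |r - 1|)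
    (fun s hs => (hasDerivAt_potential (hm.trans_le (hsub hs).1)).hasDerivWithinAt)
    (fun s hs => ?_) left_mem_uIcc right_mem_uIcc
  · rw [potential_one, sub_zero] at this
    refine (le_abs_self _).trans (this.trans (le_of_eq ?_))
    rw [Real.norm_eq_abs, mul_assoc, ← sq, sq_abs]
  · have hs' := hsub hs
    have h1 : |s - 1| ≤ |r - 1| := abs_sub_left_of_mem_uIcc hs
    have h2 := abs_rpow_sub_one_le hγ hm hm1 hM1 hs'
    have hM : 0 < M := by linarith
    rw [Real.norm_eq_abs, abs_div, show a * s ^ γ - a = a * (s ^ γ - 1) by ring, abs_mul,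
      abs_of_pos ha, abs_of_nonneg (sq_nonneg s), div_mul_eq_mul_div, mul_assoc a]
    have h3 : |s ^ γ - 1| ≤ γ * M ^ (γ - 1) * |r - 1| := h2.trans (by gcongr)
    gcongr
    exact hs'.1

end potential

/-- Smooth, spatially periodic solutions of the isentropic compressible Navier–Stokes system on
nonnegative times, with unit mass and zero momentum. -/
structure IsSolution (a γ ν : ℝ) (η w : ℝ → ℝ → ℝ) : Prop where
  smooth_density : SmoothFwd η
  smooth_velocity : SmoothFwd w
  periodic_density : ∀ t x, η t (x + 1) = η t x
  periodic_velocity : ∀ t x, w t (x + 1) = w t x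
  density_pos : ∀ t x, 0 ≤ t → 0 < η t x
  continuity : ∀ t x, 0 ≤ t → dt η t x + dx (fun t x => η t x * w t x) t x = 0
  momentum : ∀ t x, 0 ≤ t →
    η t x * matDeriv w t x - ν * dx (dx w) t x + dx (fun t x => a * η t x ^ γ) t x = 0
  initial_mass : ∫ x in (0 : ℝ)..1, η 0 x = 1
  initial_momentum : ∫ x in (0 : ℝ)..1, η 0 x * w 0 x = 0

lemma dt_periodic {f : ℝ → ℝ → ℝ} (hf : ∀ t x, f t (x + 1) = f t x) (t x : ℝ) :
    dt f t (x + 1) = dt f t x := by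
  simp only [dt, hf]

lemma dx_periodic {f : ℝ → ℝ → ℝ} (hf : ∀ t x, f t (x + 1) = f t x) (t x : ℝ) :
    dx f t (x + 1) = dx f t x := by
  have : (fun y => f t (y + 1)) = f t := funext (hf t)
  rw [dx, dx, ← deriv_comp_add_const, this]

lemma eq_one_zero_of_periodic {f : ℝ → ℝ → ℝ} (hf : ∀ t x, f t (x + 1) = f t x) (t : ℝ) :
    f t 1 = f t 0 := by
  simpa using hf t 0

/-- The pressure. -/
noncomputable def pressure (a γ : ℝ) (η : ℝ → ℝ → ℝ) (t x : ℝ) : ℝ := a * η t x ^ γ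

/-- The effective velocity `w + ν ∂ₓη / η²`. -/
noncomputable def effVelocity (ν : ℝ) (η w : ℝ → ℝ → ℝ) (t x : ℝ) : ℝ :=
  w t x + ν * (dx η t x / η t x ^ 2)

/-- The sum of the energy densities built on the velocity and on the effective velocity. -/
noncomputable def energyDensity (a γ ν : ℝ) (η w : ℝ → ℝ → ℝ) (t x : ℝ) : ℝ :=
  2⁻¹ * (η t x * w t x ^ 2) + 2⁻¹ * (η t x * effVelocity ν η w t x ^ 2)
    + 2 * (η t x * potential a γ (η t x))

namespace IsSolution

variable {a γ ν : ℝ} {η w : ℝ → ℝ → ℝ} {t : ℝ}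

lemma smooth_pressure (h : IsSolution a γ ν η w) : SmoothFwd (pressure a γ η) :=
  (SmoothFwd.const a).mul (h.smooth_density.comp fun t x ht =>
    Real.contDiffAt_rpow_const_of_ne (h.density_pos t x ht).ne')

lemma smooth_inv_density (h : IsSolution a γ ν η w) : SmoothFwd fun t x => (η t x)⁻¹ :=
  h.smooth_density.comp fun t x ht => contDiffAt_inv ℝ (h.density_pos t x ht).ne'

lemma smooth_potential (h : IsSolution a γ ν η w) :
    SmoothFwd fun t x => potential a γ (η t x) :=
  h.smooth_density.comp fun t x ht => contDiffAt_potential (h.density_pos t x ht)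

lemma smooth_effVelocity (h : IsSolution a γ ν η w) : SmoothFwd (effVelocity ν η w) := by
  have : effVelocity ν η w = fun t x => w t x + ν * (dx η t x * (η t x)⁻¹ ^ 2) := by
    funext t x
    rw [effVelocity, inv_pow, div_eq_mul_inv]
  rw [this]
  exact h.smooth_velocity.add ((SmoothFwd.const ν).mul
    (h.smooth_density.dx.mul (h.smooth_inv_density.pow 2)))

lemma smooth_energyDensity (h : IsSolution a γ ν η w) : SmoothFwd (energyDensity a γ ν η w) :=
  (((SmoothFwd.const 2⁻¹).mul (h.smooth_density.mul (h.smooth_velocity.pow 2))).add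
    ((SmoothFwd.const 2⁻¹).mul (h.smooth_density.mul (h.smooth_effVelocity.pow 2)))).add
    ((SmoothFwd.const 2).mul (h.smooth_density.mul h.smooth_potential))

lemma smooth_matDeriv (h : IsSolution a γ ν η w) : SmoothFwd (matDeriv w) :=
  h.smooth_velocity.dt.add (h.smooth_velocity.mul h.smooth_velocity.dx)

lemma pressure_periodic (h : IsSolution a γ ν η w) (t x : ℝ) :
    pressure a γ η t (x + 1) = pressure a γ η t x := by
  simp only [pressure, h.periodic_density]

lemma matDeriv_periodic (h : IsSolution a γ ν η w) (t x : ℝ) :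
    matDeriv w t (x + 1) = matDeriv w t x := by
  change dt w t (x + 1) + w t (x + 1) * dx w t (x + 1) = dt w t x + w t x * dx w t x
  rw [dt_periodic h.periodic_velocity, dx_periodic h.periodic_velocity, h.periodic_velocity]

lemma dt_density (h : IsSolution a γ ν η w) (ht : 0 ≤ t) (x : ℝ) :
    dt η t x = -(dx η t x * w t x + η t x * dx w t x) := by
  have h1 : dx (fun t x => η t x * w t x) t x = dx η t x * w t x + η t x * dx w t x :=
    ((h.smooth_density.hasDerivAt_space ht x).mul (h.smooth_velocity.hasDerivAt_space ht x)).deriv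
  linarith [h.continuity t x ht]

lemma dx_dt_density (h : IsSolution a γ ν η w) (ht : 0 ≤ t) (x : ℝ) :
    dx (dt η) t x = -(dx (dx η) t x * w t x + 2 * dx η t x * dx w t x
      + η t x * dx (dx w) t x) := by
  have h1 : dt η t = fun x => -(dx η t x * w t x + η t x * dx w t x) :=
    funext (h.dt_density ht)
  have hη := h.smooth_density.hasDerivAt_space ht x
  have hηx := h.smooth_density.dx.hasDerivAt_space ht x
  have hw := h.smooth_velocity.hasDerivAt_space ht x
  have hwx := h.smooth_velocity.dx.hasDerivAt_space ht x
  rw [dx, h1]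
  refine (((hηx.mul hw).add (hη.mul hwx)).neg).deriv.trans ?_
  ring

lemma density_mul_matDeriv (h : IsSolution a γ ν η w) (ht : 0 ≤ t) (x : ℝ) :
    η t x * matDeriv w t x = ν * dx (dx w) t x - dx (pressure a γ η) t x := by
  have : dx (pressure a γ η) t x = dx (fun t x => a * η t x ^ γ) t x := rfl
  linarith [h.momentum t x ht]

lemma dt_velocity (h : IsSolution a γ ν η w) (ht : 0 ≤ t) (x : ℝ) :
    dt w t x = (ν * dx (dx w) t x - dx (pressure a γ η) t x) / η t x - w t x * dx w t x := by
  rw [← h.density_mul_matDeriv ht, mul_div_cancel_left₀ _ (h.density_pos t x ht).ne']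
  simp only [matDeriv, dt, dx]
  ring

lemma dx_pressure (h : IsSolution a γ ν η w) (ht : 0 ≤ t) (x : ℝ) :
    dx (pressure a γ η) t x = γ * pressure a γ η t x * dx η t x / η t x := by
  have hpos := h.density_pos t x ht
  refine (((h.smooth_density.hasDerivAt_space ht x).rpow_const
    (p := γ) (Or.inl hpos.ne')).const_mul a).deriv.trans ?_
  rw [pressure, Real.rpow_sub_one hpos.ne']
  ring

lemma dt_pressure (h : IsSolution a γ ν η w) (ht : 0 ≤ t) (x : ℝ) :
    dt (pressure a γ η) t x =
      -(w t x * dx (pressure a γ η) t x + γ * (pressure a γ η t x * dx w t x)) := by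
  have hpos := h.density_pos t x ht
  have hne := hpos.ne'
  refine (((h.smooth_density.hasDerivAt_time ht x).rpow_const
    (p := γ) (Or.inl hne)).const_mul a).deriv.trans ?_
  rw [h.dx_pressure ht, pressure, Real.rpow_sub_one hne, h.dt_density ht]
  field_simp

lemma hasDerivAt_integral_energyDensity (h : IsSolution a γ ν η w) (ht : 0 < t) :
    HasDerivAt (fun t => ∫ x in (0 : ℝ)..1, energyDensity a γ ν η w t x)
      (-∫ x in (0 : ℝ)..1, (ν * dx w t x ^ 2
        + ν * γ * (pressure a γ η t x * (dx η t x ^ 2 / η t x ^ 3)))) t := by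
  have hη := h.smooth_density
  have hw := h.smooth_velocity
  have hP := h.smooth_pressure
  have hV := h.smooth_effVelocity
  have hH := h.smooth_potential
  have hG := ((hw.mul (((SmoothFwd.const ν).mul hw.dx).add
    ((SmoothFwd.const (2 * a)).sub ((SmoothFwd.const 2).mul hP)))).sub
    (h.smooth_energyDensity.mul hw))
  refine h.smooth_energyDensity.hasDerivAt_integral_of_balance hG ht ?_ ?_
  · simp only [energyDensity, effVelocity, eq_one_zero_of_periodic h.periodic_density t,
      eq_one_zero_of_periodic h.periodic_velocity t,
      eq_one_zero_of_periodic (dx_periodic h.periodic_velocity) t,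
      eq_one_zero_of_periodic (dx_periodic h.periodic_density) t,
      eq_one_zero_of_periodic h.pressure_periodic t]
  · intro x
    have hpos := h.density_pos t x ht.le
    have ηt := hη.hasDerivAt_time ht.le x
    have ηx := hη.hasDerivAt_space ht.le x
    have wt := hw.hasDerivAt_time ht.le x
    have wx := hw.hasDerivAt_space ht.le x
    have Vt : dt (effVelocity ν η w) t x = _ := (wt.add (((hη.dx.hasDerivAt_time ht.le x).div
      (ηt.pow 2) (pow_ne_zero 2 hpos.ne')).const_mul ν)).deriv
    have Vx : dx (effVelocity ν η w) t x = _ := (wx.add (((hη.dx.hasDerivAt_space ht.le x).div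
      (ηx.pow 2) (pow_ne_zero 2 hpos.ne')).const_mul ν)).deriv
    have Ht := (hasDerivAt_potential (a := a) (γ := γ) hpos).comp t ηt
    have Hx := (hasDerivAt_potential (a := a) (γ := γ) hpos).comp x ηx
    have Et : dt (energyDensity a γ ν η w) t x = _ :=
      ((((ηt.mul (wt.pow 2)).const_mul 2⁻¹).add
        ((ηt.mul ((hV.hasDerivAt_time ht.le x).pow 2)).const_mul 2⁻¹)).add
        ((ηt.mul Ht).const_mul 2)).deriv
    have Ex := ((((ηx.mul (wx.pow 2)).const_mul 2⁻¹).add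
        ((ηx.mul ((hV.hasDerivAt_space ht.le x).pow 2)).const_mul 2⁻¹)).add
        ((ηx.mul Hx).const_mul 2))
    have Gx := ((wx.mul (((hw.dx.hasDerivAt_space ht.le x).const_mul ν).add
      (((hP.hasDerivAt_space ht.le x).const_mul 2).const_sub (2 * a)))).sub
      (Ex.mul wx)).deriv
    refine Et.trans (Eq.trans ?_ (congrArg (· - _) Gx.symm))
    have hP' : a * η t x ^ γ = pressure a γ η t x := rfl
    simp only [Vt, Vx, effVelocity, Pi.pow_apply, Pi.mul_apply, Pi.add_apply,
      Function.comp, hP', Nat.add_one_sub_one, pow_one, Nat.cast_ofNat,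
      hη.dt_dx ht.le, h.dx_dt_density ht.le, h.dt_density ht.le, h.dt_velocity ht.le,
      h.dx_pressure ht.le]
    have hne := hpos.ne'
    field_simp
    ring

end IsSolution

lemma antitoneOn_Ici_of_hasDerivAt_nonpos {f f' : ℝ → ℝ} (hc : ContinuousOn f (Ici 0))
    (hd : ∀ t, 0 < t → HasDerivAt f (f' t) t) (hf' : ∀ t, 0 < t → f' t ≤ 0) :
    AntitoneOn f (Ici 0) := by
  refine antitoneOn_of_deriv_nonpos (convex_Ici 0) hc ?_ ?_ <;> rw [interior_Ici] <;> intro t ht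
  · exact (hd t ht).differentiableAt.differentiableWithinAt
  · rw [(hd t ht).deriv]
    exact hf' t ht

lemma eq_initial_of_hasDerivAt_zero {f : ℝ → ℝ} (hc : ContinuousOn f (Ici 0))
    (hd : ∀ t, 0 < t → HasDerivAt f 0 t) {t : ℝ} (ht : 0 ≤ t) : f t = f 0 := by
  refine le_antisymm (antitoneOn_Ici_of_hasDerivAt_nonpos hc hd (fun _ _ => le_rfl)
    self_mem_Ici ht ht) ?_
  have := antitoneOn_Ici_of_hasDerivAt_nonpos hc.neg (fun s hs => (hd s hs).neg)
    (fun _ _ => neg_zero.le) self_mem_Ici ht ht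
  simpa using this

namespace IsSolution

variable {a γ ν : ℝ} {η w : ℝ → ℝ → ℝ} {t : ℝ}

lemma mass (h : IsSolution a γ ν η w) (ht : 0 ≤ t) : ∫ x in (0 : ℝ)..1, η t x = 1 := by
  refine Eq.trans (eq_initial_of_hasDerivAt_zero (f := fun t => ∫ x in (0 : ℝ)..1, η t x)
    h.smooth_density.continuousOn_integral (fun t ht => ?_) ht) h.initial_mass
  have := h.smooth_density.hasDerivAt_integral_of_balance (d := fun _ => 0)
    ((SmoothFwd.const (-1)).mul (h.smooth_density.mul h.smooth_velocity)) ht ?_ fun x => ?_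
  · simpa using this
  · simp only [eq_one_zero_of_periodic h.periodic_density,
      eq_one_zero_of_periodic h.periodic_velocity]
  · have e := (((h.smooth_density.hasDerivAt_space ht.le x).mul
      (h.smooth_velocity.hasDerivAt_space ht.le x)).const_mul (-1)).deriv
    refine (h.dt_density ht.le x).trans (Eq.trans ?_ (congrArg (· - _) e.symm))
    ring

lemma momentum_eq_zero (h : IsSolution a γ ν η w) (ht : 0 ≤ t) :
    ∫ x in (0 : ℝ)..1, η t x * w t x = 0 := by
  have hη := h.smooth_density
  have hw := h.smooth_velocity
  have hP := h.smooth_pressure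
  refine Eq.trans (eq_initial_of_hasDerivAt_zero (f := fun t => ∫ x in (0 : ℝ)..1, η t x * w t x)
    (hη.mul hw).continuousOn_integral (fun t ht => ?_) ht) h.initial_momentum
  have := (hη.mul hw).hasDerivAt_integral_of_balance (d := fun _ => 0)
    ((((SmoothFwd.const ν).mul hw.dx).sub hP).sub (hη.mul (hw.pow 2))) ht ?_ fun x => ?_
  · simpa using this
  · simp only [eq_one_zero_of_periodic h.periodic_density,
      eq_one_zero_of_periodic h.periodic_velocity,
      eq_one_zero_of_periodic (dx_periodic h.periodic_velocity) t,
      eq_one_zero_of_periodic h.pressure_periodic t]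
  · have hne := (h.density_pos t x ht.le).ne'
    have e : dt (fun t x => η t x * w t x) t x = _ :=
      ((hη.hasDerivAt_time ht.le x).mul (hw.hasDerivAt_time ht.le x)).deriv
    have wx := hw.hasDerivAt_space ht.le x
    have e' := ((((hw.dx.hasDerivAt_space ht.le x).const_mul ν).sub
      (hP.hasDerivAt_space ht.le x)).sub
      ((hη.hasDerivAt_space ht.le x).mul (wx.pow 2))).deriv
    refine e.trans (Eq.trans ?_ (congrArg (· - _) e'.symm))
    simp only [Pi.pow_apply, Nat.add_one_sub_one, pow_one, Nat.cast_ofNat, h.dt_density ht.le,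
      h.dt_velocity ht.le]
    field_simp
    ring

lemma hasDerivAt_integral_sq_dx_velocity (h : IsSolution a γ ν η w) (ht : 0 < t) :
    HasDerivAt (fun t => ∫ x in (0 : ℝ)..1, dx w t x ^ 2)
      (-∫ x in (0 : ℝ)..1, 2 * (dx (dx w) t x * dt w t x)) t := by
  have hw := h.smooth_velocity
  refine (hw.dx.pow 2).hasDerivAt_integral_of_balance
    ((SmoothFwd.const 2).mul (hw.dx.mul hw.dt)) ht ?_ fun x => ?_
  · simp only [eq_one_zero_of_periodic (dx_periodic h.periodic_velocity) t,
      eq_one_zero_of_periodic (dt_periodic h.periodic_velocity) t]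
  · have e : dt (fun t x => dx w t x ^ 2) t x = _ := ((hw.dx.hasDerivAt_time ht.le x).pow 2).deriv
    have e' := (((hw.dx.hasDerivAt_space ht.le x).mul
      (hw.dt.hasDerivAt_space ht.le x)).const_mul 2).deriv
    refine e.trans (Eq.trans ?_ (congrArg (· - _) e'.symm))
    simp only [Nat.add_one_sub_one, pow_one, Nat.cast_ofNat, hw.dt_dx ht.le]
    ring

/-- The material derivative of the effective viscous flux `ν ∂ₓw - p`. -/
noncomputable def fluxRate (a γ ν : ℝ) (η w : ℝ → ℝ → ℝ) (t x : ℝ) : ℝ :=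
  ν * dx (matDeriv w) t x - ν * dx w t x ^ 2 + γ * (pressure a γ η t x * dx w t x)

lemma smooth_fluxRate (h : IsSolution a γ ν η w) : SmoothFwd (fluxRate a γ ν η w) :=
  (((SmoothFwd.const ν).mul h.smooth_matDeriv.dx).sub
    ((SmoothFwd.const ν).mul (h.smooth_velocity.dx.pow 2))).add
    ((SmoothFwd.const γ).mul (h.smooth_pressure.mul h.smooth_velocity.dx))

lemma dx_matDeriv (hw : SmoothFwd w) (ht : 0 ≤ t) (x : ℝ) :
    dx (matDeriv w) t x = dx (dt w) t x + (dx w t x ^ 2 + w t x * dx (dx w) t x) := by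
  refine ((hw.dt.hasDerivAt_space ht x).add ((hw.hasDerivAt_space ht x).mul
    (hw.dx.hasDerivAt_space ht x))).deriv.trans ?_
  ring

lemma dx_dx_matDeriv (hw : SmoothFwd w) (ht : 0 ≤ t) (x : ℝ) :
    dx (dx (matDeriv w)) t x = dx (dx (dt w)) t x
      + (3 * (dx w t x * dx (dx w) t x) + w t x * dx (dx (dx w)) t x) := by
  have h1 : dx (matDeriv w) t = _ := funext (dx_matDeriv hw ht)
  rw [dx, h1]
  have wx := hw.hasDerivAt_space ht x
  have wxx := hw.dx.hasDerivAt_space ht x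
  refine ((hw.dt.dx.hasDerivAt_space ht x).add ((wxx.pow 2).add
    (wx.mul (hw.dx.dx.hasDerivAt_space ht x)))).deriv.trans ?_
  simp only [Nat.add_one_sub_one, pow_one, Nat.cast_ofNat]
  ring

lemma dx_dt_pressure (h : IsSolution a γ ν η w) (ht : 0 ≤ t) (x : ℝ) :
    dx (dt (pressure a γ η)) t x =
      -(dx w t x * dx (pressure a γ η) t x + w t x * dx (dx (pressure a γ η)) t x
        + γ * (dx (pressure a γ η) t x * dx w t x + pressure a γ η t x * dx (dx w) t x)) := by
  have h1 : dt (pressure a γ η) t = _ := funext (h.dt_pressure ht)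
  rw [dx, h1]
  have wx := h.smooth_velocity.hasDerivAt_space ht x
  have wxx := h.smooth_velocity.dx.hasDerivAt_space ht x
  have px := h.smooth_pressure.hasDerivAt_space ht x
  have pxx := h.smooth_pressure.dx.hasDerivAt_space ht x
  exact (((wx.mul pxx).add ((px.mul wxx).const_mul γ)).neg).deriv

/-- The transport equation for the material derivative. -/
lemma density_mul_dt_matDeriv (h : IsSolution a γ ν η w) (ht : 0 < t) (x : ℝ) :
    η t x * dt (matDeriv w) t x =
      dx (fluxRate a γ ν η w) t x - η t x * w t x * dx (matDeriv w) t x := by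
  have hη := h.smooth_density
  have hw := h.smooth_velocity
  have hP := h.smooth_pressure
  have hU := h.smooth_matDeriv
  have time : dt η t x * matDeriv w t x + η t x * dt (matDeriv w) t x =
      ν * dx (dx (dt w)) t x - dx (dt (pressure a γ η)) t x := by
    have e1 := (hη.hasDerivAt_time ht.le x).mul (hU.hasDerivAt_time ht.le x)
    have e2 := ((hw.dx.dx.hasDerivAt_time ht.le x).const_mul ν).sub
      (hP.dx.hasDerivAt_time ht.le x)
    have ev : ((fun s => η s x) * fun s => matDeriv w s x) =ᶠ[𝓝 t]
        ((fun s => ν * dx (dx w) s x) - fun s => dx (pressure a γ η) s x) := by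
      filter_upwards [lt_mem_nhds ht] with s hs
      exact h.density_mul_matDeriv hs.le x
    rw [e1.unique (e2.congr_of_eventuallyEq ev), hw.dx.dt_dx ht.le, hP.dt_dx ht.le]
    have : dt (dx w) t = dx (dt w) t := funext (hw.dt_dx ht.le)
    rw [dx, this]
    rfl
  have space : dx η t x * matDeriv w t x + η t x * dx (matDeriv w) t x =
      ν * dx (dx (dx w)) t x - dx (dx (pressure a γ η)) t x := by
    have e1 := (hη.hasDerivAt_space ht.le x).mul (hU.hasDerivAt_space ht.le x)
    have e2 := ((hw.dx.dx.hasDerivAt_space ht.le x).const_mul ν).sub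
      (hP.dx.hasDerivAt_space ht.le x)
    have ev : (η t * matDeriv w t) =
        ((fun s => ν * dx (dx w) t s) - dx (pressure a γ η) t) := 
      funext (h.density_mul_matDeriv ht.le)
    rw [ev] at e1
    exact e1.unique e2
  have wxx := hw.dx.hasDerivAt_space ht.le x
  have flux : dx (fluxRate a γ ν η w) t x = _ := ((((hU.dx.hasDerivAt_space ht.le x).const_mul ν).sub
    ((wxx.pow 2).const_mul ν)).add (((hP.hasDerivAt_space ht.le x).mul wxx).const_mul γ)).deriv
  rw [flux]
  simp only [Nat.add_one_sub_one, pow_one, Nat.cast_ofNat]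
  rw [dx_dx_matDeriv hw ht.le]
  rw [h.dx_dt_pressure ht.le, h.dt_density ht.le] at time
  linear_combination time + w t x * space + dx w t x * h.density_mul_matDeriv ht.le x

lemma hasDerivAt_integral_matDeriv (h : IsSolution a γ ν η w) (ht : 0 < t) :
    HasDerivAt (fun t => ∫ x in (0 : ℝ)..1, 2⁻¹ * (η t x * matDeriv w t x ^ 2))
      (-∫ x in (0 : ℝ)..1, dx (matDeriv w) t x * fluxRate a γ ν η w t x) t := by
  have hη := h.smooth_density
  have hw := h.smooth_velocity
  have hU := h.smooth_matDeriv
  have hW := h.smooth_fluxRate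
  refine ((SmoothFwd.const 2⁻¹).mul (hη.mul (hU.pow 2))).hasDerivAt_integral_of_balance
    ((hU.mul hW).sub ((SmoothFwd.const 2⁻¹).mul ((hη.mul hw).mul (hU.pow 2)))) ht ?_ fun x => ?_
  · simp only [fluxRate, eq_one_zero_of_periodic h.periodic_density t,
      eq_one_zero_of_periodic h.periodic_velocity t,
      eq_one_zero_of_periodic (dx_periodic h.periodic_velocity) t,
      eq_one_zero_of_periodic h.pressure_periodic t,
      eq_one_zero_of_periodic h.matDeriv_periodic t,
      eq_one_zero_of_periodic (dx_periodic h.matDeriv_periodic) t]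
  · have e : dt (fun t x => 2⁻¹ * (η t x * matDeriv w t x ^ 2)) t x = _ :=
      (((hη.hasDerivAt_time ht.le x).mul ((hU.hasDerivAt_time ht.le x).pow 2)).const_mul 2⁻¹).deriv
    have Ux := hU.hasDerivAt_space ht.le x
    have e' := ((Ux.mul (hW.hasDerivAt_space ht.le x)).sub
      ((((hη.hasDerivAt_space ht.le x).mul (hw.hasDerivAt_space ht.le x)).mul
        (Ux.pow 2)).const_mul 2⁻¹)).deriv
    refine e.trans (Eq.trans ?_ (congrArg (· - _) e'.symm))
    simp only [Pi.pow_apply, Pi.mul_apply, Nat.add_one_sub_one, pow_one, Nat.cast_ofNat]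
    linear_combination matDeriv w t x * h.density_mul_dt_matDeriv ht x
      + 2⁻¹ * matDeriv w t x ^ 2 * h.dt_density ht.le x

end IsSolution

/-- Decay for a hierarchy of three dissipated quantities `A`, `y`, `Z`, in which the dissipation of
`y` is controlled up to a quadratic term and that of `Z` depends on an upper bound for `y`. -/
lemma exists_decay_of_dissipation {c CA κ C₁ C₂ σ ν C₃ CZ E : ℝ} (hc : 0 < c) (hCA : 0 < CA)
    (hκ : 0 < κ) (hC₁ : 0 < C₁) (hC₂ : 0 < C₂) (hσ : 0 < σ) (hν : 0 < ν) (hC₃ : 0 < C₃)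
    (hCZ : 0 < CZ) (hE : 0 < E) :
    ∃ C α : ℝ, 0 < C ∧ 0 < α ∧ ∀ A y Z r z q DA Dy DZ : ℝ → ℝ,
      ContinuousOn A (Ici 0) → ContinuousOn y (Ici 0) → ContinuousOn Z (Ici 0) → Continuous q →
      (∀ t, 0 < t → HasDerivAt A (-DA t) t) →
      (∀ t, 0 < t → HasDerivAt y (-Dy t) t) →
      (∀ t, 0 < t → HasDerivAt Z (-DZ t) t) →
      (∀ t, 0 ≤ t → 0 ≤ A t) → (∀ t, 0 ≤ t → 0 ≤ y t) → (∀ t, 0 ≤ t → 0 ≤ Z t) →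
      (∀ t, 0 ≤ t → 0 ≤ r t) → (∀ t, 0 ≤ t → 0 ≤ z t) → (∀ t, 0 ≤ q t) →
      (∀ t, 0 ≤ t → A t ≤ CA * (y t + r t)) →
      (∀ t, 0 ≤ t → Z t ≤ CZ * (z t + r t)) →
      (∀ t, 0 ≤ t → c * (y t + r t) ≤ DA t) →
      (∀ t, 0 ≤ t → κ * z t - C₁ * r t - C₂ * y t ^ 2 ≤ Dy t) →
      (∀ t Y, 0 ≤ t → y t ≤ Y → σ * q t - ν * (Y * z t) - C₃ * y t ≤ DZ t) →
      y 0 + r 0 ≤ E →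
      (∀ t, 0 ≤ t → 2 * Z t ≤ C * (y 0 + r 0 + z 0) * Real.exp (-α * t)) ∧
        ∀ t, 0 ≤ t → ∫ s in (0 : ℝ)..t, q s ≤ C * (y 0 + r 0 + z 0) := by
  set G := Real.exp (C₂ / c * (CA * E)) with hG
  have hG0 : 0 < G := Real.exp_pos _
  set N := (C₁ * G + 1) / c with hN
  have hN0 : 0 < N := by positivity
  set Y := E * G + N * (CA * E) with hY
  have hY0 : 0 < Y := by positivity
  set CB := G + N * CA with hCB
  have hCB0 : 0 < CB := by positivity
  set L := (ν * Y + 1) / κ + C₃ + 1 with hL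
  have hL0 : 0 < L := by positivity
  set F := CZ + L * CB with hF
  have hF0 : 0 < F := by positivity
  refine ⟨(2 + 1 / σ) * F, 1 / F, by positivity, by positivity, ?_⟩
  intro A y Z r z q DA Dy DZ cA cy cZ cq dA dy dZ A0 y0 Z0 r0 z0 q0 hA hZ hDA hDy hDZ hin
  have Aanti : AntitoneOn A (Ici 0) := by
    refine antitoneOn_Ici_of_hasDerivAt_nonpos cA dA fun t ht => ?_
    have := hDA t ht.le
    have := mul_nonneg hc.le (add_nonneg (y0 t ht.le) (r0 t ht.le))
    linarith
  have Ale : ∀ t, 0 ≤ t → A t ≤ CA * E := fun t ht =>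
    (Aanti self_mem_Ici ht ht).trans ((hA 0 le_rfl).trans (by gcongr))
  have expA : ∀ t, 0 ≤ t → 1 ≤ Real.exp (C₂ / c * A t) ∧ Real.exp (C₂ / c * A t) ≤ G := by
    intro t ht
    have := A0 t ht
    refine ⟨Real.one_le_exp (by positivity), Real.exp_le_exp.2 ?_⟩
    have := Ale t ht
    gcongr
  set B := fun t => y t * Real.exp (C₂ / c * A t) + N * A t with hB
  set DB := fun t => (Dy t + C₂ / c * DA t * y t) * Real.exp (C₂ / c * A t) + N * DA t with hDB
  have cB : ContinuousOn B (Ici 0) := by fun_prop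
  have dB : ∀ t, 0 < t → HasDerivAt B (-DB t) t := fun t ht => by
    refine (((dy t ht).mul ((dA t ht).const_mul (C₂ / c)).exp).add
      ((dA t ht).const_mul N)).congr_deriv ?_
    simp only [hDB]
    ring
  have hDB' : ∀ t, 0 ≤ t → κ * z t + (y t + r t) ≤ DB t := by
    intro t ht
    obtain ⟨e1, e2⟩ := expA t ht
    have h1 := hDA t ht
    have hy := y0 t ht
    have hr := r0 t ht
    have hz := z0 t ht
    have h2 : κ * z t - C₁ * r t ≤ Dy t + C₂ / c * DA t * y t := by
      have h3 : C₂ / c * (c * (y t + r t)) * y t ≤ C₂ / c * DA t * y t := by gcongr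
      have h4 : C₂ / c * (c * (y t + r t)) * y t = C₂ * y t ^ 2 + C₂ * (r t * y t) := by
        field_simp
      have h5 : 0 ≤ C₂ * (r t * y t) := by positivity
      linarith [hDy t ht]
    have h6 : N * (c * (y t + r t)) ≤ N * DA t := by gcongr
    have h7 : N * (c * (y t + r t)) = (C₁ * G + 1) * (y t + r t) := by
      rw [hN]; field_simp
    have h8 := mul_le_mul_of_nonneg_right h2 (Real.exp_pos (C₂ / c * A t)).le
    have h9 : κ * z t * 1 ≤ κ * z t * Real.exp (C₂ / c * A t) := by gcongr
    have h10 : C₁ * r t * Real.exp (C₂ / c * A t) ≤ C₁ * r t * G := by gcongr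
    have h11 : 0 ≤ C₁ * G * y t := by positivity
    simp only [hDB]
    linarith
  have hBle : ∀ t, 0 ≤ t → B t ≤ CB * (y t + r t) := by
    intro t ht
    have h1 : y t * Real.exp (C₂ / c * A t) ≤ y t * G :=
      mul_le_mul_of_nonneg_left (expA t ht).2 (y0 t ht)
    have h2 : N * A t ≤ N * (CA * (y t + r t)) := by gcongr; exact hA t ht
    have h3 : 0 ≤ G * r t := mul_nonneg hG0.le (r0 t ht)
    simp only [hB, hCB]
    linarith
  have yB : ∀ t, 0 ≤ t → y t ≤ B t := by
    intro t ht
    have h1 : y t * 1 ≤ y t * Real.exp (C₂ / c * A t) :=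
      mul_le_mul_of_nonneg_left (expA t ht).1 (y0 t ht)
    have h2 : 0 ≤ N * A t := mul_nonneg hN0.le (A0 t ht)
    simp only [hB]
    linarith
  have Banti : AntitoneOn B (Ici 0) := by
    refine antitoneOn_Ici_of_hasDerivAt_nonpos cB dB fun t ht => ?_
    have := hDB' t ht.le
    have := mul_nonneg hκ.le (z0 t ht.le)
    linarith [y0 t ht.le, r0 t ht.le]
  have yY : ∀ t, 0 ≤ t → y t ≤ Y := by
    intro t ht
    refine (yB t ht).trans ((Banti self_mem_Ici ht ht).trans ?_)
    have h1 : y 0 ≤ E := by linarith [r0 0 le_rfl]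
    have h2 := Ale 0 le_rfl
    have h3 := (expA 0 le_rfl).2
    simp only [hB, hY]
    gcongr
  set Φ := fun t => Z t + L * B t with hΦ
  set DΦ := fun t => DZ t + L * DB t with hDΦ
  have cΦ : ContinuousOn Φ (Ici 0) := by fun_prop
  have dΦ : ∀ t, 0 < t → HasDerivAt Φ (-DΦ t) t := fun t ht => by
    refine ((dZ t ht).add ((dB t ht).const_mul L)).congr_deriv ?_
    simp only [hDΦ]
    ring
  have hDΦ' : ∀ t, 0 ≤ t → σ * q t + (y t + r t + z t) ≤ DΦ t := by
    intro t ht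
    have hy := y0 t ht
    have hr := r0 t ht
    have hz := z0 t ht
    have h1 := hDZ t Y ht (yY t ht)
    have h2 : L * (κ * z t + (y t + r t)) ≤ L * DB t := by gcongr; exact hDB' t ht
    have h3 : L * (κ * z t) = (ν * Y + 1) * z t + (C₃ + 1) * (κ * z t) := by
      rw [hL]; field_simp; ring
    have h4 : L * (y t + r t) = (ν * Y + 1) / κ * (y t + r t) + (C₃ + 1) * (y t + r t) := by
      rw [hL]; ring
    have h5 : 0 ≤ (ν * Y + 1) / κ * (y t + r t) := by positivity
    have h6 : 0 ≤ (C₃ + 1) * (κ * z t) := by positivity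
    have h7 : 0 ≤ C₃ * r t := by positivity
    simp only [hDΦ]
    linarith
  have hΦle : ∀ t, 0 ≤ t → Φ t ≤ F * (y t + r t + z t) := by
    intro t ht
    have hy := y0 t ht
    have hz := z0 t ht
    have h2 : L * B t ≤ L * (CB * (y t + r t)) := by gcongr; exact hBle t ht
    have h3 : 0 ≤ CZ * y t := by positivity
    have h4 : 0 ≤ L * CB * z t := by positivity
    simp only [hΦ, hF]
    linarith [hZ t ht]
  have hBnn : ∀ t, 0 ≤ t → 0 ≤ B t := fun t ht => (y0 t ht).trans (yB t ht)
  have ZΦ : ∀ t, 0 ≤ t → Z t ≤ Φ t := fun t ht => by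
    have := mul_nonneg hL0.le (hBnn t ht)
    simp only [hΦ]
    linarith
  have S0 : 0 ≤ y 0 + r 0 + z 0 := by linarith [y0 0 le_rfl, r0 0 le_rfl, z0 0 le_rfl]
  have hΦ0 := hΦle 0 le_rfl
  constructor
  · intro t ht
    have anti : AntitoneOn (fun t => Φ t * Real.exp (1 / F * t)) (Ici 0) := by
      refine antitoneOn_Ici_of_hasDerivAt_nonpos (by fun_prop) (fun t ht => (dΦ t ht).mul
        ((hasDerivAt_id t).const_mul (1 / F)).exp) fun t ht => ?_
      have h1 := hDΦ' t ht.le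
      have h2 := mul_nonneg hσ.le (q0 t)
      have h3 : 1 / F * Φ t ≤ y t + r t + z t := by
        rw [one_div, inv_mul_le_iff₀ hF0]
        exact hΦle t ht.le
      have h4 : 0 ≤ Real.exp (1 / F * t) * (DΦ t - 1 / F * Φ t) :=
        mul_nonneg (Real.exp_pos _).le (by linarith)
      simp only [id, mul_one]
      linarith
    have h1 := anti self_mem_Ici ht ht
    simp only [mul_zero, Real.exp_zero, mul_one] at h1
    have h2 : Φ t ≤ Φ 0 * Real.exp (-(1 / F) * t) := by
      rw [neg_mul, Real.exp_neg, ← div_eq_mul_inv, le_div_iff₀ (Real.exp_pos _)]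
      exact h1
    have h3 : Φ 0 ≤ F * (y 0 + r 0 + z 0) := hΦ0
    have h4 : 0 ≤ 1 / σ * F * (y 0 + r 0 + z 0) := by positivity
    calc 2 * Z t ≤ 2 * (Φ 0 * Real.exp (-(1 / F) * t)) := by linarith [ZΦ t ht]
      _ = 2 * Φ 0 * Real.exp (-(1 / F) * t) := by ring
      _ ≤ _ := by
        refine mul_le_mul_of_nonneg_right ?_ (Real.exp_pos _).le
        linarith
  · intro t ht
    have anti : AntitoneOn (fun t => Φ t + σ * ∫ s in (0 : ℝ)..t, q s) (Ici 0) := by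
      have dq : ∀ t, HasDerivAt (fun t => ∫ s in (0 : ℝ)..t, q s) (q t) t := fun t =>
        cq.integral_hasStrictDerivAt 0 t |>.hasDerivAt
      have cQ : Continuous fun t => ∫ s in (0 : ℝ)..t, q s :=
        continuous_iff_continuousAt.2 fun t => (dq t).continuousAt
      refine antitoneOn_Ici_of_hasDerivAt_nonpos (by fun_prop) (fun t ht => (dΦ t ht).add
        ((dq t).const_mul σ)) fun t ht => ?_
      linarith [hDΦ' t ht.le, y0 t ht.le, r0 t ht.le, z0 t ht.le]
    have h1 := anti self_mem_Ici ht ht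
    simp only [intervalIntegral.integral_same, mul_zero, add_zero] at h1
    have h2 := (Z0 t ht).trans (ZΦ t ht)
    have h3 : σ * ∫ s in (0 : ℝ)..t, q s ≤ F * (y 0 + r 0 + z 0) := by linarith
    rw [← le_div_iff₀' hσ] at h3
    refine h3.trans ?_
    have : 0 ≤ 2 * F * (y 0 + r 0 + z 0) := by positivity
    rw [div_eq_mul_one_div]
    linarith

lemma lintegral_Ioi_le_of_integral_le {q : ℝ → ℝ} {K : ℝ} (hq : Continuous q) (h0 : ∀ t, 0 ≤ q t)
    (h : ∀ t, 0 ≤ t → ∫ s in (0 : ℝ)..t, q s ≤ K) :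
    ∫⁻ t in Ioi (0 : ℝ), ENNReal.ofReal (q t) ≤ ENNReal.ofReal K := by
  have hU : Ioi (0 : ℝ) = ⋃ n : ℕ, Ioc (0 : ℝ) n := by
    ext t
    simp only [mem_Ioi, mem_iUnion, mem_Ioc]
    exact ⟨fun ht => (exists_nat_ge t).imp fun n hn => ⟨ht, hn⟩, fun ⟨_, ht, _⟩ => ht⟩
  have hmono : Monotone fun n : ℕ => Ioc (0 : ℝ) n := fun m n hmn =>
    Ioc_subset_Ioc_right (by exact_mod_cast hmn)
  rw [hU, setLIntegral_iUnion_of_directed _ hmono.directed_le]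
  refine iSup_le fun n => ?_
  rw [← ofReal_integral_eq_lintegral_ofReal, ← intervalIntegral.integral_of_le n.cast_nonneg]
  · exact ENNReal.ofReal_le_ofReal (h n n.cast_nonneg)
  · exact (intervalIntegrable_iff_integrableOn_Ioc_of_le n.cast_nonneg).1
      (hq.intervalIntegrable _ _)
  · exact Eventually.of_forall h0

/-- The square of the spatial `L²` norm over one period. -/
noncomputable def sqNorm (f : ℝ → ℝ → ℝ) (t : ℝ) : ℝ := ∫ x in (0 : ℝ)..1, f t x ^ 2

lemma sqNorm_nonneg (f : ℝ → ℝ → ℝ) (t : ℝ) : 0 ≤ sqNorm f t :=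
  intervalIntegral.integral_nonneg zero_le_one fun _ _ => sq_nonneg _

lemma integral_mono_of_continuous {f g : ℝ → ℝ} (hf : Continuous f) (hg : Continuous g)
    (h : ∀ x ∈ Icc (0 : ℝ) 1, f x ≤ g x) :
    ∫ x in (0 : ℝ)..1, f x ≤ ∫ x in (0 : ℝ)..1, g x :=
  intervalIntegral.integral_mono_on zero_le_one (hf.intervalIntegrable _ _)
    (hg.intervalIntegrable _ _) h

lemma integral_mul_sq_add_mul_sq {f g : ℝ → ℝ} (hf : Continuous f) (hg : Continuous g)
    (b c : ℝ) : ∫ x in (0 : ℝ)..1, (b * f x ^ 2 + c * g x ^ 2) =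
      b * (∫ x in (0 : ℝ)..1, f x ^ 2) + c * ∫ x in (0 : ℝ)..1, g x ^ 2 := by
  rw [intervalIntegral.integral_add (Continuous.intervalIntegrable (by fun_prop) _ _)
    (Continuous.intervalIntegrable (by fun_prop) _ _), intervalIntegral.integral_const_mul,
    intervalIntegral.integral_const_mul]

/-- The total energy. -/
noncomputable def energy (a γ ν : ℝ) (η w : ℝ → ℝ → ℝ) (t : ℝ) : ℝ :=
  ∫ x in (0 : ℝ)..1, energyDensity a γ ν η w t x

/-- The constant bounding the energy by the squared gradients, for densities in `[m, M]`. -/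
noncomputable def energyConst (a γ ν m M : ℝ) : ℝ :=
  2 * M + M * ν ^ 2 / m ^ 4 + 2 * (M * (a * (γ * M ^ (γ - 1)) / m ^ 2))

namespace IsSolution

variable {a γ ν m M : ℝ} {η w : ℝ → ℝ → ℝ} {t : ℝ}

lemma exists_density_eq_one (h : IsSolution a γ ν η w) (ht : 0 ≤ t) :
    ∃ x ∈ Icc (0 : ℝ) 1, η t x = 1 := by
  have hc := h.smooth_density.continuous_space ht
  obtain ⟨x, hx, h0⟩ := exists_eq_zero_of_integral_mul_eq_zero (ρ := fun _ => 1)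
    (f := fun x => η t x - 1) continuous_const (by fun_prop) (fun _ => zero_lt_one) (by
      simp only [one_mul]
      rw [intervalIntegral.integral_sub (hc.intervalIntegrable _ _) (by simp), h.mass ht]
      simp)
  exact ⟨x, hx, by linarith⟩

lemma density_sub_one_sq_le (h : IsSolution a γ ν η w) (ht : 0 ≤ t) {x : ℝ}
    (hx : x ∈ Icc (0 : ℝ) 1) : (η t x - 1) ^ 2 ≤ sqNorm (dx η) t := by
  obtain ⟨y, hy, h0⟩ := h.exists_density_eq_one ht
  exact sq_le_integral_sq (f := fun x => η t x - 1) (h.smooth_density.dx.continuous_space ht)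
    (fun x => (h.smooth_density.hasDerivAt_space ht x).sub_const 1) hx hy (by linarith)

lemma velocity_sq_le (h : IsSolution a γ ν η w) (ht : 0 ≤ t) {x : ℝ}
    (hx : x ∈ Icc (0 : ℝ) 1) : w t x ^ 2 ≤ sqNorm (dx w) t := by
  obtain ⟨y, hy, h0⟩ := exists_eq_zero_of_integral_mul_eq_zero
    (h.smooth_density.continuous_space ht) (h.smooth_velocity.continuous_space ht)
    (fun x => h.density_pos t x ht) (h.momentum_eq_zero ht)
  exact sq_le_integral_sq (h.smooth_velocity.dx.continuous_space ht)
    (h.smooth_velocity.hasDerivAt_space ht) hx hy h0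

lemma dx_velocity_sq_le (h : IsSolution a γ ν η w) (ht : 0 ≤ t) {x : ℝ}
    (hx : x ∈ Icc (0 : ℝ) 1) : dx w t x ^ 2 ≤ sqNorm (dx (dx w)) t := by
  obtain ⟨y, hy, h0⟩ := exists_eq_zero_of_integral_mul_eq_zero (ρ := fun _ => 1)
    continuous_const (h.smooth_velocity.dx.continuous_space ht) (fun _ => zero_lt_one) (by
      simpa using h.smooth_velocity.integral_dx ht
        (eq_one_zero_of_periodic h.periodic_velocity t))
  exact sq_le_integral_sq (h.smooth_velocity.dx.dx.continuous_space ht)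
    (h.smooth_velocity.dx.hasDerivAt_space ht) hx hy h0

lemma mul_potential_nonneg (h : IsSolution a γ ν η w) (ha : 0 < a) (hγ : 1 ≤ γ) (ht : 0 ≤ t)
    (x : ℝ) : 0 ≤ η t x * potential a γ (η t x) :=
  mul_nonneg (h.density_pos t x ht).le (potential_nonneg ha hγ (h.density_pos t x ht))

lemma energy_nonneg (h : IsSolution a γ ν η w) (ha : 0 < a) (hγ : 1 ≤ γ) (ht : 0 ≤ t) :
    0 ≤ energy a γ ν η w t := by
  refine intervalIntegral.integral_nonneg zero_le_one fun x _ => ?_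
  have := h.mul_potential_nonneg ha hγ ht x
  have := h.density_pos t x ht
  unfold energyDensity
  positivity

lemma energy_le (h : IsSolution a γ ν η w) (ha : 0 < a) (hγ : 1 ≤ γ) (hm : 0 < m)
    (ht : 0 ≤ t) (hη : ∀ x ∈ Icc (0 : ℝ) 1, η t x ∈ Icc m M) :
    energy a γ ν η w t ≤ energyConst a γ ν m M * (sqNorm (dx w) t + sqNorm (dx η) t) := by
  obtain ⟨x₀, hx₀, h₀⟩ := h.exists_density_eq_one ht
  have hm1 : m ≤ 1 := h₀ ▸ (hη x₀ hx₀).1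
  have hM1 : 1 ≤ M := h₀ ▸ (hη x₀ hx₀).2
  have hM : 0 < M := by linarith
  set y := sqNorm (dx w) t with hy
  set r := sqNorm (dx η) t with hr
  have hy0 : 0 ≤ y := sqNorm_nonneg _ _
  have hr0 : 0 ≤ r := sqNorm_nonneg _ _
  set c := a * (γ * M ^ (γ - 1)) / m ^ 2 with hc
  have hc0 : 0 < c := by positivity
  have hpt : ∀ x ∈ Icc (0 : ℝ) 1, energyDensity a γ ν η w t x ≤
      (2 * M * y + 2 * (M * c * r)) * 1 ^ 2 + M * ν ^ 2 / m ^ 4 * dx η t x ^ 2 := by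
    intro x hx
    obtain ⟨h1, h2⟩ := hη x hx
    have hpos := h.density_pos t x ht
    have hV : effVelocity ν η w t x ^ 2 ≤ 2 * w t x ^ 2 + 2 * (ν ^ 2 / m ^ 4 * dx η t x ^ 2) := by
      have e1 : (ν * (dx η t x / η t x ^ 2)) ^ 2 ≤ ν ^ 2 / m ^ 4 * dx η t x ^ 2 := by
        have : (ν * (dx η t x / η t x ^ 2)) ^ 2 = ν ^ 2 / η t x ^ 4 * dx η t x ^ 2 := by
          field_simp
        rw [this]
        gcongr
      unfold effVelocity
      linarith [sq_nonneg (w t x - ν * (dx η t x / η t x ^ 2))]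
    have hw2 := h.velocity_sq_le ht hx
    have e1 : η t x * w t x ^ 2 ≤ M * y := by gcongr
    have e2 : η t x * effVelocity ν η w t x ^ 2
        ≤ M * (2 * y + 2 * (ν ^ 2 / m ^ 4 * dx η t x ^ 2)) := by
      gcongr
      linarith
    have e3 : η t x * potential a γ (η t x) ≤ M * (c * r) := by
      have := potential_le ha hγ hm hm1 hM1 (hη x hx)
      have h3 := h.density_sub_one_sq_le ht hx
      have h4 := potential_nonneg ha hγ hpos
      gcongr
      exact this.trans (by gcongr)
    have e4 : 0 ≤ M * y := by positivity
    unfold energyDensity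
    have e5 : M * ν ^ 2 / m ^ 4 * dx η t x ^ 2 = M * (ν ^ 2 / m ^ 4 * dx η t x ^ 2) := by ring
    rw [e5]
    linarith
  have cηx := h.smooth_density.dx.continuous_space ht
  refine (integral_mono_of_continuous (h.smooth_energyDensity.continuous_space ht)
    (by fun_prop) hpt).trans ?_
  rw [integral_mul_sq_add_mul_sq continuous_const cηx]
  change _ + _ * r ≤ _
  simp only [one_pow, intervalIntegral.integral_const, sub_zero, smul_eq_mul, mul_one]
  have e1 : 0 ≤ M * ν ^ 2 / m ^ 4 * y := by positivity
  have e2 : 0 ≤ M * c * y := by positivity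
  have e3 : 0 ≤ M * r := by positivity
  unfold energyConst
  linarith

/-- The energy controls the oscillation of the logarithm of the density. -/
lemma density_mem_Icc (h : IsSolution a γ ν η w) (ha : 0 < a) (hγ : 1 ≤ γ) (hν : 0 < ν)
    (ht : 0 ≤ t) {K : ℝ} (hK : energy a γ ν η w t ≤ K) {x : ℝ} (hx : x ∈ Icc (0 : ℝ) 1) :
    η t x ∈ Icc (Real.exp (-(2⁻¹ * (4 / ν ^ 2 * K + 1)))) (Real.exp (2⁻¹ * (4 / ν ^ 2 * K + 1))) := by
  obtain ⟨x₀, hx₀, h₀⟩ := h.exists_density_eq_one ht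
  have cη := h.smooth_density.continuous_space ht
  have cηx := h.smooth_density.dx.continuous_space ht
  have hne : ∀ x, η t x ≠ 0 := fun x => (h.density_pos t x ht).ne'
  have clog : Continuous fun x => dx η t x / η t x := cηx.div cη hne
  have h1 := abs_sub_le_integral_abs (f := fun x => Real.log (η t x)) clog
    (fun x => (h.smooth_density.hasDerivAt_space ht x).log (hne x)) hx hx₀
  have h2 : ∫ x in (0 : ℝ)..1, |dx η t x / η t x| ≤ 2⁻¹ * (4 / ν ^ 2 * K + 1) := by
    have cE := h.smooth_energyDensity.continuous_space ht
    calc _ ≤ ∫ x in (0 : ℝ)..1, 2⁻¹ * (4 / ν ^ 2 * energyDensity a γ ν η w t x + η t x) := by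
          refine integral_mono_of_continuous clog.abs (by fun_prop) fun x hx => ?_
          have hpos := h.density_pos t x ht
          have e1 : |dx η t x / η t x| ≤ 2⁻¹ * (dx η t x ^ 2 / η t x ^ 3 + η t x) := by
            rw [abs_div, abs_of_pos hpos, ← sq_abs (dx η t x)]
            have : 2⁻¹ * (|dx η t x| ^ 2 / η t x ^ 3 + η t x) - |dx η t x| / η t x =
                2⁻¹ * ((|dx η t x| - η t x ^ 2) ^ 2 / η t x ^ 3) := by
              field_simp
              ring
            have : 0 ≤ 2⁻¹ * ((|dx η t x| - η t x ^ 2) ^ 2 / η t x ^ 3) := by positivity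
            linarith
          have e2 : dx η t x ^ 2 / η t x ^ 3 ≤ 4 / ν ^ 2 * energyDensity a γ ν η w t x := by
            have e3 : dx η t x ^ 2 / η t x ^ 3 =
                η t x * (effVelocity ν η w t x - w t x) ^ 2 / ν ^ 2 := by
              unfold effVelocity
              field_simp
              ring
            rw [e3, div_mul_eq_mul_div]
            refine div_le_div_of_nonneg_right ?_ (by positivity)
            have := h.mul_potential_nonneg ha hγ ht x
            have : 0 ≤ η t x * (effVelocity ν η w t x + w t x) ^ 2 := by positivity
            unfold energyDensity
            linarith
          linarith
      _ = 2⁻¹ * (4 / ν ^ 2 * energy a γ ν η w t + 1) := by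
          rw [intervalIntegral.integral_const_mul, intervalIntegral.integral_add
            (Continuous.intervalIntegrable (by fun_prop) _ _) (cη.intervalIntegrable _ _),
            intervalIntegral.integral_const_mul, h.mass ht, energy]
      _ ≤ _ := by gcongr
  have h3 := abs_le.1 (h1.trans h2)
  rw [h₀, Real.log_one, sub_zero] at h3
  have hpos := h.density_pos t x ht
  exact ⟨(Real.le_log_iff_exp_le hpos).1 h3.1, (Real.log_le_iff_le_exp hpos).1 h3.2⟩

lemma pressure_mem_Icc (ha : 0 < a) (hγ : 1 ≤ γ) (hm : 0 < m) {x : ℝ} (hη : η t x ∈ Icc m M) :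
    pressure a γ η t x ∈ Icc (a * m ^ γ) (a * M ^ γ) := by
  have := hm.trans_le hη.1
  unfold pressure
  constructor <;> gcongr
  exacts [hη.1, hη.2]

lemma sq_dx_pressure_div_le (h : IsSolution a γ ν η w) (ha : 0 < a) (hγ : 1 ≤ γ) (hm : 0 < m)
    (ht : 0 ≤ t) {x : ℝ} (hη : η t x ∈ Icc m M) :
    dx (pressure a γ η) t x ^ 2 ≤ (γ * (a * M ^ γ) / m) ^ 2 * dx η t x ^ 2 := by
  have hpos := h.density_pos t x ht
  have hP := pressure_mem_Icc ha hγ hm hη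
  have hP0 : 0 ≤ pressure a γ η t x := le_trans (by positivity) hP.1
  have hM : 0 < M := hpos.trans_le hη.2
  rw [h.dx_pressure ht, mul_div_right_comm, mul_pow]
  gcongr
  exacts [hP.2, hη.1]

lemma dissipation_ge (h : IsSolution a γ ν η w) (ha : 0 < a) (hγ : 1 ≤ γ) (hν : 0 < ν)
    (hm : 0 < m) (ht : 0 ≤ t) (hη : ∀ x ∈ Icc (0 : ℝ) 1, η t x ∈ Icc m M) :
    min ν (ν * γ * (a * m ^ γ / M ^ 3)) * (sqNorm (dx w) t + sqNorm (dx η) t) ≤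
      ∫ x in (0 : ℝ)..1, (ν * dx w t x ^ 2
        + ν * γ * (pressure a γ η t x * (dx η t x ^ 2 / η t x ^ 3))) := by
  have cwx := h.smooth_velocity.dx.continuous_space ht
  have cη := h.smooth_density.continuous_space ht
  have cηx := h.smooth_density.dx.continuous_space ht
  have cP := h.smooth_pressure.continuous_space ht
  have cd : Continuous fun x => dx η t x ^ 2 / η t x ^ 3 :=
    (cηx.pow 2).div (cη.pow 3) fun x => pow_ne_zero 3 (h.density_pos t x ht).ne'
  rw [mul_add]
  unfold sqNorm
  rw [← integral_mul_sq_add_mul_sq cwx cηx]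
  refine integral_mono_of_continuous (by fun_prop) (by fun_prop) fun x hx => ?_
  have hpos := h.density_pos t x ht
  obtain ⟨h1, h2⟩ := hη x hx
  have hP := (pressure_mem_Icc ha hγ hm (hη x hx)).1
  have e1 : ν * γ * (a * m ^ γ / M ^ 3) * dx η t x ^ 2 ≤
      ν * γ * (pressure a γ η t x * (dx η t x ^ 2 / η t x ^ 3)) := by
    have : pressure a γ η t x * (dx η t x ^ 2 / η t x ^ 3) =
      pressure a γ η t x / η t x ^ 3 * dx η t x ^ 2 := by ring
    rw [this, mul_assoc (ν * γ)]
    gcongr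
    exact le_trans (by positivity) hP
  have e2 := mul_le_mul_of_nonneg_right (min_le_left ν (ν * γ * (a * m ^ γ / M ^ 3)))
    (sq_nonneg (dx w t x))
  have e3 := mul_le_mul_of_nonneg_right (min_le_right ν (ν * γ * (a * m ^ γ / M ^ 3)))
    (sq_nonneg (dx η t x))
  linarith

lemma gradient_dissipation_ge (h : IsSolution a γ ν η w) (ha : 0 < a) (hγ : 1 ≤ γ) (hν : 0 < ν)
    (hm : 0 < m) (ht : 0 ≤ t) (hη : ∀ x ∈ Icc (0 : ℝ) 1, η t x ∈ Icc m M) :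
    ν / M * sqNorm (dx (dx w)) t
        - 2 * M / ν * ((γ * (a * M ^ γ) / m) ^ 2 / m ^ 2) * sqNorm (dx η) t
        - 2 * M / ν * sqNorm (dx w) t ^ 2 ≤
      ∫ x in (0 : ℝ)..1, 2 * (dx (dx w) t x * dt w t x) := by
  have cwx := h.smooth_velocity.dx.continuous_space ht
  have cwxx := h.smooth_velocity.dx.dx.continuous_space ht
  have cwt := h.smooth_velocity.dt.continuous_space ht
  have cηx := h.smooth_density.dx.continuous_space ht
  set y := sqNorm (dx w) t with hy
  set k := 2 * M / ν * ((γ * (a * M ^ γ) / m) ^ 2 / m ^ 2) with hk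
  have hpt : ∀ x ∈ Icc (0 : ℝ) 1, ν / M * dx (dx w) t x ^ 2 + -k * dx η t x ^ 2 ≤
      2 * (dx (dx w) t x * dt w t x) + 2 * M / ν * y * dx w t x ^ 2 := by
    intro x hx
    have hpos := h.density_pos t x ht
    obtain ⟨h1, h2⟩ := hη x hx
    have hM : 0 < M := hpos.trans_le h2
    have hp : (dx (pressure a γ η) t x / η t x) ^ 2
        ≤ (γ * (a * M ^ γ) / m) ^ 2 / m ^ 2 * dx η t x ^ 2 := by
      rw [div_pow, div_mul_eq_mul_div]
      gcongr
      exact h.sq_dx_pressure_div_le ha hγ hm ht (hη x hx)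
    have hw := h.velocity_sq_le ht hx
    have e1 : ν / M * dx (dx w) t x ^ 2 ≤ ν / η t x * dx (dx w) t x ^ 2 := by gcongr
    have e2 : 2 * M / ν * (dx (pressure a γ η) t x / η t x) ^ 2 ≤ k * dx η t x ^ 2 := by
      rw [hk, mul_assoc]
      gcongr
    have e3 : 2 * M / ν * (w t x ^ 2 * dx w t x ^ 2) ≤ 2 * M / ν * y * dx w t x ^ 2 := by
      rw [mul_assoc]
      gcongr
    have young : ∀ X b : ℝ, 2 * X * b ≤ ν / M / 2 * X ^ 2 + 2 * M / ν * b ^ 2 := by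
      intro X b
      have : ν / M / 2 * X ^ 2 + 2 * M / ν * b ^ 2 - 2 * X * b
          = ν / M / 2 * (X - 2 * M / ν * b) ^ 2 := by field_simp; ring
      have : 0 ≤ ν / M / 2 * (X - 2 * M / ν * b) ^ 2 := by positivity
      linarith
    have y1 := young (dx (dx w) t x) (dx (pressure a γ η) t x / η t x)
    have y2 := young (dx (dx w) t x) (w t x * dx w t x)
    rw [mul_pow] at y2
    have e4 : 2 * (dx (dx w) t x * dt w t x) = 2 * (ν / η t x * dx (dx w) t x ^ 2)
        - 2 * dx (dx w) t x * (dx (pressure a γ η) t x / η t x)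
        - 2 * dx (dx w) t x * (w t x * dx w t x) := by
      rw [h.dt_velocity ht]
      ring
    linarith
  have := integral_mono_of_continuous (by fun_prop) (by fun_prop) hpt
  rw [integral_mul_sq_add_mul_sq cwxx cηx, intervalIntegral.integral_add
    (Continuous.intervalIntegrable (by fun_prop) _ _)
    (Continuous.intervalIntegrable (by fun_prop) _ _), intervalIntegral.integral_const_mul
    (2 * M / ν * y)] at this
  change _ * sqNorm (dx (dx w)) t + _ * sqNorm (dx η) t ≤ _ + _ * y at this
  linarith

lemma matDeriv_dissipation_ge (h : IsSolution a γ ν η w) (ha : 0 < a) (hγ : 1 ≤ γ) (hν : 0 < ν)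
    (hm : 0 < m) (ht : 0 ≤ t) (hη : ∀ x ∈ Icc (0 : ℝ) 1, η t x ∈ Icc m M) {Y : ℝ}
    (hY : sqNorm (dx w) t ≤ Y) :
    ν / 2 * sqNorm (dx (matDeriv w)) t - ν * (Y * sqNorm (dx (dx w)) t)
        - (γ * (a * M ^ γ)) ^ 2 / ν * sqNorm (dx w) t ≤
      ∫ x in (0 : ℝ)..1, dx (matDeriv w) t x * fluxRate a γ ν η w t x := by
  have cwx := h.smooth_velocity.dx.continuous_space ht
  have cU := h.smooth_matDeriv.dx.continuous_space ht
  have cF := h.smooth_fluxRate.continuous_space ht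
  set z := sqNorm (dx (dx w)) t with hz
  have hpt : ∀ x ∈ Icc (0 : ℝ) 1, ν / 2 * dx (matDeriv w) t x ^ 2
      + -(ν * z + (γ * (a * M ^ γ)) ^ 2 / ν) * dx w t x ^ 2 ≤
      dx (matDeriv w) t x * fluxRate a γ ν η w t x := by
    intro x hx
    have hP := pressure_mem_Icc ha hγ hm (hη x hx)
    have hP0 : 0 ≤ pressure a γ η t x := le_trans (by positivity) hP.1
    have hw := h.dx_velocity_sq_le ht hx
    have e1 : ν * dx w t x ^ 2 * dx w t x ^ 2 ≤ ν * z * dx w t x ^ 2 := by gcongr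
    have e2 : (γ * pressure a γ η t x) ^ 2 / ν * dx w t x ^ 2 ≤
        (γ * (a * M ^ γ)) ^ 2 / ν * dx w t x ^ 2 := by
      gcongr
      exact hP.2
    have e3 : dx (matDeriv w) t x * fluxRate a γ ν η w t x - ν / 2 * dx (matDeriv w) t x ^ 2
        + ν * dx w t x ^ 2 * dx w t x ^ 2 + (γ * pressure a γ η t x) ^ 2 / ν * dx w t x ^ 2 =
        ν * (dx (matDeriv w) t x / 2 - dx w t x ^ 2) ^ 2
          + ν * (dx (matDeriv w) t x / 2 + γ * pressure a γ η t x / ν * dx w t x) ^ 2 := by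
      unfold fluxRate
      field_simp
      ring
    have e4 : 0 ≤ ν * (dx (matDeriv w) t x / 2 - dx w t x ^ 2) ^ 2
          + ν * (dx (matDeriv w) t x / 2 + γ * pressure a γ η t x / ν * dx w t x) ^ 2 := by
      positivity
    linarith
  have := integral_mono_of_continuous (by fun_prop) (by fun_prop) hpt
  rw [integral_mul_sq_add_mul_sq cU cwx] at this
  change _ * sqNorm (dx (matDeriv w)) t + _ * sqNorm (dx w) t ≤ _ at this
  have e : ν * (z * sqNorm (dx w) t) ≤ ν * (z * Y) := by
    have : 0 ≤ z := sqNorm_nonneg _ _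
    gcongr
  linarith

lemma integral_matDeriv_le (h : IsSolution a γ ν η w) (ha : 0 < a) (hγ : 1 ≤ γ)
    (hm : 0 < m) (ht : 0 ≤ t) (hη : ∀ x ∈ Icc (0 : ℝ) 1, η t x ∈ Icc m M) :
    ∫ x in (0 : ℝ)..1, 2⁻¹ * (η t x * matDeriv w t x ^ 2) ≤
      (ν ^ 2 + (γ * (a * M ^ γ) / m) ^ 2) / m * (sqNorm (dx (dx w)) t + sqNorm (dx η) t) := by
  have cη := h.smooth_density.continuous_space ht
  have cηx := h.smooth_density.dx.continuous_space ht
  have cwxx := h.smooth_velocity.dx.dx.continuous_space ht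
  have cU := h.smooth_matDeriv.continuous_space ht
  rw [mul_add]
  unfold sqNorm
  rw [← integral_mul_sq_add_mul_sq cwxx cηx]
  refine integral_mono_of_continuous (by fun_prop) (by fun_prop) fun x hx => ?_
  have hpos := h.density_pos t x ht
  have hp := h.sq_dx_pressure_div_le ha hγ hm ht (hη x hx)
  have e1 : 2⁻¹ * (η t x * matDeriv w t x ^ 2) =
      2⁻¹ * (ν * dx (dx w) t x - dx (pressure a γ η) t x) ^ 2 / η t x := by
    rw [← h.density_mul_matDeriv ht]
    field_simp
  have h1 := (hη x hx).1
  set k := (γ * (a * M ^ γ) / m) ^ 2 with hk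
  have hk0 : 0 ≤ k := sq_nonneg _
  rw [e1, ← mul_add, div_mul_eq_mul_div]
  have e2 : 0 ≤ ν ^ 2 * dx η t x ^ 2 := by positivity
  have e3 : 0 ≤ k * dx (dx w) t x ^ 2 := by positivity
  refine div_le_div₀ (by positivity) ?_ hm h1
  linarith [sq_nonneg (ν * dx (dx w) t x + dx (pressure a γ η) t x)]

end IsSolution

lemma energyConst_pos {a γ ν m M : ℝ} (ha : 0 < a) (hγ : 1 ≤ γ) (hm : 0 < m) (hM : 0 < M) :
    0 < energyConst a γ ν m M := by
  unfold energyConst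
  positivity

/-- Decay of the material derivative in terms of the squared norms of the initial gradients. -/
theorem exists_matDeriv_decay {a γ ν ςlow ςbar E : ℝ} (ha : 0 < a) (hγ : 1 ≤ γ) (hν : 0 < ν)
    (hςlow : 0 < ςlow) (hςord : ςlow ≤ ςbar) (hE : 0 < E) :
    ∃ C α : ℝ, 0 < C ∧ 0 < α ∧ ∀ η w : ℝ → ℝ → ℝ, IsSolution a γ ν η w →
      (∀ x, η 0 x ∈ Icc ςlow ςbar) → sqNorm (dx w) 0 + sqNorm (dx η) 0 ≤ E →
      (∀ t, 0 ≤ t → ∫ x in (0 : ℝ)..1, η t x * matDeriv w t x ^ 2 ≤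
        C * (sqNorm (dx w) 0 + sqNorm (dx η) 0 + sqNorm (dx (dx w)) 0) * Real.exp (-α * t)) ∧
      ∫⁻ t in Ioi (0 : ℝ), ENNReal.ofReal (sqNorm (dx (matDeriv w)) t) ≤
        ENNReal.ofReal
          (C * (sqNorm (dx w) 0 + sqNorm (dx η) 0 + sqNorm (dx (dx w)) 0)) := by
  set K := energyConst a γ ν ςlow ςbar * E with hK
  set m := Real.exp (-(2⁻¹ * (4 / ν ^ 2 * K + 1))) with hm'
  set M := Real.exp (2⁻¹ * (4 / ν ^ 2 * K + 1)) with hM'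
  have hm : 0 < m := Real.exp_pos _
  have hM : 0 < M := Real.exp_pos _
  have hγ0 : 0 < γ := by linarith
  have hc₀ := energyConst_pos (ν := ν) ha hγ hςlow (hςlow.trans_le hςord)
  have hc : 0 < min ν (ν * γ * (a * m ^ γ / M ^ 3)) := lt_min hν (by positivity)
  obtain ⟨C, α, hC, hα, H⟩ := exists_decay_of_dissipation hc
    (energyConst_pos (ν := ν) ha hγ hm hM) (κ := ν / M)
    (C₁ := 2 * M / ν * ((γ * (a * M ^ γ) / m) ^ 2 / m ^ 2)) (C₂ := 2 * M / ν) (σ := ν / 2)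
    (ν := ν) (C₃ := (γ * (a * M ^ γ)) ^ 2 / ν)
    (CZ := (ν ^ 2 + (γ * (a * M ^ γ) / m) ^ 2) / m)
    (by positivity) (by positivity) (by positivity) (by positivity) hν (by positivity)
    (by positivity) hE
  refine ⟨C, α, hC, hα, fun η w h h₀ hE₀ => ?_⟩
  have hA0 : energy a γ ν η w 0 ≤ K :=
    (h.energy_le ha hγ hςlow le_rfl fun x _ => h₀ x).trans (mul_le_mul_of_nonneg_left hE₀ hc₀.le)
  have hA : ∀ t, 0 ≤ t → energy a γ ν η w t ≤ K := by
    intro t ht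
    refine le_trans (antitoneOn_Ici_of_hasDerivAt_nonpos
      h.smooth_energyDensity.continuousOn_integral
      (fun t ht => h.hasDerivAt_integral_energyDensity ht) (fun t ht => ?_)
      self_mem_Ici ht ht) hA0
    refine neg_nonpos.2 (intervalIntegral.integral_nonneg zero_le_one fun x _ => ?_)
    have := h.density_pos t x ht.le
    unfold pressure
    positivity
  have hη : ∀ t, 0 ≤ t → ∀ x ∈ Icc (0 : ℝ) 1, η t x ∈ Icc m M := fun t ht x hx =>
    h.density_mem_Icc ha hγ hν ht (hA t ht) hx
  have hq : Continuous fun t => sqNorm (dx (matDeriv w)) (max t 0) :=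
    (h.smooth_matDeriv.dx.pow 2).continuousOn_integral.comp_continuous (by fun_prop)
      fun t => le_max_right t 0
  obtain ⟨h1, h2⟩ := H (energy a γ ν η w) (sqNorm (dx w))
    (fun t => ∫ x in (0 : ℝ)..1, 2⁻¹ * (η t x * matDeriv w t x ^ 2)) (sqNorm (dx η))
    (sqNorm (dx (dx w))) (fun t => sqNorm (dx (matDeriv w)) (max t 0)) _ _ _
    h.smooth_energyDensity.continuousOn_integral
    (h.smooth_velocity.dx.pow 2).continuousOn_integral
    ((SmoothFwd.const 2⁻¹).mul
      (h.smooth_density.mul (h.smooth_matDeriv.pow 2))).continuousOn_integral hq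
    (fun t ht => h.hasDerivAt_integral_energyDensity ht)
    (fun t ht => h.hasDerivAt_integral_sq_dx_velocity ht)
    (fun t ht => h.hasDerivAt_integral_matDeriv ht)
    (fun t ht => h.energy_nonneg ha hγ ht) (fun t _ => sqNorm_nonneg _ t)
    (fun t ht => intervalIntegral.integral_nonneg zero_le_one fun x _ => by
      have := h.density_pos t x ht
      positivity)
    (fun t _ => sqNorm_nonneg _ t) (fun t _ => sqNorm_nonneg _ t) (fun t => sqNorm_nonneg _ _)
    (fun t ht => h.energy_le ha hγ hm ht (hη t ht))
    (fun t ht => h.integral_matDeriv_le ha hγ hm ht (hη t ht))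
    (fun t ht => h.dissipation_ge ha hγ hν hm ht (hη t ht))
    (fun t ht => h.gradient_dissipation_ge ha hγ hν hm ht (hη t ht))
    (fun t Y ht hY => by
      rw [max_eq_left ht]
      exact h.matDeriv_dissipation_ge ha hγ hν hm ht (hη t ht) hY) hE₀
  refine ⟨fun t ht => ?_, ?_⟩
  · have := h1 t ht
    rwa [intervalIntegral.integral_const_mul, mul_inv_cancel_left₀ two_ne_zero] at this
  · refine le_trans (le_of_eq (setLIntegral_congr_fun measurableSet_Ioi fun t ht => ?_))
      (lintegral_Ioi_le_of_integral_le hq (fun t => sqNorm_nonneg _ _) h2)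
    simp only [max_eq_left (mem_Ioi.1 ht).le]

lemma HSq_one (f : ℝ → ℝ) : HSq 1 f =
    (∫ x in (0 : ℝ)..1, f x ^ 2) + ∫ x in (0 : ℝ)..1, deriv f x ^ 2 := by
  simp [HSq, Finset.sum_range_succ]

lemma HSq_two (f : ℝ → ℝ) : HSq 2 f = HSq 1 f + ∫ x in (0 : ℝ)..1, deriv (deriv f) x ^ 2 := by
  simp [HSq, Finset.sum_range_succ]

lemma integral_sq_nonneg (f : ℝ → ℝ) : 0 ≤ ∫ x in (0 : ℝ)..1, f x ^ 2 :=
  intervalIntegral.integral_nonneg zero_le_one fun _ _ => sq_nonneg _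

lemma gradients_le_HSq_one (η w : ℝ → ℝ → ℝ) : sqNorm (dx w) 0 + sqNorm (dx η) 0 ≤
    HSq 1 (fun x => η 0 x - 1) + HSq 1 (w 0) := by
  have e : deriv (fun x => η 0 x - 1) = deriv (η 0) := by
    funext x
    exact deriv_sub_const _
  rw [HSq_one, HSq_one, e]
  have h1 := integral_sq_nonneg fun x => η 0 x - 1
  have h2 := integral_sq_nonneg (w 0)
  change (∫ x in (0 : ℝ)..1, deriv (w 0) x ^ 2) + (∫ x in (0 : ℝ)..1, deriv (η 0) x ^ 2) ≤ _
  linarith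

lemma gradients_le_HSq_two (η w : ℝ → ℝ → ℝ) :
    sqNorm (dx w) 0 + sqNorm (dx η) 0 + sqNorm (dx (dx w)) 0 ≤
      HSq 2 (fun x => η 0 x - 1) + HSq 2 (w 0) := by
  rw [HSq_two, HSq_two]
  have h1 := integral_sq_nonneg (deriv (deriv fun x => η 0 x - 1))
  have h2 := gradients_le_HSq_one η w
  change _ + (∫ x in (0 : ℝ)..1, deriv (deriv (w 0)) x ^ 2) ≤ _
  linarith

end NavierStokes

/-- **Decay estimates for the material derivative** (Proposition
`prop-Dtv-L2`): there are `C, α > 0`, depending only on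
`(a, γ, ν, ς̄₀, ς̲₀, Ē₁)`, such that every global smooth solution of the 1D
isentropic compressible Navier–Stokes system on `[0,∞) × 𝕋` with
`ς̲₀ ≤ η₀ ≤ ς̄₀`, `∫_𝕋 η₀ = 1`, `∫_𝕋 η₀ w₀ = 0` and
`E₁₀ = ‖η₀-1‖²_{H¹} + ‖w₀‖²_{H¹} ≤ Ē₁` satisfies, with
`E₂₀ = ‖η₀-1‖²_{H²} + ‖w₀‖²_{H²}` and `D_t w = ∂ₜ w + w ∂ₓ w`:
`∫_𝕋 η |D_t w|²(t) ≤ C E₂₀ e^{-α t}` for all `t ≥ 0`, and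
`∫₀^∞ ∫_𝕋 |∂ₓ (D_t w)|² ≤ C E₂₀` (time integral as lower Lebesgue integral). -/
theorem material_derivative_decay (a γ ν ςlow ςbar Ebar₁ : ℝ)
    (ha : 0 < a) (hγ1 : 1 ≤ γ) (hγ2 : γ ≤ 2) (hν : 0 < ν)
    (hςlow : 0 < ςlow) (hςord : ςlow ≤ ςbar) (hEbar₁ : 0 < Ebar₁) :
    ∃ C α : ℝ, 0 < C ∧ 0 < α ∧
      ∀ η w : ℝ → ℝ → ℝ,
        ContDiff ℝ (⊤ : ℕ∞) (Function.uncurry η) →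
        ContDiff ℝ (⊤ : ℕ∞) (Function.uncurry w) →
        (∀ t x : ℝ, η t (x + 1) = η t x) →
        (∀ t x : ℝ, w t (x + 1) = w t x) →
        (∀ t x : ℝ, 0 ≤ t → 0 < η t x) →
        (∀ t x : ℝ, 0 ≤ t →
          deriv (fun s => η s x) t + deriv (fun y => η t y * w t y) x = 0) →
        (∀ t x : ℝ, 0 ≤ t →
          η t x * (deriv (fun s => w s x) t + w t x * deriv (w t) x)
            - ν * deriv (deriv (w t)) x + deriv (fun y => a * η t y ^ γ) x = 0) →
        (∀ x : ℝ, ςlow ≤ η 0 x) →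
        (∀ x : ℝ, η 0 x ≤ ςbar) →
        (∫ x in (0:ℝ)..1, η 0 x) = 1 →
        (∫ x in (0:ℝ)..1, η 0 x * w 0 x) = 0 →
        HSq 1 (fun x => η 0 x - 1) + HSq 1 (w 0) ≤ Ebar₁ →
        (∀ t : ℝ, 0 ≤ t →
            (∫ x in (0:ℝ)..1, η t x * (matDeriv w t x) ^ 2)
              ≤ C * (HSq 2 (fun x => η 0 x - 1) + HSq 2 (w 0)) * Real.exp (-α * t)) ∧
          (∫⁻ t in Set.Ioi (0:ℝ),
              ENNReal.ofReal (∫ x in (0:ℝ)..1, (deriv (fun y => matDeriv w t y) x) ^ 2))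
            ≤ ENNReal.ofReal (C * (HSq 2 (fun x => η 0 x - 1) + HSq 2 (w 0))) := by
  obtain ⟨C, α, hC, hα, H⟩ :=
    NavierStokes.exists_matDeriv_decay ha hγ1 hν hςlow hςord hEbar₁
  refine ⟨C, α, hC, hα, fun η w hη hw pη pw hpos hcont hmom hlow hbar hmass hP hE => ?_⟩
  have h : NavierStokes.IsSolution a γ ν η w :=
    { smooth_density := fun _ _ _ => hη.contDiffAt
      smooth_velocity := fun _ _ _ => hw.contDiffAt
      periodic_density := pη
      periodic_velocity := pw
      density_pos := hpos
      continuity := hcont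
      momentum := hmom
      initial_mass := hmass
      initial_momentum := hP }
  obtain ⟨h1, h2⟩ := H η w h (fun x => ⟨hlow x, hbar x⟩)
    ((NavierStokes.gradients_le_HSq_one η w).trans hE)
  have hle := mul_le_mul_of_nonneg_left (NavierStokes.gradients_le_HSq_two η w) hC.le
  exact ⟨fun t ht => (h1 t ht).trans (mul_le_mul_of_nonneg_right hle (Real.exp_pos _).le),
    h2.trans (ENNReal.ofReal_le_ofReal hle)⟩
end
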